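/- There exist absolute constants c > 0 and C > 0 such that the following holds. Let n ≥ 100 and let P be a set of n points in the real projective plane ℝP² spanning at most Kn ordinary lines, where K is a real number with 1 ≤ K ≤ c·(log log n)^c. Then there is a set Z which is either (i) an irreducible cubic, (ii) the union of an irreducible conic and a line, or (iii) a line, such that all but at most C·K^C points of P lie on Z. -/

import Mathlib

/-- The real projective plane: one-dimensional subspaces of `ℝ³`. -/
abbrev RP2 := Projectivization ℝ (Fin 3 → ℝ)

/-- A line in `ℝP²`: the set of points contained in a fixed
two-dimensional linear subspace of `ℝ³`. -/
def IsProjLine (L : Set RP2) : Prop :=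
  ∃ W : Submodule ℝ (Fin 3 → ℝ), Module.finrank ℝ W = 2 ∧
    L = {x : RP2 | x.submodule ≤ W}

/-- The number of ordinary lines of `P`: lines containing exactly two points of `P`. -/
noncomputable def numOrdinaryLines (P : Set RP2) : ℕ :=
  {L : Set RP2 | IsProjLine L ∧ (P ∩ L).ncard = 2}.ncard

/-- An irreducible cubic in `ℝP²`: the zero set of an irreducible homogeneous
polynomial of degree `3` in three real variables. -/
def IsIrreducibleCubic (Z : Set RP2) : Prop :=
  ∃ p : MvPolynomial (Fin 3) ℝ, Irreducible p ∧ p.IsHomogeneous 3 ∧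
    Z = {x : RP2 | MvPolynomial.eval x.rep p = 0}

/-- An irreducible conic in `ℝP²`: the zero set of an irreducible homogeneous
polynomial of degree `2` in three real variables. -/
def IsIrreducibleConic (Z : Set RP2) : Prop :=
  ∃ p : MvPolynomial (Fin 3) ℝ, Irreducible p ∧ p.IsHomogeneous 2 ∧
    Z = {x : RP2 | MvPolynomial.eval x.rep p = 0}


set_option linter.unusedVariables false

namespace FOL

open Finset

attribute [local instance] Classical.propDecidable

/-- signed vertical distance of the dual point `v` from the dual line `p`. -/
def ev (p v : ℝ × ℝ) : ℝ := v.2 - p.1 * v.1 - p.2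

/-- lines through a point -/
noncomputable def thr (L : Finset (ℝ × ℝ)) (v : ℝ × ℝ) : Finset (ℝ × ℝ) :=
  L.filter (fun p => ev p v = 0)

noncomputable def inter (p q : ℝ × ℝ) : ℝ × ℝ :=
  ((q.2 - p.2) / (p.1 - q.1), p.1 * ((q.2 - p.2) / (p.1 - q.1)) + p.2)

/-- vertices of the arrangement -/
noncomputable def Vx (L : Finset (ℝ × ℝ)) : Finset (ℝ × ℝ) :=
  (L.offDiag).image (fun pq => inter pq.1 pq.2)

structure Gen (L : Finset (ℝ × ℝ)) : Prop where
  inj : ∀ p ∈ L, ∀ q ∈ L, p.1 = q.1 → p = q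
  gen : ∀ v ∈ Vx L, ∀ w ∈ Vx L, v.1 = w.1 → v = w

lemma ev_inter_left (p q : ℝ × ℝ) : ev p (inter p q) = 0 := by
  simp only [ev, inter]; ring

lemma ev_inter_right {p q : ℝ × ℝ} (h : p.1 ≠ q.1) : ev q (inter p q) = 0 := by
  have : p.1 - q.1 ≠ 0 := sub_ne_zero.2 h
  simp only [ev, inter]; field_simp; ring

lemma line_eq {p q v w : ℝ × ℝ} (h1 : ev p v = 0) (h2 : ev q v = 0) (h3 : ev p w = 0)
    (h4 : ev q w = 0) (h : v ≠ w) : p = q := by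
  simp only [ev] at *
  have hx : v.1 ≠ w.1 := by
    intro hx
    apply h
    ext
    · exact hx
    · rw [hx] at h1; linarith
  have hx' : v.1 - w.1 ≠ 0 := sub_ne_zero.2 hx
  have e1 : (p.1 - q.1) * (v.1 - w.1) = 0 := by linarith
  have e2 : p.1 = q.1 := by
    rcases mul_eq_zero.1 e1 with h | h
    · linarith
    · exact absurd h hx'
  ext
  · exact e2
  · rw [e2] at h1; linarith

lemma pt_eq {p q v w : ℝ × ℝ} (h1 : ev p v = 0) (h2 : ev q v = 0) (h3 : ev p w = 0)
    (h4 : ev q w = 0) (h : p ≠ q) : v = w := by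
  by_contra hh
  exact h (line_eq h1 h2 h3 h4 hh)

lemma pt_eq_x {p v w : ℝ × ℝ} (h1 : ev p v = 0) (h3 : ev p w = 0) (h : v.1 = w.1) : v = w := by
  simp only [ev] at *
  ext
  · exact h
  · rw [h] at h1; linarith

variable {L : Finset (ℝ × ℝ)}

lemma mem_thr {p v : ℝ × ℝ} : p ∈ thr L v ↔ p ∈ L ∧ ev p v = 0 := by
  simp [thr]

lemma mem_Vx (hL : Gen L) {v : ℝ × ℝ} :
    v ∈ Vx L ↔ ∃ p ∈ L, ∃ q ∈ L, p ≠ q ∧ ev p v = 0 ∧ ev q v = 0 := by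
  simp only [Vx, Finset.mem_image, Finset.mem_offDiag]
  constructor
  · rintro ⟨⟨p, q⟩, ⟨hp, hq, hne⟩, rfl⟩
    refine ⟨_, hp, _, hq, hne, ev_inter_left _ _, ev_inter_right ?_⟩
    intro h; exact hne (hL.inj _ hp _ hq h)
  · rintro ⟨p, hp, q, hq, hne, h1, h2⟩
    refine ⟨(p, q), ⟨hp, hq, hne⟩, ?_⟩
    have hx : p.1 ≠ q.1 := fun h => hne (hL.inj _ hp _ hq h)
    exact pt_eq (ev_inter_left p q) (ev_inter_right hx) h1 h2 hne

lemma two_le_thr (hL : Gen L) {v : ℝ × ℝ} (hv : v ∈ Vx L) : 2 ≤ (thr L v).card := by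
  obtain ⟨p, hp, q, hq, hne, h1, h2⟩ := (mem_Vx hL).1 hv
  have : ({p, q} : Finset (ℝ × ℝ)) ⊆ thr L v := by
    intro x hx
    simp only [Finset.mem_insert, Finset.mem_singleton] at hx
    rcases hx with rfl | rfl
    · exact mem_thr.2 ⟨hp, h1⟩
    · exact mem_thr.2 ⟨hq, h2⟩
  calc 2 = ({p, q} : Finset (ℝ × ℝ)).card := (Finset.card_pair hne).symm
    _ ≤ _ := Finset.card_le_card this

def clr (L : Finset (ℝ × ℝ)) (p v w : ℝ × ℝ) : Prop :=
  ∀ u ∈ Vx L, ev p u = 0 → 0 ≤ (u.1 - v.1) * (u.1 - w.1)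

lemma uns_of_clear (hL : Gen L) {p v w : ℝ × ℝ} (hp : p ∈ L) (hv : ev p v = 0) (hw : ev p w = 0)
    (hc : clr L p v w) : ∀ s ∈ L, 0 ≤ ev s v * ev s w := by
  intro s hs
  by_contra hneg
  push Not at hneg
  have hsp : s ≠ p := by
    rintro rfl; rw [hv] at hneg; simp at hneg
  have hx : p.1 ≠ s.1 := fun h => hsp (hL.inj _ hs _ hp h.symm)
  have hx' : p.1 - s.1 ≠ 0 := sub_ne_zero.2 hx
  have hu : inter p s ∈ Vx L :=
    (mem_Vx hL).2 ⟨p, hp, s, hs, hsp.symm, ev_inter_left _ _, ev_inter_right hx⟩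
  have h := hc _ hu (ev_inter_left _ _)
  have e1 : ev s v = (p.1 - s.1) * (v.1 - (inter p s).1) := by
    simp only [ev, inter] at *; field_simp; linarith
  have e2 : ev s w = (p.1 - s.1) * (w.1 - (inter p s).1) := by
    simp only [ev, inter] at *; field_simp; linarith
  rw [e1, e2] at hneg
  have : 0 < (p.1 - s.1)^2 := by positivity
  nlinarith

lemma clear_of_uns (hL : Gen L) {p v w : ℝ × ℝ} (hv : ev p v = 0) (hw : ev p w = 0)
    (hu : ∀ s ∈ L, 0 ≤ ev s v * ev s w) : clr L p v w := by
  intro u huV hup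
  obtain ⟨s, hs, t, ht, hne, h1, h2⟩ := (mem_Vx hL).1 huV
  have : ∃ s ∈ L, s ≠ p ∧ ev s u = 0 := by
    by_cases h : s = p
    · exact ⟨t, ht, fun h' => hne (by rw [h, h']), h2⟩
    · exact ⟨s, hs, h, h1⟩
  obtain ⟨s, hs, hsp, h1⟩ := this
  have h := hu s hs
  by_cases hx : p.1 = s.1
  · exfalso
    apply hsp
    ext
    · exact hx.symm
    · simp only [ev] at *; rw [hx] at hup; linarith
  have e1 : ev s v = (p.1 - s.1) * (v.1 - u.1) := by simp only [ev] at *; linarith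
  have e2 : ev s w = (p.1 - s.1) * (w.1 - u.1) := by simp only [ev] at *; linarith
  rw [e1, e2] at h
  have : 0 < (p.1 - s.1)^2 := by have := sub_ne_zero.2 hx; positivity
  by_contra hneg
  push Not at hneg
  nlinarith

/-- adjacency along the line `p` -/
structure Adj (L : Finset (ℝ × ℝ)) (p v w : ℝ × ℝ) : Prop where
  hp : p ∈ L
  hv : v ∈ Vx L
  hw : w ∈ Vx L
  ne : v ≠ w
  ev1 : ev p v = 0
  ev2 : ev p w = 0
  uns : ∀ s ∈ L, 0 ≤ ev s v * ev s w

lemma Adj.symm {p v w : ℝ × ℝ} (h : Adj L p v w) : Adj L p w v :=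
  ⟨h.hp, h.hw, h.hv, h.ne.symm, h.ev2, h.ev1, fun s hs => by rw [mul_comm]; exact h.uns s hs⟩

lemma Adj.xne {p v w : ℝ × ℝ} (h : Adj L p v w) : v.1 ≠ w.1 :=
  fun hx => h.ne (pt_eq_x h.ev1 h.ev2 hx)

lemma Adj.clr (hL : Gen L) {p v w : ℝ × ℝ} (h : Adj L p v w) : clr L p v w :=
  clear_of_uns hL h.ev1 h.ev2 h.uns

lemma adj_of_clr (hL : Gen L) {p v w : ℝ × ℝ} (hp : p ∈ L) (hv : v ∈ Vx L) (hw : w ∈ Vx L)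
    (ne : v ≠ w) (h1 : ev p v = 0) (h2 : ev p w = 0) (hc : clr L p v w) : Adj L p v w :=
  ⟨hp, hv, hw, ne, h1, h2, uns_of_clear hL hp h1 h2 hc⟩

lemma ray_unique (hL : Gen L) {p v w w' : ℝ × ℝ} (h : Adj L p v w) (h' : Adj L p v w')
    (hs : 0 < (w.1 - v.1) * (w'.1 - v.1)) : w = w' := by
  apply pt_eq_x h.ev2 h'.ev2
  have h1 := h.clr hL w' h'.hw h'.ev2
  have h2 := h'.clr hL w h.hw h.ev2
  have : (w.1 - w'.1)^2 ≤ 0 := by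
    rcases lt_or_ge v.1 w.1 with hh | hh
    · have : 0 < w.1 - v.1 := by linarith
      have h3 : 0 < w'.1 - v.1 := by
        by_contra hc; push Not at hc; nlinarith
      have : w.1 ≤ w'.1 := by by_contra hc; push Not at hc; nlinarith
      have : w'.1 ≤ w.1 := by by_contra hc; push Not at hc; nlinarith
      nlinarith
    · have : w.1 - v.1 < 0 := by
        rcases eq_or_lt_of_le hh with h | h
        · rw [h] at hs; simp at hs
        · linarith
      have h3 : w'.1 - v.1 < 0 := by
        by_contra hc; push Not at hc; nlinarith
      have : w.1 ≤ w'.1 := by by_contra hc; push Not at hc; nlinarith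
      have : w'.1 ≤ w.1 := by by_contra hc; push Not at hc; nlinarith
      nlinarith
  nlinarith

lemma line_unique {p q v w : ℝ × ℝ} (h : Adj L p v w) (h' : Adj L q v w) : p = q :=
  line_eq h.ev1 h'.ev1 h.ev2 h'.ev2 h.ne

/-- two triangles on the same side of an edge share the line at `v`. -/
lemma apex_line {p A A' v w z z' : ℝ × ℝ} (h : Adj L p v w) (hA : Adj L A v z)
    (hA' : Adj L A' v z') (hs : 0 < ev p z * ev p z') (h1 : 0 ≤ ev A w * ev A z')
    (h2 : 0 ≤ ev A' w * ev A' z) : A.1 = A'.1 := by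
  have a1 := h.ev1; have a2 := h.ev2; have a3 := hA.ev1; have a4 := hA.ev2
  have a5 := hA'.ev1; have a6 := hA'.ev2
  have ht := sub_ne_zero.2 h.xne
  have e1 : ev A w = (p.1 - A.1) * (w.1 - v.1) := by simp only [ev] at *; linarith
  have e2 : ev A z' = (A'.1 - A.1) * (z'.1 - v.1) := by simp only [ev] at *; linarith
  have e3 : ev A' w = (p.1 - A'.1) * (w.1 - v.1) := by simp only [ev] at *; linarith
  have e4 : ev A' z = (A.1 - A'.1) * (z.1 - v.1) := by simp only [ev] at *; linarith
  have e5 : ev p z = (A.1 - p.1) * (z.1 - v.1) := by simp only [ev] at *; linarith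
  have e6 : ev p z' = (A'.1 - p.1) * (z'.1 - v.1) := by simp only [ev] at *; linarith
  rw [e5, e6] at hs
  rw [e1, e2] at h1
  rw [e3, e4] at h2
  have h3 := mul_nonneg h1 h2
  by_contra hne
  have hne' := sub_ne_zero.2 hne
  have hpos : 0 < (v.1 - w.1)^2 * (A.1 - A'.1)^2 := by positivity
  have h4 := mul_pos hpos hs
  nlinarith

lemma apex_line' (hL : Gen L) {p A A' v w z z' : ℝ × ℝ} (h : Adj L p v w) (hA : Adj L A v z)
    (hA' : Adj L A' v z') (hs : 0 < ev p z * ev p z') (h1 : 0 ≤ ev A w * ev A z')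
    (h2 : 0 ≤ ev A' w * ev A' z) : A = A' :=
  hL.inj _ hA.hp _ hA'.hp (apex_line h hA hA' hs h1 h2)

lemma apex_unique (hL : Gen L) {p A A' D D' v w z z' : ℝ × ℝ} (h : Adj L p v w) (hA : Adj L A v z)
    (hA' : Adj L A' v z') (hD : Adj L D w z) (hD' : Adj L D' w z')
    (hs : 0 < ev p z * ev p z') : z = z' := by
  have hAA : A = A' := apex_line' hL h hA hA' hs (hD'.uns _ hA.hp) (hD.uns _ hA'.hp)
  have hDD : D = D' := apex_line' hL h.symm hD hD' hs (hA'.uns _ hD.hp) (hA.uns _ hD'.hp)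
  subst hAA; subst hDD
  apply pt_eq hA.ev2 hD.ev2 hA'.ev2 hD'.ev2
  rintro rfl
  have : p = A := line_eq h.ev1 hA.ev1 h.ev2 hD.ev1 h.ne
  subst this
  rw [hA.ev2] at hs; simp at hs

/-! ### hits -/

structure Hit (L : Finset (ℝ × ℝ)) (δ ε : ℝ) (w p q v : ℝ × ℝ) : Prop where
  hp : p ∈ L
  hq : q ∈ L
  hv : v ∈ Vx L
  hw : w ∈ Vx L
  pv : ev p v = 0
  qv : ev q v = 0
  pw : ev p w = 0
  lt : δ * v.1 < δ * w.1
  cp : clr L p v w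
  cq : clr L q v w
  low : ε * ev q w < 0
  mid : ∀ s ∈ L, ev s v = 0 → ¬ (0 < (s.1 - p.1) * (q.1 - s.1))

lemma sgn_sq {δ : ℝ} (h : δ = 1 ∨ δ = -1) : δ * δ = 1 := by
  rcases h with rfl | rfl <;> norm_num

lemma hit_lowest (hL : Gen L) {δ ε : ℝ} (hδ : δ = 1 ∨ δ = -1) (hε : ε = 1 ∨ ε = -1)
    {w p q v : ℝ × ℝ} (h : Hit L δ ε w p q v) :
    ∀ s ∈ L, ε * ev s w < 0 → ε * ev s w ≤ ε * ev q w := by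
  intro s hs hlow
  by_contra hgt
  push Not at hgt
  set wq : ℝ × ℝ := (w.1, q.1 * w.1 + q.2) with hwq
  have hq0 : ev q wq = 0 := by simp [ev, hwq]
  have u1 := uns_of_clear hL h.hq h.qv hq0 (by
    intro u hu hqu; exact h.cq u hu hqu) s hs
  have u2 := uns_of_clear hL h.hp h.pv h.pw h.cp s hs
  have e : ev s wq = ev s w - ev q w := by simp [ev, hwq]; ring
  have hpos : 0 < ε * ev s wq := by rw [e]; linarith
  have hzero : ev s v = 0 := by
    by_contra hne
    rcases hε with rfl | rfl <;> rcases lt_or_gt_of_ne hne with h' | h' <;> nlinarith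
  apply h.mid s hs hzero
  have hpv := h.pv
  have hqv := h.qv
  have hpw := h.pw
  have e1 : ev s w = (p.1 - s.1) * (w.1 - v.1) := by simp only [ev] at *; linarith
  have e2 : ev s wq = (q.1 - s.1) * (w.1 - v.1) := by simp only [ev, hwq] at *; linarith
  rw [e1] at hlow
  rw [e2] at hpos
  have hε2 := sgn_sq hε
  have hx : 0 < (w.1 - v.1)^2 := by
    have := h.lt
    have : w.1 - v.1 ≠ 0 := by intro h0; have : w.1 = v.1 := by linarith
                               simp [this] at *
    positivity
  by_contra hcon
  push Not at hcon
  have h5 : 0 < (ε * ((s.1 - p.1) * (w.1 - v.1))) * (ε * ((q.1 - s.1) * (w.1 - v.1))) := by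
    apply mul_pos _ hpos; linarith
  have h6 : (ε * ((s.1 - p.1) * (w.1 - v.1))) * (ε * ((q.1 - s.1) * (w.1 - v.1)))
    = (ε * ε) * ((w.1 - v.1)^2 * ((s.1 - p.1) * (q.1 - s.1))) := by ring
  rw [h6, hε2] at h5
  nlinarith

lemma hit_q_unique (hL : Gen L) {δ δ' ε : ℝ} (hδ : δ = 1 ∨ δ = -1) (hδ' : δ' = 1 ∨ δ' = -1)
    (hε : ε = 1 ∨ ε = -1) {w p q v p' q' v' : ℝ × ℝ} (h : Hit L δ ε w p q v)
    (h' : Hit L δ' ε w p' q' v') : q = q' := by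
  have h1 := hit_lowest hL hδ hε h q' h'.hq h'.low
  have h2 := hit_lowest hL hδ' hε h' q h.hq h.low
  have he : ev q w = ev q' w := by
    rcases hε with rfl | rfl <;> linarith
  by_contra hne
  have hz : (w.1, q.1 * w.1 + q.2) ∈ Vx L := by
    apply (mem_Vx hL).2 ⟨q, h.hq, q', h'.hq, hne, ?_, ?_⟩
    · simp [ev]
    · simp only [ev] at *; linarith
  have := hL.gen _ hz w h.hw rfl
  have h3 : ev q w = 0 := by rw [← this]; simp [ev]
  have := h.low
  rw [h3] at this; simp at this

lemma hit_unique (hL : Gen L) {δ ε : ℝ} (hδ : δ = 1 ∨ δ = -1)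
    (hε : ε = 1 ∨ ε = -1) {w p q v p' q' v' : ℝ × ℝ} (h : Hit L δ ε w p q v)
    (h' : Hit L δ ε w p' q' v') : q = q' ∧ v = v' ∧ p = p' := by
  have hq := hit_q_unique hL hδ hδ hε h h'
  subst hq
  have hv : v = v' := by
    apply pt_eq_x h.qv h'.qv
    have h1 := h.cq v' h'.hv h'.qv
    have h2 := h'.cq v h.hv h.qv
    have h3 := h.lt
    have h4 := h'.lt
    rcases hδ with rfl | rfl
    · apply le_antisymm <;> by_contra hc <;> push Not at hc <;> nlinarith
    · apply le_antisymm <;> by_contra hc <;> push Not at hc <;> nlinarith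
  subst hv
  refine ⟨rfl, rfl, line_eq h.pv h'.pv h.pw h'.pw ?_⟩
  rintro rfl
  exact lt_irrefl _ h.lt

/-- sectors -/
noncomputable def Sec (L : Finset (ℝ × ℝ)) (δ : ℝ) : Finset ((ℝ × ℝ) × (ℝ × ℝ)) :=
  (Vx L ×ˢ L).filter (fun vp => ev vp.2 vp.1 = 0 ∧ ∃ q ∈ L, ev q vp.1 = 0 ∧ δ * vp.2.1 < δ * q.1)

lemma card_Sec (hL : Gen L) {δ : ℝ} (hδ : δ = 1 ∨ δ = -1) :
    (Sec L δ).card + (Vx L).card = ∑ v ∈ Vx L, (thr L v).card := by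
  have h1 : (Sec L δ).card = ∑ v ∈ Vx L, ((thr L v).card - 1) := by
    rw [Finset.card_eq_sum_card_fiberwise (f := Prod.fst) (t := Vx L)]
    · apply Finset.sum_congr rfl
      intro v hv
      have hne : (thr L v).Nonempty := by
        have := two_le_thr hL hv
        exact Finset.card_pos.1 (by omega)
      obtain ⟨m, hm, hmax⟩ := Finset.exists_max_image (thr L v) (fun q => δ * q.1) hne
      rw [← Finset.card_erase_of_mem hm]
      apply Finset.card_bij (fun vp _ => vp.2)
      · rintro ⟨v', p⟩ hvp
        simp only [Sec, Finset.mem_filter, Finset.mem_product] at hvp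
        obtain ⟨⟨⟨hv', hpL⟩, hev, q, hq, hqv, hlt⟩, rfl⟩ := hvp
        rw [Finset.mem_erase]
        refine ⟨?_, mem_thr.2 ⟨hpL, hev⟩⟩
        rintro rfl
        exact absurd (hmax q (mem_thr.2 ⟨hq, hqv⟩)) (not_le.2 hlt)
      · rintro ⟨v1, p1⟩ h1 ⟨v2, p2⟩ h2 h
        simp only [Finset.mem_filter] at h1 h2
        ext1
        · exact h1.2.trans h2.2.symm
        · exact h
      · intro p hp
        rw [Finset.mem_erase] at hp
        obtain ⟨hpL, hpv⟩ := mem_thr.1 hp.2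
        refine ⟨(v, p), ?_, rfl⟩
        simp only [Sec, Finset.mem_filter, Finset.mem_product]
        refine ⟨⟨⟨hv, hpL⟩, hpv, m, (mem_thr.1 hm).1, (mem_thr.1 hm).2, ?_⟩, trivial⟩
        apply lt_of_le_of_ne (hmax p hp.2)
        intro he
        apply hp.1
        apply hL.inj _ hpL _ (mem_thr.1 hm).1
        rcases hδ with rfl | rfl <;> linarith
    · intro x hx
      simp only [Sec, Finset.coe_filter, Finset.mem_product, Set.mem_ofPred_eq] at hx
      exact hx.1.1
  rw [h1, Finset.card_eq_sum_ones, ← Finset.sum_add_distrib]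
  apply Finset.sum_congr rfl
  intro v hv
  have := two_le_thr hL hv
  omega

noncomputable def Corn (L : Finset (ℝ × ℝ)) (δ : ℝ) : Finset ((ℝ × ℝ) × ℝ) :=
  (Vx L ×ˢ ({1, -1} : Finset ℝ)).filter (fun c => ∃ p q v, Hit L δ c.2 c.1 p q v)

lemma sec_hit (hL : Gen L) {δ : ℝ} (hδ : δ = 1 ∨ δ = -1) {v p : ℝ × ℝ} (h : (v, p) ∈ Sec L δ)
    (hn : ∃ u ∈ Vx L, ev p u = 0 ∧ δ * v.1 < δ * u.1) :
    ∃ w q, Hit L δ 1 w p q v ∧ δ * p.1 < δ * q.1 ∨ Hit L δ (-1) w q p v ∧ δ * p.1 < δ * q.1 := by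
  simp only [Sec, Finset.mem_filter, Finset.mem_product] at h
  obtain ⟨⟨hv, hpL⟩, hpv, q0, hq0, hq0v, hq0lt⟩ := h
  obtain ⟨q, hq, hqmin⟩ := Finset.exists_min_image ((thr L v).filter (fun q => δ * p.1 < δ * q.1))
    (fun q => δ * q.1) ⟨q0, by simp [mem_thr, hq0, hq0v, hq0lt]⟩
  rw [Finset.mem_filter, mem_thr] at hq
  obtain ⟨⟨hqL, hqv⟩, hpq⟩ := hq
  obtain ⟨u0, hu0, hpu0, hu0lt⟩ := hn
  obtain ⟨w, hw, hwmin⟩ := Finset.exists_min_image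
    ((Vx L).filter (fun u => (ev p u = 0 ∨ ev q u = 0) ∧ δ * v.1 < δ * u.1))
    (fun q => δ * q.1) ⟨u0, by simp [hu0, hpu0, hu0lt]⟩
  rw [Finset.mem_filter] at hw
  obtain ⟨hwV, hw0, hwlt⟩ := hw
  have hmid : ∀ s ∈ L, ev s v = 0 → ¬ (0 < (s.1 - p.1) * (q.1 - s.1)) := by
    intro s hs hsv hcon
    by_cases hh : δ * p.1 < δ * s.1
    · have := hqmin s (by simp [mem_thr, hs, hsv, hh])
      rcases hδ with rfl | rfl <;> nlinarith
    · rcases hδ with rfl | rfl <;> nlinarith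
  have hc : ∀ r, (r = p ∨ r = q) → clr L r v w := by
    intro r hr u hu hru
    by_cases hh : δ * v.1 < δ * u.1
    · have := hwmin u (by
        simp only [Finset.mem_filter]
        refine ⟨hu, ?_, hh⟩
        rcases hr with rfl | rfl <;> simp [hru])
      rcases hδ with rfl | rfl <;> nlinarith
    · rcases hδ with rfl | rfl <;> nlinarith
  refine ⟨w, q, ?_⟩
  rcases hw0 with hw0 | hw0
  · left
    refine ⟨⟨hpL, hqL, hv, hwV, hpv, hqv, hw0, hwlt, hc p (Or.inl rfl), hc q (Or.inr rfl), ?_, hmid⟩, hpq⟩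
    have e : ev q w = (p.1 - q.1) * (w.1 - v.1) := by simp only [ev] at *; linarith
    rw [e]
    rcases hδ with rfl | rfl <;> nlinarith
  · right
    refine ⟨⟨hqL, hpL, hv, hwV, hqv, hpv, hw0, hwlt, hc q (Or.inr rfl), hc p (Or.inl rfl), ?_, ?_⟩, hpq⟩
    · have e : ev p w = (q.1 - p.1) * (w.1 - v.1) := by simp only [ev] at *; linarith
      rw [e]
      rcases hδ with rfl | rfl <;> nlinarith
    · intro s hs hsv hcon
      apply hmid s hs hsv; linarith

lemma card_Corn (hL : Gen L) {δ : ℝ} (hδ : δ = 1 ∨ δ = -1) :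
    ∑ v ∈ Vx L, (thr L v).card ≤ (Vx L).card + L.card + (Corn L δ).card := by
  rw [← card_Sec hL hδ]
  set S1 := (Sec L δ).filter (fun vp => ¬ ∃ u ∈ Vx L, ev vp.2 u = 0 ∧ δ * vp.1.1 < δ * u.1) with hS1
  set S2 := (Sec L δ).filter (fun vp => ∃ u ∈ Vx L, ev vp.2 u = 0 ∧ δ * vp.1.1 < δ * u.1) with hS2
  have hcard : S2.card + S1.card = (Sec L δ).card :=
    Finset.card_filter_add_card_filter_not (s := Sec L δ) _
  have h1 : S1.card ≤ L.card := by
    apply Finset.card_le_card_of_injOn Prod.snd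
    · rintro ⟨v, p⟩ h
      simp only [hS1, Sec, Finset.coe_filter, Finset.mem_filter, Finset.mem_product, Set.mem_ofPred_eq] at h
      exact h.1.1.2
    · rintro ⟨v, p⟩ h ⟨v', p'⟩ h' hpp
      simp only [hS1, Sec, Finset.coe_filter, Finset.mem_filter, Finset.mem_product, Set.mem_ofPred_eq] at h h'
      simp only at hpp
      subst hpp
      obtain ⟨⟨⟨hv, hp⟩, hpv, -⟩, hl⟩ := h
      obtain ⟨⟨⟨hv', -⟩, hpv', -⟩, hl'⟩ := h'
      push Not at hl hl'
      have a := hl v' hv' hpv'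
      have b := hl' v hv hpv
      have : v = v' := by
        apply pt_eq_x hpv hpv'
        rcases hδ with rfl | rfl <;> linarith
      rw [this]
  have h2 : S2.card ≤ (Corn L δ).card := by
    have key : ∀ vp ∈ S2, ∃ c : (ℝ × ℝ) × ℝ, c ∈ Corn L δ ∧ ∃ q, δ * vp.2.1 < δ * q.1 ∧
        ((c.2 = 1 ∧ Hit L δ c.2 c.1 vp.2 q vp.1) ∨ (c.2 = -1 ∧ Hit L δ c.2 c.1 q vp.2 vp.1)) := by
      rintro ⟨v, p⟩ h
      rw [hS2, Finset.mem_filter] at h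
      obtain ⟨w, q, h | h⟩ := sec_hit hL hδ h.1 h.2
      · refine ⟨(w, 1), ?_, q, h.2, Or.inl ⟨rfl, h.1⟩⟩
        simp only [Corn, Finset.mem_filter, Finset.mem_product]
        exact ⟨⟨h.1.hw, by simp⟩, _, _, _, h.1⟩
      · refine ⟨(w, -1), ?_, q, h.2, Or.inr ⟨rfl, h.1⟩⟩
        simp only [Corn, Finset.mem_filter, Finset.mem_product]
        exact ⟨⟨h.1.hw, by simp⟩, _, _, _, h.1⟩
    choose! f hf using key
    apply Finset.card_le_card_of_injOn f
    · intro x hx; exact (hf x hx).1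
    · rintro ⟨v, p⟩ h ⟨v', p'⟩ h' hff
      obtain ⟨-, q, hlt, hq⟩ := hf _ h
      obtain ⟨-, q', hlt', hq'⟩ := hf _ h'
      rw [← hff] at hq'
      simp only at hq hq'
      rcases hq with ⟨e, hq⟩ | ⟨e, hq⟩ <;> rcases hq' with ⟨e', hq'⟩ | ⟨e', hq'⟩
      · obtain ⟨-, rfl, rfl⟩ := hit_unique hL hδ (Or.inl e) hq hq'; rfl
      · rw [e] at e'; norm_num at e'
      · rw [e] at e'; norm_num at e'
      · obtain ⟨rfl, rfl, -⟩ := hit_unique hL hδ (Or.inr e) hq hq'; rfl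
  omega

end FOL

set_option linter.unusedVariables false
namespace FOL

open Finset

attribute [local instance] Classical.propDecidable

variable {L : Finset (ℝ × ℝ)}

structure Ap (L : Finset (ℝ × ℝ)) (p v w z : ℝ × ℝ) (ε : ℝ) : Prop where
  adj : Adj L p v w
  lt : v.1 < w.1
  pos : 0 < ε * ev p z
  a1 : ∃ A, Adj L A v z
  a2 : ∃ D, Adj L D w z

lemma Ap.unique (hL : Gen L) {p v w z w' z' : ℝ × ℝ} {ε : ℝ} (h : Ap L p v w z ε)
    (h' : Ap L p v w' z' ε) : w = w' ∧ z = z' := by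
  have hw : w = w' := ray_unique hL h.adj h'.adj
    (mul_pos (by linarith [h.lt]) (by linarith [h'.lt]))
  subst hw
  obtain ⟨A, hA⟩ := h.a1
  obtain ⟨D, hD⟩ := h.a2
  obtain ⟨A', hA'⟩ := h'.a1
  obtain ⟨D', hD'⟩ := h'.a2
  refine ⟨rfl, apex_unique hL h.adj hA hA' hD hD' ?_⟩
  have := mul_pos h.pos h'.pos
  by_contra hc
  push Not at hc
  nlinarith [sq_nonneg ε]

noncomputable def GC (L : Finset (ℝ × ℝ)) : Finset ((ℝ × ℝ) × ℝ) := Corn L 1 ∩ Corn L (-1)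

lemma card_GC (hL : Gen L) :
    2 * ∑ v ∈ Vx L, (thr L v).card ≤ 4 * (Vx L).card + 2 * L.card + (GC L).card := by
  have h1 := card_Corn hL (δ := 1) (Or.inl rfl)
  have h2 := card_Corn hL (δ := -1) (Or.inr rfl)
  have h3 := Finset.card_union_add_card_inter (Corn L 1) (Corn L (-1))
  have h4 : (Corn L 1 ∪ Corn L (-1)).card ≤ (Vx L ×ˢ ({1, -1} : Finset ℝ)).card := by
    apply Finset.card_le_card
    apply Finset.union_subset <;> exact Finset.filter_subset _ _
  have h5 : ({1, -1} : Finset ℝ).card = 2 := by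
    rw [Finset.card_pair]; norm_num
  rw [Finset.card_product, h5] at h4
  unfold GC
  omega

lemma card_I (hL : Gen L) :
    ∑ v ∈ Vx L, (thr L v).card ≤ 3 * (Vx L).card + L.card := by
  have h1 := card_Corn hL (δ := 1) (Or.inl rfl)
  have h4 : (Corn L 1).card ≤ (Vx L ×ˢ ({1, -1} : Finset ℝ)).card := by
    apply Finset.card_le_card
    exact Finset.filter_subset _ _
  have h5 : ({1, -1} : Finset ℝ).card = 2 := by
    rw [Finset.card_pair]; norm_num
  rw [Finset.card_product, h5] at h4
  omega

lemma gc_tri (hL : Gen L) {w : ℝ × ℝ} {ε : ℝ} (h : (w, ε) ∈ GC L) :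
    (ε = 1 ∨ ε = -1) ∧ ∃ p q v p' v', v.1 < w.1 ∧ w.1 < v'.1 ∧ Ap L p v w v' ε ∧ Ap L p' w v' v ε ∧
      Ap L q v v' w (-ε) := by
  simp only [GC, Corn, Finset.mem_inter, Finset.mem_filter, Finset.mem_product, Finset.mem_insert,
    Finset.mem_singleton] at h
  obtain ⟨⟨⟨hw, hε⟩, p, q, v, h1⟩, -, p', q', v', h2⟩ := h
  refine ⟨hε, p, q, v, p', v', ?_⟩
  have hq := hit_q_unique hL (Or.inl rfl) (Or.inr rfl) hε h1 h2
  subst hq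
  have l1 : v.1 < w.1 := by have := h1.lt; linarith
  have l2 : w.1 < v'.1 := by have := h2.lt; linarith
  have n1 : v ≠ w := by rintro rfl; exact lt_irrefl _ l1
  have n2 : v' ≠ w := by rintro rfl; exact lt_irrefl _ l2
  have n3 : v ≠ v' := by rintro rfl; linarith
  have ad1 : Adj L p v w := adj_of_clr hL h1.hp h1.hv h1.hw n1 h1.pv h1.pw h1.cp
  have ad2 : Adj L p' v' w := adj_of_clr hL h2.hp h2.hv h2.hw n2 h2.pv h2.pw h2.cp
  have ad3 : Adj L q v v' := by
    apply adj_of_clr hL h1.hq h1.hv h2.hv n3 h1.qv h2.qv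
    intro u hu hqu
    have c1 := h1.cq u hu hqu
    have c2 := h2.cq u hu hqu
    have hne : u.1 ≠ w.1 := by
      intro he
      have := hL.gen u hu w h1.hw he
      subst this
      have := h1.low
      rw [hqu] at this; simp at this
    rcases lt_or_gt_of_ne hne with hh | hh
    · nlinarith
    · nlinarith
  have b1 := h1.pv; have b2 := h1.pw; have b3 := h1.qv; have b4 := h2.pv; have b5 := h2.pw
  have b6 := h2.qv
  have low := h1.low
  refine ⟨l1, l2, ⟨ad1, l1, ?_, ⟨_, ad3⟩, ⟨_, ad2.symm⟩⟩, ⟨ad2.symm, l2, ?_, ⟨_, ad1.symm⟩, ⟨_, ad3.symm⟩⟩,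
    ⟨ad3, by linarith, by linarith, ⟨_, ad1⟩, ⟨_, ad2⟩⟩⟩
  · have e1 : ev q w = (p.1 - q.1) * (w.1 - v.1) := by simp only [ev] at *; linarith
    have e2 : ev p v' = (q.1 - p.1) * (v'.1 - v.1) := by simp only [ev] at *; linarith
    rw [e1] at low; rw [e2]
    have : 0 < ε * (q.1 - p.1) := by
      by_contra hc; push Not at hc; nlinarith
    have := mul_pos this (show 0 < v'.1 - v.1 by linarith)
    linarith
  · have e1 : ev q w = (p'.1 - q.1) * (w.1 - v'.1) := by simp only [ev] at *; linarith
    have e2 : ev p' v = (q.1 - p'.1) * (v.1 - v'.1) := by simp only [ev] at *; linarith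
    rw [e1] at low; rw [e2]
    have : 0 < ε * (p'.1 - q.1) := by
      by_contra hc; push Not at hc; nlinarith
    have := mul_pos this (show 0 < v'.1 - v.1 by linarith)
    linarith

/-- edge sides -/
noncomputable def ESall (L : Finset (ℝ × ℝ)) : Finset (((ℝ × ℝ) × (ℝ × ℝ)) × ℝ) :=
  ((Vx L ×ˢ L).filter (fun vp => ev vp.2 vp.1 = 0)) ×ˢ ({1, -1} : Finset ℝ)

noncomputable def ESgood (L : Finset (ℝ × ℝ)) : Finset (((ℝ × ℝ) × (ℝ × ℝ)) × ℝ) :=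
  (ESall L).filter (fun e => ∃ w z, Ap L e.1.2 e.1.1 w z e.2)

noncomputable def ESbad (L : Finset (ℝ × ℝ)) : Finset (((ℝ × ℝ) × (ℝ × ℝ)) × ℝ) :=
  (ESall L).filter (fun e => ¬ (∃ w z, Ap L e.1.2 e.1.1 w z e.2))

noncomputable def Flg (L X : Finset (ℝ × ℝ)) : Finset ((ℝ × ℝ) × (ℝ × ℝ)) :=
  (X ×ˢ L).filter (fun vp => ev vp.2 vp.1 = 0)

lemma card_Flg (X : Finset (ℝ × ℝ)) : (Flg L X).card = ∑ v ∈ X, (thr L v).card := by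
  rw [Finset.card_eq_sum_card_fiberwise (f := Prod.fst) (t := X)]
  · apply Finset.sum_congr rfl
    intro v hv
    apply Finset.card_bij (fun vp _ => vp.2)
    · rintro ⟨v', p⟩ h
      simp only [Flg, Finset.mem_filter, Finset.mem_product] at h
      obtain ⟨⟨⟨-, hp⟩, he⟩, rfl⟩ := h
      exact mem_thr.2 ⟨hp, he⟩
    · rintro ⟨v1, p1⟩ h1 ⟨v2, p2⟩ h2 h
      simp only [Finset.mem_filter] at h1 h2
      ext1
      · exact h1.2.trans h2.2.symm
      · exact h
    · intro p hp
      obtain ⟨hp, he⟩ := mem_thr.1 hp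
      exact ⟨(v, p), by simp [Flg, hv, hp, he], rfl⟩
  · intro x hx
    simp only [Flg, Finset.coe_filter, Finset.mem_product, Set.mem_ofPred_eq] at hx
    exact hx.1.1

lemma card_ESall : (ESall L).card = 2 * ∑ v ∈ Vx L, (thr L v).card := by
  have h5 : ({1, -1} : Finset ℝ).card = 2 := by
    rw [Finset.card_pair]; norm_num
  unfold ESall
  rw [Finset.card_product, h5, mul_comm, ← card_Flg]
  rfl

noncomputable def ESc (L : Finset (ℝ × ℝ)) (R : ℝ → ℝ → ℝ → Prop) :
    Finset (((ℝ × ℝ) × (ℝ × ℝ)) × ℝ) :=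
  (ESall L).filter (fun e => ∃ w z, Ap L e.1.2 e.1.1 w z e.2 ∧ R e.1.1.1 w.1 z.1)

lemma ESc_disj (hL : Gen L) {R R' : ℝ → ℝ → ℝ → Prop} (h : ∀ x y z, R x y z → R' x y z → False) :
    Disjoint (ESc L R) (ESc L R') := by
  rw [Finset.disjoint_left]
  intro e h1 h2
  simp only [ESc, Finset.mem_filter] at h1 h2
  obtain ⟨-, w, z, ha, hr⟩ := h1
  obtain ⟨-, w', z', ha', hr'⟩ := h2
  obtain ⟨rfl, rfl⟩ := ha.unique hL ha'
  exact h _ _ _ hr hr'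

lemma mem_ESall {p v w z : ℝ × ℝ} {ε : ℝ} (h : Ap L p v w z ε) (hε : ε = 1 ∨ ε = -1) :
    ((v, p), ε) ∈ ESall L := by
  simp [ESall, h.adj.hv, h.adj.hp, h.adj.ev1, hε]

lemma card_ESbad (hL : Gen L) :
    (ESbad L).card + 4 * ∑ v ∈ Vx L, (thr L v).card ≤ 12 * (Vx L).card + 6 * L.card := by
  set R1 : ℝ → ℝ → ℝ → Prop := fun x y z => x < y ∧ y < z
  set R2 : ℝ → ℝ → ℝ → Prop := fun x y z => x < y ∧ z < x
  set R3 : ℝ → ℝ → ℝ → Prop := fun x y z => x < z ∧ z < y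
  have tri : ∀ c ∈ GC L, (c.2 = 1 ∨ c.2 = -1) ∧ ∃ p q v p' v', v.1 < c.1.1 ∧ c.1.1 < v'.1 ∧
      Ap L p v c.1 v' c.2 ∧ Ap L p' c.1 v' v c.2 ∧ Ap L q v v' c.1 (-c.2) := by
    rintro ⟨w, ε⟩ hc
    exact gc_tri hL hc
  have hsg : ∀ ε : ℝ, (ε = 1 ∨ ε = -1) → (-ε = 1 ∨ -ε = -1) := by
    rintro ε (rfl | rfl) <;> simp
  choose! hε P Q V P' V' l1 l2 t1 t2 t3 using tri
  have c1 : (GC L).card ≤ (ESc L R1).card := by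
    apply Finset.card_le_card_of_injOn (fun c => ((V c, P c), c.2))
    · intro c hc
      simp only [ESc, Finset.coe_filter, Set.mem_ofPred_eq]
      exact ⟨mem_ESall (t1 c hc) (hε c hc), _, _, t1 c hc, l1 c hc, l2 c hc⟩
    · intro c hc c' hc' h
      simp only [Prod.mk.injEq] at h
      have a1 := t1 c hc
      have a2 := t1 c' hc'
      rw [h.1.1, h.1.2, h.2] at a1
      exact Prod.ext (a1.unique hL a2).1 h.2
  have c2 : (GC L).card ≤ (ESc L R2).card := by
    apply Finset.card_le_card_of_injOn (fun c => ((c.1, P' c), c.2))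
    · intro c hc
      simp only [ESc, Finset.coe_filter, Set.mem_ofPred_eq]
      exact ⟨mem_ESall (t2 c hc) (hε c hc), _, _, t2 c hc, l2 c hc, l1 c hc⟩
    · intro c hc c' hc' h
      simp only [Prod.mk.injEq] at h
      exact Prod.ext h.1.1 h.2
  have c3 : (GC L).card ≤ (ESc L R3).card := by
    apply Finset.card_le_card_of_injOn (fun c => ((V c, Q c), -c.2))
    · intro c hc
      simp only [ESc, Finset.coe_filter, Set.mem_ofPred_eq]
      exact ⟨mem_ESall (t3 c hc) (hsg _ (hε c hc)), _, _, t3 c hc, l1 c hc, l2 c hc⟩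
    · intro c hc c' hc' h
      simp only [Prod.mk.injEq] at h
      have a1 := t3 c hc
      have a2 := t3 c' hc'
      rw [h.1.1, h.1.2, h.2] at a1
      exact Prod.ext (a1.unique hL a2).2 (by linarith [h.2])
  have d12 : Disjoint (ESc L R1) (ESc L R2) := ESc_disj hL (by
    rintro x y z ⟨a, b⟩ ⟨c, d⟩; linarith)
  have d3 : Disjoint (ESc L R1 ∪ ESc L R2) (ESc L R3) := by
    rw [Finset.disjoint_union_left]
    constructor
    · exact ESc_disj hL (by rintro x y z ⟨a, b⟩ ⟨c, d⟩; linarith)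
    · exact ESc_disj hL (by rintro x y z ⟨a, b⟩ ⟨c, d⟩; linarith)
  have hsub : (ESc L R1 ∪ ESc L R2) ∪ ESc L R3 ⊆ ESgood L := by
    intro e he
    simp only [ESc, Finset.mem_union, Finset.mem_filter] at he
    simp only [ESgood, Finset.mem_filter]
    rcases he with (⟨h, w, z, h', -⟩ | ⟨h, w, z, h', -⟩) | ⟨h, w, z, h', -⟩ <;> exact ⟨h, w, z, h'⟩
  have hc := Finset.card_le_card hsub
  rw [Finset.card_union_of_disjoint d3, Finset.card_union_of_disjoint d12] at hc
  have hsum : (ESgood L).card + (ESbad L).card = (ESall L).card :=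
    Finset.card_filter_add_card_filter_not (s := ESall L) _
  rw [card_ESall] at hsum
  have := card_GC hL
  omega

/-! ### bad vertex counting -/

noncomputable def N2 (L : Finset (ℝ × ℝ)) : ℕ := ((Vx L).filter (fun v => (thr L v).card = 2)).card

lemma three_V (hL : Gen L) : 3 * (Vx L).card ≤ ∑ v ∈ Vx L, (thr L v).card + N2 L := by
  rw [N2, Finset.card_filter, ← Finset.sum_add_distrib, Finset.card_eq_sum_ones, Finset.mul_sum]
  apply Finset.sum_le_sum
  intro v hv
  have := two_le_thr hL hv
  split_ifs <;> omega

lemma card_ESbad' (hL : Gen L) : (ESbad L).card ≤ 6 * L.card + 4 * N2 L := by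
  have := card_ESbad hL
  have := three_V hL
  omega

lemma sum_ne3 (hL : Gen L) :
    (Flg L ((Vx L).filter (fun v => (thr L v).card ≠ 3))).card ≤ 4 * L.card + 6 * N2 L := by
  rw [card_Flg, Finset.sum_filter]
  have h : ∑ v ∈ Vx L, (if (thr L v).card ≠ 3 then (thr L v).card else 0) + 12 * (Vx L).card
      ≤ 4 * ∑ v ∈ Vx L, (thr L v).card + 6 * N2 L := by
    rw [N2, Finset.card_filter, Finset.card_eq_sum_ones, Finset.mul_sum, Finset.mul_sum,
      Finset.mul_sum, ← Finset.sum_add_distrib, ← Finset.sum_add_distrib]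
    apply Finset.sum_le_sum
    intro v hv
    have := two_le_thr hL hv
    split_ifs <;> omega
  have := card_I hL
  omega

def Full (L : Finset (ℝ × ℝ)) (p v u : ℝ × ℝ) : Prop :=
  ∀ ε : ℝ, (ε = 1 ∨ ε = -1) → ∃ z, 0 < ε * ev p z ∧ (∃ A, Adj L A v z) ∧ ∃ D, Adj L D u z

lemma Full.symm {p v u : ℝ × ℝ} (h : Full L p v u) : Full L p u v := by
  intro ε hε
  obtain ⟨z, h1, h2, h3⟩ := h ε hε
  exact ⟨z, h1, h3, h2⟩

structure Good1 (L : Finset (ℝ × ℝ)) (v : ℝ × ℝ) : Prop where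
  c3 : (thr L v).card = 3
  nb : ∀ p u, Adj L p v u → (thr L u).card = 3 ∧ Full L p v u

structure Good2 (L : Finset (ℝ × ℝ)) (v : ℝ × ℝ) : Prop where
  g1 : Good1 L v
  nb : ∀ p u, Adj L p v u → Good1 L u

noncomputable def Nb (L X : Finset (ℝ × ℝ)) : Finset (ℝ × ℝ) :=
  (Vx L).filter (fun u => ∃ v ∈ X, ∃ p, Adj L p v u)

lemma card_Nb (hL : Gen L) (X : Finset (ℝ × ℝ)) : (Nb L X).card ≤ 2 * (Flg L X).card := by
  have h5 : ({true, false} : Finset Bool).card = 2 := by simp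
  rw [mul_comm, ← h5, ← Finset.card_product]
  have key : ∀ u ∈ Nb L X, ∃ v ∈ X, ∃ p, Adj L p v u := by
    intro u hu; exact (Finset.mem_filter.1 hu).2
  choose! v hv p hp using key
  apply Finset.card_le_card_of_injOn (fun u => ((v u, p u), decide ((v u).1 < u.1)))
  · intro u hu
    have := hp u hu
    simp [Flg, hv u hu, this.hp, this.ev1]
    exact lt_or_ge _ _
  · intro u hu u' hu' h
    simp only [Prod.mk.injEq] at h
    have a := hp u hu
    have a' := hp u' hu'
    have x1 := a.xne
    have x2 := a'.xne
    have h2 := h.2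
    rw [decide_eq_decide] at h2
    rw [h.1.1, h.1.2] at a
    rw [h.1.1] at x1 h2
    apply ray_unique hL a a'
    rcases lt_or_gt_of_ne x2 with hh | hh
    · have := h2.2 hh
      nlinarith
    · have : ¬ (v u').1 < u.1 := fun hc => by have := h2.1 hc; linarith
      have : u.1 < (v u').1 := lt_of_le_of_ne (not_lt.1 this) x1.symm
      nlinarith

noncomputable def E0 (L : Finset (ℝ × ℝ)) : Finset (ℝ × ℝ) :=
  (Vx L).filter (fun v => ∃ p u, Adj L p v u ∧ ¬ Full L p v u)

lemma notFull_left {p v u : ℝ × ℝ} (hL : Gen L) (h : Adj L p v u) (hx : v.1 < u.1)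
    (hf : ¬ Full L p v u) : ∃ ε : ℝ, ((v, p), ε) ∈ ESbad L := by
  unfold Full at hf
  push Not at hf
  obtain ⟨ε, hε, hz⟩ := hf
  refine ⟨ε, ?_⟩
  simp only [ESbad, ESall, Finset.mem_filter, Finset.mem_product, Finset.mem_insert, Finset.mem_singleton]
  refine ⟨⟨⟨⟨h.hv, h.hp⟩, h.ev1⟩, hε⟩, ?_⟩
  rintro ⟨w, z, hA⟩
  have : w = u := ray_unique hL hA.adj h (mul_pos (by linarith [hA.lt]) (by linarith))
  subst this
  obtain ⟨D, hD1⟩ := hA.a2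
  exact hz z hA.pos hA.a1 D hD1

lemma card_E0 (hL : Gen L) : (E0 L).card ≤ 2 * (ESbad L).card := by
  set f : (((ℝ × ℝ) × (ℝ × ℝ)) × ℝ) → ℝ × ℝ := fun e =>
    if h : ∃ w, Adj L e.1.2 e.1.1 w ∧ e.1.1.1 < w.1 then h.choose else 0
  have hsub : E0 L ⊆ (ESbad L).image (fun e => e.1.1) ∪ (ESbad L).image f := by
    intro v hv
    obtain ⟨hvV, p, u, ha, hf⟩ := Finset.mem_filter.1 hv
    rw [Finset.mem_union]
    rcases lt_or_gt_of_ne ha.xne with hx | hx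
    · left
      obtain ⟨ε, he⟩ := notFull_left hL ha hx hf
      exact Finset.mem_image.2 ⟨_, he, rfl⟩
    · right
      obtain ⟨ε, he⟩ := notFull_left hL ha.symm hx (fun h => hf h.symm)
      refine Finset.mem_image.2 ⟨_, he, ?_⟩
      have hex : ∃ w, Adj L p u w ∧ u.1 < w.1 := ⟨v, ha.symm, hx⟩
      have : f ((u, p), ε) = hex.choose := by simp only [f]; rw [dif_pos hex]
      rw [this]
      have hs := hex.choose_spec
      exact ray_unique hL hs.1 ha.symm (mul_pos (by linarith [hs.2]) (by linarith))
  have h1 := Finset.card_le_card hsub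
  have h2 := Finset.card_union_le ((ESbad L).image (fun e => e.1.1)) ((ESbad L).image f)
  have h3 := Finset.card_image_le (s := ESbad L) (f := fun e => e.1.1)
  have h4 := Finset.card_image_le (s := ESbad L) (f := f)
  omega

lemma Flg_le (X0 Y : Finset (ℝ × ℝ)) (h : ∀ v ∈ Y, v ∉ X0 → (thr L v).card = 3) :
    (Flg L (X0 ∪ Y)).card ≤ (Flg L X0).card + 3 * Y.card := by
  rw [card_Flg, card_Flg]
  have : X0 ∪ Y = X0 ∪ (Y \ X0) := by simp
  rw [this, Finset.sum_union Finset.disjoint_sdiff]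
  have h1 : ∑ v ∈ Y \ X0, (thr L v).card = ∑ v ∈ Y \ X0, 3 := by
    apply Finset.sum_congr rfl
    intro v hv
    rw [Finset.mem_sdiff] at hv
    exact h v hv.1 hv.2
  have h2 : (Y \ X0).card ≤ Y.card := Finset.card_le_card Finset.sdiff_subset
  rw [h1, Finset.sum_const, smul_eq_mul]
  omega

noncomputable def Bad (L : Finset (ℝ × ℝ)) : Finset (ℝ × ℝ) := (Vx L).filter (fun v => ¬ Good2 L v)

theorem card_Bad (hL : Gen L) (k : ℕ) (hk : 1 ≤ k) (hN : N2 L ≤ k * L.card) :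
    (Flg L (Bad L)).card ≤ 1180 * (k * L.card) := by
  have hn : L.card ≤ k * L.card := Nat.le_mul_of_pos_left _ hk
  set n := k * L.card
  set X0 := (Vx L).filter (fun v => (thr L v).card ≠ 3) with hX0
  have b0 : (Flg L X0).card ≤ 10 * n := by
    have := sum_ne3 hL; rw [← hX0] at this; omega
  have bE : (E0 L).card ≤ 20 * n := by
    have := card_E0 hL
    have := card_ESbad' hL; omega
  have bN := card_Nb hL X0
  set Y1 := E0 L ∪ Nb L X0 with hY1
  have bY1 : Y1.card ≤ 40 * n := by
    have := Finset.card_union_le (E0 L) (Nb L X0); rw [← hY1] at this; omega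
  have h3 : ∀ Y ⊆ Vx L, ∀ v ∈ Y, v ∉ X0 → (thr L v).card = 3 := by
    intro Y hY v hv hn
    by_contra hc
    exact hn (Finset.mem_filter.2 ⟨hY hv, hc⟩)
  have sY1 : Y1 ⊆ Vx L := Finset.union_subset (Finset.filter_subset _ _) (Finset.filter_subset _ _)
  have bF1 : (Flg L (X0 ∪ Y1)).card ≤ 130 * n := by
    have := Flg_le (L := L) X0 Y1 (h3 _ sY1)
    omega
  set X1 := X0 ∪ Y1 with hX1
  have bN1 := card_Nb hL X1
  have notg1 : ∀ v ∈ Vx L, v ∉ X1 → Good1 L v := by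
    intro v hv hvX
    simp only [hX1, hY1, hX0, E0, Nb, Finset.mem_union, Finset.mem_filter, not_or] at hvX
    obtain ⟨h0, h1, h2⟩ := hvX
    refine ⟨by by_contra hc; exact h0 ⟨hv, hc⟩, fun p u ha => ⟨?_, ?_⟩⟩
    · by_contra hc
      exact h2 ⟨hv, u, ⟨ha.hw, hc⟩, p, ha.symm⟩
    · by_contra hc
      exact h1 ⟨hv, p, u, ha, hc⟩
  have sB : Bad L ⊆ X0 ∪ (Y1 ∪ Nb L X1) := by
    intro v hv
    obtain ⟨hvV, hb⟩ := Finset.mem_filter.1 hv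
    by_contra hc
    rw [← Finset.union_assoc, Finset.mem_union, not_or] at hc
    apply hb
    refine ⟨notg1 v hvV hc.1, fun p u ha => notg1 u ha.hw ?_⟩
    intro hu
    exact hc.2 (Finset.mem_filter.2 ⟨hvV, u, hu, p, ha.symm⟩)
  have bX1 : X1.card ≤ 130 * n := by
    calc X1.card ≤ (Flg L X1).card := by
          rw [card_Flg, Finset.card_eq_sum_ones]
          apply Finset.sum_le_sum
          intro v hv
          have : v ∈ Vx L := by
            rcases Finset.mem_union.1 hv with h | h
            · exact (Finset.mem_filter.1 h).1
            · exact sY1 h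
          have := two_le_thr hL this
          omega
      _ ≤ _ := bF1
  have hY1X1 : Y1.card ≤ X1.card := Finset.card_le_card Finset.subset_union_right
  have hu := Finset.card_union_le Y1 (Nb L X1)
  have hfin := Flg_le (L := L) X0 (Y1 ∪ Nb L X1)
    (h3 _ (Finset.union_subset sY1 (Finset.filter_subset _ _)))
  have hmono : (Flg L (Bad L)).card ≤ (Flg L (X0 ∪ (Y1 ∪ Nb L X1))).card := by
    apply Finset.card_le_card
    apply Finset.filter_subset_filter
    exact Finset.product_subset_product sB (Finset.Subset.refl _)
  omega

end FOL

set_option linter.unusedVariables false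
namespace FOL

open Finset

attribute [local instance] Classical.propDecidable

variable {L : Finset (ℝ × ℝ)}

/-- exactly three lines of `L` through `v` -/
structure Tri (L : Finset (ℝ × ℝ)) (v p q r : ℝ × ℝ) : Prop where
  pq : p ≠ q
  pr : p ≠ r
  qr : q ≠ r
  mem : ∀ s, (s ∈ L ∧ ev s v = 0) ↔ (s = p ∨ s = q ∨ s = r)

lemma Tri.rot {v p q r : ℝ × ℝ} (h : Tri L v p q r) : Tri L v q r p :=
  ⟨h.qr, h.pq.symm, h.pr.symm, fun s => by rw [h.mem]; tauto⟩

lemma Tri.swap {v p q r : ℝ × ℝ} (h : Tri L v p q r) : Tri L v p r q :=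
  ⟨h.pr, h.pq, h.qr.symm, fun s => by rw [h.mem]; tauto⟩

lemma Tri.m1 {v p q r : ℝ × ℝ} (h : Tri L v p q r) : p ∈ L ∧ ev p v = 0 := (h.mem p).2 (by simp)
lemma Tri.m2 {v p q r : ℝ × ℝ} (h : Tri L v p q r) : q ∈ L ∧ ev q v = 0 := (h.mem q).2 (by simp)
lemma Tri.m3 {v p q r : ℝ × ℝ} (h : Tri L v p q r) : r ∈ L ∧ ev r v = 0 := (h.mem r).2 (by simp)

lemma tri_of_card {v p q : ℝ × ℝ} (h : (thr L v).card = 3) (hp : p ∈ L) (hp' : ev p v = 0)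
    (hq : q ∈ L) (hq' : ev q v = 0) (hpq : p ≠ q) : ∃ r, Tri L v p q r := by
  have h1 : p ∈ thr L v := mem_thr.2 ⟨hp, hp'⟩
  have h2 : q ∈ (thr L v).erase p := Finset.mem_erase.2 ⟨hpq.symm, mem_thr.2 ⟨hq, hq'⟩⟩
  have h3 : (((thr L v).erase p).erase q).card = 1 := by
    rw [Finset.card_erase_of_mem h2, Finset.card_erase_of_mem h1, h]
  obtain ⟨r, hr⟩ := Finset.card_eq_one.1 h3
  have hr' : r ∈ ((thr L v).erase p).erase q := by rw [hr]; simp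
  simp only [Finset.mem_erase, mem_thr] at hr'
  refine ⟨r, hpq, hr'.2.1.symm, hr'.1.symm, fun s => ?_⟩
  constructor
  · rintro ⟨hs, hs'⟩
    by_contra hc
    push Not at hc
    have : s ∈ ((thr L v).erase p).erase q := by
      simp only [Finset.mem_erase, mem_thr]; exact ⟨hc.2.1, hc.1, hs, hs'⟩
    rw [hr] at this
    exact hc.2.2 (by simpa using this)
  · rintro (rfl | rfl | rfl)
    · exact ⟨hp, hp'⟩
    · exact ⟨hq, hq'⟩
    · exact hr'.2.2

lemma tri_of_card3 {v p q r : ℝ × ℝ} (h : (thr L v).card = 3) (hp : p ∈ L) (hp' : ev p v = 0)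
    (hq : q ∈ L) (hq' : ev q v = 0) (hr : r ∈ L) (hr' : ev r v = 0)
    (hpq : p ≠ q) (hpr : p ≠ r) (hqr : q ≠ r) : Tri L v p q r := by
  obtain ⟨t, ht⟩ := tri_of_card h hp hp' hq hq' hpq
  rcases (ht.mem r).1 ⟨hr, hr'⟩ with h | h | h
  · exact absurd h hpr.symm
  · exact absurd h hqr.symm
  · rw [h]; exact ht

lemma Adj.off {p t v w : ℝ × ℝ} (h : Adj L p v w) (ht : ev t v = 0) (hne : t ≠ p) : ev t w ≠ 0 :=
  fun h0 => hne (line_eq ht h.ev1 h0 h.ev2 h.ne)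

/-- complement lemma -/
lemma compl_ne {p A A' v w z z' : ℝ × ℝ} (hv : (thr L v).card = 3) (h : Adj L p v w)
    (hA : Adj L A v z) (hA' : Adj L A' v z') (hwz : ∃ D, Adj L D w z) (hwz' : ∃ D, Adj L D w z')
    (hs : ev p z * ev p z' < 0) : A ≠ A' := by
  rintro rfl
  have hpA : p ≠ A := by
    rintro rfl; rw [hA.ev2] at hs; simp at hs
  obtain ⟨t, ht⟩ := tri_of_card hv h.hp h.ev1 hA.hp hA.ev1 hpA
  obtain ⟨D, hD⟩ := hwz
  obtain ⟨D', hD'⟩ := hwz'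
  have u1 := hD.uns t ht.m3.1
  have u2 := hD'.uns t ht.m3.1
  have n1 : ev t w ≠ 0 := h.off ht.m3.2 ht.pr.symm
  have n2 : ev t z ≠ 0 := hA.off ht.m3.2 ht.qr.symm
  have n3 : ev t z' ≠ 0 := hA'.off ht.m3.2 ht.qr.symm
  have a3 := hA.ev1; have a4 := hA.ev2; have a6 := hA'.ev2; have a7 := ht.m3.2; have a8 := h.ev1
  have e1 : ev t z = (A.1 - t.1) * (z.1 - v.1) := by simp only [ev] at *; linarith
  have e2 : ev t z' = (A.1 - t.1) * (z'.1 - v.1) := by simp only [ev] at *; linarith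
  have e3 : ev p z = (A.1 - p.1) * (z.1 - v.1) := by simp only [ev] at *; linarith
  have e4 : ev p z' = (A.1 - p.1) * (z'.1 - v.1) := by simp only [ev] at *; linarith
  have hzz : (z.1 - v.1) * (z'.1 - v.1) < 0 := by
    rw [e3, e4] at hs
    by_contra hc; push Not at hc
    nlinarith [mul_nonneg (sq_nonneg (A.1 - p.1)) hc]
  have h1 : ev t z * ev t z' < 0 := by
    have h0 : A.1 - t.1 ≠ 0 := by
      intro h0; rw [h0] at e1; simp at e1; exact n2 e1
    have : 0 < (A.1 - t.1)^2 := by positivity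
    rw [e1, e2]; nlinarith
  have h2 := mul_nonneg u1 u2
  have h3 : 0 < (ev t w)^2 := by positivity
  nlinarith

/-- same side of `p` on one line means same direction -/
lemma same_ray (hL : Gen L) {p b v z z' : ℝ × ℝ} (hp : ev p v = 0) (h : Adj L b v z)
    (h' : Adj L b v z') (hs : 0 < ev p z * ev p z') : z = z' := by
  apply ray_unique hL h h'
  have a3 := h.ev1; have a4 := h.ev2; have a6 := h'.ev2
  have e3 : ev p z = (b.1 - p.1) * (z.1 - v.1) := by simp only [ev] at *; linarith
  have e4 : ev p z' = (b.1 - p.1) * (z'.1 - v.1) := by simp only [ev] at *; linarith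
  rw [e3, e4] at hs
  by_contra hc; push Not at hc
  nlinarith [mul_nonneg (sq_nonneg (b.1 - p.1)) (neg_nonneg.2 hc)]

/-- choose the apex opposite to `z0`. -/
lemma Full.opp {p v u z0 : ℝ × ℝ} (h : Full L p v u) (hz : ev p z0 ≠ 0) :
    ∃ z, ev p z0 * ev p z < 0 ∧ (∃ A, Adj L A v z) ∧ ∃ D, Adj L D u z := by
  rcases lt_or_gt_of_ne hz with h0 | h0
  · obtain ⟨z, h1, h2, h3⟩ := h 1 (Or.inl rfl)
    exact ⟨z, by nlinarith, h2, h3⟩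
  · obtain ⟨z, h1, h2, h3⟩ := h (-1) (Or.inr rfl)
    exact ⟨z, by nlinarith, h2, h3⟩

/-- half lemma -/
lemma half (hL : Gen L) {p a b b2 v v2 w : ℝ × ℝ} (hv : Tri L v p a b)
    (hv3 : (thr L v).card = 3) (hw3 : (thr L w).card = 3)
    (h1 : Adj L p v v2) (h2 : Adj L a v w) (h3 : Adj L b2 v2 w) (hf : Full L a v w) :
    ∃ Z Y, Adj L b v Z ∧ Adj L Y w Z ∧ 0 < ev p w * ev p Z ∧ Tri L w a b2 Y := by
  have hav2 : ev a v2 ≠ 0 := h1.off hv.m2.2 hv.pq.symm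
  obtain ⟨Z, hs, ⟨X, hX⟩, ⟨Y, hY⟩⟩ := hf.opp hav2
  have hXp : p ≠ X := compl_ne hv3 h2 h1 hX ⟨_, h3.symm⟩ ⟨_, hY⟩ hs
  have hXa : X ≠ a := by
    rintro rfl; rw [hX.ev2] at hs; simp at hs
  have hXb : X = b := by
    rcases (hv.mem X).1 ⟨hX.hp, hX.ev1⟩ with h | h | h
    · exact absurd h.symm hXp
    · exact absurd h hXa
    · exact h
  subst hXb
  have hYb2 : b2 ≠ Y := compl_ne hw3 h2.symm h3.symm hY ⟨_, h1⟩ ⟨_, hX⟩ hs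
  have hYa : Y ≠ a := by
    rintro rfl; rw [hY.ev2] at hs; simp at hs
  have hab2 : a ≠ b2 := by
    rintro rfl; exact hav2 h3.ev1
  refine ⟨Z, Y, hX, hY, ?_, tri_of_card3 hw3 h2.hp h2.ev2 h3.hp h3.ev2 hY.hp hY.ev1 hab2 hYa.symm hYb2⟩
  have u := hY.uns p h1.hp
  have n1 : ev p w ≠ 0 := h2.off hv.m1.2 hv.pq
  have n2 : ev p Z ≠ 0 := hX.off hv.m1.2 hv.pr
  exact lt_of_le_of_ne u (mul_ne_zero n1 n2).symm

structure Strip (L : Finset (ℝ × ℝ)) (p : ℝ × ℝ) (N : ℕ) (V a b W : ℕ → ℝ × ℝ) : Prop where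
  tri : ∀ i, i ≤ N → Tri L (V i) p (a i) (b i)
  g1 : ∀ i, i ≤ N → Good1 L (V i)
  adj : ∀ i, i < N → Adj L p (V i) (V (i + 1))
  wa : ∀ i, i < N → Adj L (a i) (V i) (W i)
  wb : ∀ i, i < N → Adj L (b (i + 1)) (V (i + 1)) (W i)
  side : ∀ i, i + 1 < N → 0 < ev p (W i) * ev p (W (i + 1))

lemma row_one (hL : Gen L) {p : ℝ × ℝ} {N : ℕ} {V a b W : ℕ → ℝ × ℝ} (h : Strip L p N V a b W)
    (i : ℕ) (hi : i + 1 < N) : ∃ c, Adj L c (W i) (W (i + 1)) ∧ Tri L (W i) (a i) (b (i + 1)) c ∧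
      Tri L (W (i + 1)) (a (i + 1)) (b (i + 2)) c := by
  have g := h.g1 (i + 1) (by omega)
  have t := h.tri (i + 1) (by omega)
  have A1 := h.wa (i + 1) (by omega)
  have A0 := h.wb i (by omega)
  have side := h.side i hi
  obtain ⟨Z, Y, hZ, hY, hs, hT⟩ := half hL t g.c3 ((g.nb _ _ A1).1) (h.adj (i + 1) (by omega)) A1
    (h.wb (i + 1) (by omega)) ((g.nb _ _ A1).2)
  obtain ⟨Z', Y', hZ', hY', hs', hT'⟩ := half hL t.swap g.c3 ((g.nb _ _ A0).1)
    (h.adj i (by omega)).symm A0 (h.wa i (by omega)) ((g.nb _ _ A0).2)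
  have e1 : Z = W i := same_ray hL t.m1.2 hZ A0 (by
    have h1 := mul_pos hs side
    by_contra hc; push Not at hc
    nlinarith [mul_nonneg (sq_nonneg (ev p (W (i+1)))) (neg_nonneg.2 hc)])
  have e2 : Z' = W (i + 1) := same_ray hL t.m1.2 hZ' A1 (by
    have h1 := mul_pos hs' side
    by_contra hc; push Not at hc
    nlinarith [mul_nonneg (sq_nonneg (ev p (W i))) (neg_nonneg.2 hc)])
  subst e1
  rw [e2] at hY'
  have : Y' = Y := line_unique hY' hY.symm
  subst this
  exact ⟨Y', hY', hT'.swap.rot.rot, hT⟩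

lemma row (hL : Gen L) {p : ℝ × ℝ} {N : ℕ} {V a b W : ℕ → ℝ × ℝ} (h : Strip L p N V a b W)
    (hN : 2 ≤ N) : ∃ c, (∀ i, i < N → Tri L (W i) (a i) (b (i + 1)) c) ∧
      ∀ i, i + 1 < N → Adj L c (W i) (W (i + 1)) := by
  obtain ⟨c, h1, h2, h3⟩ := row_one hL h 0 (by omega)
  have key : ∀ i, i + 1 < N → Tri L (W i) (a i) (b (i + 1)) c ∧
      Tri L (W (i + 1)) (a (i + 1)) (b (i + 2)) c ∧ Adj L c (W i) (W (i + 1)) := by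
    intro i
    induction i with
    | zero => intro _; exact ⟨h2, h3, h1⟩
    | succ j ih =>
      intro hj
      obtain ⟨k1, k2, k3⟩ := ih (by omega)
      obtain ⟨c', l1, l2, l3⟩ := row_one hL h (j + 1) hj
      have : c' = c := by
        rcases (l2.mem c).1 k2.m3 with h | h | h
        · exact absurd h k2.pr.symm
        · exact absurd h k2.qr.symm
        · exact h.symm
      subst this
      exact ⟨l2, l3, l1⟩
  refine ⟨c, ?_, fun i hi => (key i hi).2.2⟩
  intro i hi
  rcases Nat.lt_or_ge (i + 1) N with h | h
  · exact (key i h).1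
  · obtain ⟨j, rfl⟩ : ∃ j, i = j + 1 := ⟨i - 1, by omega⟩
    exact (key j hi).2.1

/-- next strip -/
lemma next_strip (hL : Gen L) {p c : ℝ × ℝ} {N : ℕ} {V a b W : ℕ → ℝ × ℝ} (h : Strip L p N V a b W)
    (hg2 : ∀ i, i ≤ N → Good2 L (V i))
    (h1 : ∀ i, i < N → Tri L (W i) (a i) (b (i + 1)) c)
    (h2 : ∀ i, i + 1 < N → Adj L c (W i) (W (i + 1))) (hN : 2 ≤ N) :
    ∃ Z, Strip L c (N - 1) W a (fun i => b (i + 1)) Z := by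
  have hg : ∀ i, i < N → Good1 L (W i) := fun i hi => (hg2 i hi.le).nb _ _ (h.wa i hi)
  have hoff : ∀ i, i + 1 < N → ev c (V (i + 1)) ≠ 0 := by
    intro i hi h0
    rcases ((h.tri (i + 1) (by omega)).mem c).1 ⟨(h1 i (by omega)).m3.1, h0⟩ with e | e | e
    · have := (h.tri i (by omega)).m1
      have hw := (h1 i (by omega)).m3.2
      rw [e] at hw
      exact (h.wa i (by omega)).off this.2 (h.tri i (by omega)).pq hw
    · exact (h1 (i + 1) hi).pr e.symm
    · exact (h1 i (by omega)).qr e.symm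
  have key : ∀ i, i + 1 < N → ∃ z, Adj L (a i) (W i) z ∧ Adj L (b (i + 2)) (W (i + 1)) z ∧
      ev c (V (i + 1)) * ev c z < 0 := by
    intro i hi
    obtain ⟨z, hs, ⟨A, hA⟩, ⟨D, hD⟩⟩ := ((hg i (by omega)).nb _ _ (h2 i hi)).2.opp (hoff i hi)
    have c1 := compl_ne (hg i (by omega)).c3 (h2 i hi) (h.wb i (by omega)).symm hA
      ⟨_, (h.wa (i + 1) hi).symm⟩ ⟨_, hD⟩ hs
    have c2 := compl_ne (hg (i + 1) (by omega)).c3 (h2 i hi).symm (h.wa (i + 1) (by omega)).symm hD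
      ⟨_, (h.wb i (by omega)).symm⟩ ⟨_, hA⟩ hs
    have n1 : A ≠ c := by rintro rfl; rw [hA.ev2] at hs; simp at hs
    have n2 : D ≠ c := by rintro rfl; rw [hD.ev2] at hs; simp at hs
    have e1 : A = a i := by
      rcases ((h1 i (by omega)).mem A).1 ⟨hA.hp, hA.ev1⟩ with e | e | e
      · exact e
      · exact absurd e.symm c1
      · exact absurd e n1
    have e2 : D = b (i + 2) := by
      rcases ((h1 (i + 1) (by omega)).mem D).1 ⟨hD.hp, hD.ev1⟩ with e | e | e
      · exact absurd e.symm c2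
      · exact e
      · exact absurd e n2
    subst e1; subst e2
    exact ⟨z, hA, hD, hs⟩
  choose! Z z1 z2 z3 using key
  refine ⟨Z, ⟨?_, ?_, ?_, ?_, ?_, ?_⟩⟩
  · intro i hi; exact (h1 i (by omega)).rot.rot
  · intro i hi; exact hg i (by omega)
  · intro i hi; exact h2 i (by omega)
  · intro i hi; exact z1 i (by omega)
  · intro i hi; exact z2 i (by omega)
  · intro i hi
    have a1 := z3 i (by omega)
    have a2 := z3 (i + 1) (by omega)
    have a3 := (h.adj (i + 1) (by omega)).uns c (h1 i (by omega)).m3.1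
    have a4 := mul_pos_of_neg_of_neg a1 a2
    by_contra hc; push Not at hc
    nlinarith [mul_nonneg a3 (neg_nonneg.2 hc)]

/-- The data extracted from a run of good vertices -/
structure Grid (L : Finset (ℝ × ℝ)) (p : ℝ × ℝ) (N : ℕ) (V a b : ℕ → ℝ × ℝ) (c d e : ℝ × ℝ) : Prop where
  t0 : ∀ i, i ≤ N → Tri L (V i) p (a i) (b i)
  t1 : ∀ i, i < N → ∃ W, Tri L W c (a i) (b (i + 1))
  t2 : ∀ i, i + 1 < N → ∃ W, Tri L W d (a i) (b (i + 2))
  tm : ∀ i, i < N → ∃ W, Tri L W e (a (i + 1)) (b i)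

theorem grid_of_run (hL : Gen L) {p : ℝ × ℝ} {N : ℕ} {V : ℕ → ℝ × ℝ} (hN : 3 ≤ N)
    (hg : ∀ i, i ≤ N + 2 → Good2 L (V i))
    (hadj : ∀ i, i < N + 2 → Adj L p (V i) (V (i + 1)))
    (hx : ∀ i, i < N + 2 → (V i).1 < (V (i + 1)).1) :
    ∃ a b c d e, Grid L p N (fun i => V (i + 1)) a b c d e := by
  -- upper and lower apexes
  have up : ∀ i, i < N + 2 → ∃ w A D, 0 < ev p w ∧ Adj L A (V i) w ∧ Adj L D (V (i + 1)) w := by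
    intro i hi
    obtain ⟨z, h1, ⟨A, hA⟩, ⟨D, hD⟩⟩ := ((hg i (by omega)).g1.nb _ _ (hadj i hi)).2 1 (Or.inl rfl)
    exact ⟨z, A, D, by linarith, hA, hD⟩
  choose! W A D hW hA hD using up
  -- interior: A (i+1) ≠ D i
  have hne : ∀ i, i + 1 < N + 2 → A (i + 1) ≠ D i := by
    intro i hi he
    have a1 := hA (i + 1) hi
    have a2 := hD i (by omega)
    have hpv := (hadj (i + 1) hi).ev1
    rw [he] at a1
    have hww : W (i + 1) = W i := same_ray hL hpv a1 a2 (mul_pos (hW _ hi) (hW _ (by omega)))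
    have hpD : p ≠ D i := by
      intro h0; have := hW i (by omega); rw [h0, a2.ev2] at this; exact lt_irrefl _ this
    obtain ⟨t, ht⟩ := tri_of_card (hg (i + 1) (by omega)).g1.c3 (hadj (i + 1) hi).hp hpv a2.hp a2.ev1 hpD
    have u1 := (hA i (by omega)).uns t ht.m3.1
    have u2 := (hD (i + 1) hi).uns t ht.m3.1
    rw [hww] at u2
    have n1 : ev t (W i) ≠ 0 := a2.off ht.m3.2 ht.qr.symm
    have n2 := (hadj (i + 1) hi).off ht.m3.2 ht.pr.symm
    have b1 := hpv
    have b2 := (hadj (i + 1) hi).ev2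
    have b3 := (hadj i (by omega)).ev1
    have b4 := ht.m3.2
    have x1 := hx i (by omega)
    have x2 := hx (i + 1) hi
    have e1 : ev t (V i) = (p.1 - t.1) * ((V i).1 - (V (i + 1)).1) := by simp only [ev] at *; linarith
    have e2 : ev t (V (i + 1 + 1)) = (p.1 - t.1) * ((V (i + 1 + 1)).1 - (V (i + 1)).1) := by
      simp only [ev] at *; linarith
    have h0 : p.1 - t.1 ≠ 0 := by intro h0; rw [h0] at e2; simp at e2; exact n2 e2
    have h3 : ev t (V i) * ev t (V (i + 1 + 1)) < 0 := by
      rw [e1, e2]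
      have q1 : 0 < (p.1 - t.1)^2 := by positivity
      have q2 : 0 < ((V (i + 1)).1 - (V i).1) * ((V (i + 1 + 1)).1 - (V (i + 1)).1) :=
        mul_pos (by linarith) (by linarith)
      nlinarith [mul_pos q1 q2]
    have h4 := mul_nonneg u1 u2
    have h5 : 0 < (ev t (W i))^2 := by positivity
    nlinarith
  set V1 : ℕ → ℝ × ℝ := fun i => V (i + 1) with hV1
  have hpA : ∀ i, i < N + 2 → p ≠ A i := by
    intro i hi h0; have := hW i hi; rw [h0, (hA i hi).ev2] at this; exact lt_irrefl _ this
  have hpD : ∀ i, i < N + 2 → p ≠ D i := by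
    intro i hi h0; have := hW i hi; rw [h0, (hD i hi).ev2] at this; exact lt_irrefl _ this
  have T0 : ∀ i, i ≤ N → Tri L (V1 i) p (A (i + 1)) (D i) := by
    intro i hi
    have a1 := hA (i + 1) (by omega)
    have a2 := hD i (by omega)
    exact tri_of_card3 (hg (i + 1) (by omega)).g1.c3 (hadj (i + 1) (by omega)).hp
      (hadj (i + 1) (by omega)).ev1 a1.hp a1.ev1 a2.hp a2.ev1 (hpA _ (by omega)) (hpD _ (by omega))
      (hne i (by omega))
  have S : Strip L p N V1 (fun i => A (i + 1)) D (fun i => W (i + 1)) := by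
    refine ⟨T0, fun i hi => (hg (i + 1) (by omega)).g1, fun i hi => hadj (i + 1) (by omega),
      fun i hi => hA (i + 1) (by omega), fun i hi => hD (i + 1) (by omega), fun i hi => ?_⟩
    exact mul_pos (hW _ (by omega)) (hW _ (by omega))
  -- lower
  have low : ∀ i, i < N → ∃ w, ev p w < 0 ∧ Adj L (D i) (V1 i) w ∧ Adj L (A (i + 2)) (V1 (i + 1)) w := by
    intro i hi
    have hWp := hW (i + 1) (by omega)
    obtain ⟨z, hs, ⟨A', hA'⟩, ⟨D', hD'⟩⟩ :=
      ((hg (i + 1) (by omega)).g1.nb _ _ (hadj (i + 1) (by omega))).2.opp hWp.ne'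
    have hneg : ev p z < 0 := by by_contra hc; push Not at hc; nlinarith
    have c1 := compl_ne (hg (i + 1) (by omega)).g1.c3 (hadj (i + 1) (by omega)) (hA (i + 1) (by omega)) hA'
      ⟨_, hD (i + 1) (by omega)⟩ ⟨_, hD'⟩ hs
    have c2 := compl_ne (hg (i + 2) (by omega)).g1.c3 (hadj (i + 1) (by omega)).symm
      (hD (i + 1) (by omega)) hD' ⟨_, hA (i + 1) (by omega)⟩ ⟨_, hA'⟩ hs
    have n1 : A' ≠ p := by rintro rfl; rw [hA'.ev2] at hs; simp at hs
    have n2 : D' ≠ p := by rintro rfl; rw [hD'.ev2] at hs; simp at hs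
    have e1 : A' = D i := by
      rcases ((T0 i (by omega)).mem A').1 ⟨hA'.hp, hA'.ev1⟩ with e | e | e
      · exact absurd e n1
      · exact absurd e.symm c1
      · exact e
    have e2 : D' = A (i + 2) := by
      rcases ((T0 (i + 1) (by omega)).mem D').1 ⟨hD'.hp, hD'.ev1⟩ with e | e | e
      · exact absurd e n2
      · exact e
      · exact absurd e.symm c2
    subst e1; subst e2
    exact ⟨z, hneg, hA', hD'⟩
  choose! W' hW' hA' hD' using low
  have S' : Strip L p N V1 D (fun i => A (i + 1)) W' := by
    refine ⟨fun i hi => (T0 i hi).swap, fun i hi => (hg (i + 1) (by omega)).g1,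
      fun i hi => hadj (i + 1) (by omega), fun i hi => hA' i hi, fun i hi => hD' i hi, fun i hi => ?_⟩
    exact mul_pos_of_neg_of_neg (hW' _ (by omega)) (hW' _ (by omega))
  obtain ⟨c, hc1, hc2⟩ := row hL S (by omega)
  obtain ⟨e, he1, -⟩ := row hL S' (by omega)
  obtain ⟨Z, SZ⟩ := next_strip hL S (fun i hi => hg (i + 1) (by omega)) hc1 hc2 (by omega)
  obtain ⟨d, hd1, -⟩ := row hL SZ (by omega)
  refine ⟨fun i => A (i + 1), D, c, d, e, T0, ?_, ?_, ?_⟩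
  · intro i hi; exact ⟨_, (hc1 i hi).rot.rot⟩
  · intro i hi; exact ⟨_, (hd1 i (by omega)).rot.rot⟩
  · intro i hi; exact ⟨_, (he1 i hi).rot.rot.swap⟩

end FOL

set_option linter.unusedVariables false
namespace FOL

open Finset

attribute [local instance] Classical.propDecidable

variable {L : Finset (ℝ × ℝ)}

lemma enum {α : Type*} [Inhabited α] (S : Finset α) (f : α → ℝ) (hf : Set.InjOn f S) :
    ∃ U : ℕ → α, (∀ i < S.card, U i ∈ S) ∧ (∀ i j, i < j → j < S.card → f (U i) < f (U j)) ∧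
      ∀ v ∈ S, ∃ i < S.card, U i = v := by
  have hc : (S.image f).card = S.card := Finset.card_image_of_injOn hf
  set g := (S.image f).orderEmbOfFin hc with hg
  have h1 : ∀ i : Fin S.card, ∃ v ∈ S, f v = g i := by
    intro i
    have := Finset.orderEmbOfFin_mem (S.image f) hc i
    exact Finset.mem_image.1 this
  choose v hv hfv using h1
  refine ⟨fun i => if h : i < S.card then v ⟨i, h⟩ else default, ?_, ?_, ?_⟩
  · intro i hi; simp only [hi, dif_pos]; exact hv _
  · intro i j hij hj
    have hi : i < S.card := hij.trans hj
    simp only [hi, hj, dif_pos]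
    rw [hfv, hfv]
    exact g.strictMono (by simpa using hij)
  · intro w hw
    have : f w ∈ Set.range g := by
      rw [hg, Finset.range_orderEmbOfFin]; exact Finset.mem_coe.2 (Finset.mem_image_of_mem f hw)
    obtain ⟨i, hi⟩ := this
    refine ⟨i, i.2, ?_⟩
    simp only [i.2, dif_pos]
    apply hf (hv _) hw
    rw [hfv]; exact hi

noncomputable def BadOn (L : Finset (ℝ × ℝ)) (p : ℝ × ℝ) : Finset (ℝ × ℝ) :=
  (Bad L).filter (fun v => ev p v = 0)

/-- decomposition of a line with few bad vertices into grids -/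
theorem runs (hL : Gen L) {p : ℝ × ℝ} (hp : p ∈ L) {T : ℕ} (hT : (BadOn L p).card ≤ T) :
    ∃ (E : Finset (ℝ × ℝ)) (act : Finset ℕ) (N : ℕ → ℕ) (V a b : ℕ → ℕ → ℝ × ℝ) (c d e : ℕ → ℝ × ℝ),
      E.card ≤ 6 * (T + 1) ∧ act.card ≤ T + 1 ∧
      (∀ r ∈ act, 3 ≤ N r ∧ Grid L p (N r) (V r) (a r) (b r) (c r) (d r) (e r)) ∧
      (∀ r ∈ act, ∀ i j, i < j → j ≤ N r → (V r i).1 < (V r j).1) ∧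
      (∀ r ∈ act, ∀ r' ∈ act, r ≠ r' → ∀ i ≤ N r, ∀ j ≤ N r', ∃ u ∈ E,
        0 < (u.1 - (V r i).1) * ((V r' j).1 - u.1)) ∧
      ∀ v ∈ Vx L, ev p v = 0 → v ∈ E ∨ ∃ r ∈ act, ∃ i ≤ N r, v = V r i := by
  set S := (Vx L).filter (fun v => ev p v = 0) with hS
  obtain ⟨U, hU1, hU2, hU3⟩ := enum S Prod.fst (by
    intro v hv w hw h
    simp only [hS, Finset.coe_filter, Set.mem_ofPred_eq] at hv hw
    exact pt_eq_x hv.2 hw.2 h)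
  set m := S.card with hm
  have hUp : ∀ i < m, U i ∈ Vx L ∧ ev p (U i) = 0 := by
    intro i hi; exact Finset.mem_filter.1 (hU1 i hi)
  have hUadj : ∀ i, i + 1 < m → Adj L p (U i) (U (i + 1)) := by
    intro i hi
    have hx := hU2 i (i + 1) (by omega) hi
    apply adj_of_clr hL hp (hUp i (by omega)).1 (hUp (i + 1) hi).1 _ (hUp i (by omega)).2 (hUp (i + 1) hi).2
    · intro u hu hpu
      obtain ⟨j, hj, rfl⟩ := hU3 u (Finset.mem_filter.2 ⟨hu, hpu⟩)
      have h1 : (U j).1 ≤ (U i).1 ∨ (U (i + 1)).1 ≤ (U j).1 := by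
        rcases lt_trichotomy j i with h | h | h
        · left; exact (hU2 j i h (by omega)).le
        · left; rw [h]
        · right
          rcases Nat.lt_or_ge (i + 1) j with h' | h'
          · exact (hU2 _ _ h' hj).le
          · have : j = i + 1 := by omega
            rw [this]
      rcases h1 with h1 | h1 <;> nlinarith
    · intro h; rw [h] at hx; exact lt_irrefl _ hx
  -- bad indices
  set Bd := (Finset.range m).filter (fun i => ¬ Good2 L (U i)) with hBd
  have hBdT : Bd.card ≤ T := by
    refine le_trans ?_ hT
    apply Finset.card_le_card_of_injOn U
    · intro i hi
      simp only [hBd, Finset.coe_filter, Finset.mem_range, Set.mem_ofPred_eq] at hi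
      simp only [BadOn, Bad, Finset.coe_filter, Finset.mem_filter, Set.mem_ofPred_eq]
      exact ⟨⟨(hUp i hi.1).1, hi.2⟩, (hUp i hi.1).2⟩
    · intro i hi j hj h
      simp only [hBd, Finset.coe_filter, Finset.mem_range, Set.mem_ofPred_eq] at hi hj
      by_contra hne
      rcases lt_or_gt_of_ne hne with h' | h'
      · have := hU2 _ _ h' hj.1; rw [h] at this; exact lt_irrefl _ this
      · have := hU2 _ _ h' hi.1; rw [h] at this; exact lt_irrefl _ this
  set ρ : ℕ → ℕ := fun i => (Bd.filter (fun j => j < i)).card with hρ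
  have hρmono : ∀ i j, i ≤ j → ρ i ≤ ρ j := by
    intro i j hij
    apply Finset.card_le_card
    intro x hx
    rw [Finset.mem_filter] at hx ⊢
    exact ⟨hx.1, by omega⟩
  set Run : ℕ → Finset ℕ := fun r => (Finset.range m).filter (fun i => Good2 L (U i) ∧ ρ i = r) with hRun
  have hconv : ∀ r, ∀ i ∈ Run r, ∀ j ∈ Run r, ∀ k, i ≤ k → k ≤ j → k ∈ Run r := by
    intro r i hi j hj k hik hkj
    simp only [hRun, Finset.mem_filter, Finset.mem_range] at hi hj ⊢
    have hk : ρ k = r := by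
      have := hρmono _ _ hik
      have := hρmono _ _ hkj
      omega
    refine ⟨by omega, ?_, hk⟩
    by_contra hbad
    have hkj' : k < j := by
      rcases Nat.lt_or_ge k j with h | h
      · exact h
      · have : k = j := by omega
        subst this; exact absurd hj.2.1 hbad
    have : ρ k < ρ j := by
      apply Finset.card_lt_card
      rw [Finset.ssubset_iff_of_subset]
      · refine ⟨k, ?_, by simp⟩
        rw [Finset.mem_filter]
        refine ⟨?_, hkj'⟩
        simp only [hBd, Finset.mem_filter, Finset.mem_range]
        exact ⟨by omega, hbad⟩
      · intro x hx
        rw [Finset.mem_filter] at hx ⊢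
        exact ⟨hx.1, by omega⟩
    omega
  set act := (Finset.range (T + 1)).filter (fun r => ∃ lo ∈ Run r, lo + 5 ∈ Run r) with hact
  have hlo : ∀ r ∈ act, ∃ lo N, 3 ≤ N ∧ lo ∈ Run r ∧ lo + N + 2 ∈ Run r ∧
      ∀ i ∈ Run r, lo ≤ i ∧ i ≤ lo + N + 2 := by
    intro r hr
    obtain ⟨-, l, hl, hl5⟩ := Finset.mem_filter.1 hr
    have hne : (Run r).Nonempty := ⟨l, hl⟩
    refine ⟨(Run r).min' hne, (Run r).max' hne - (Run r).min' hne - 2, ?_, ?_, ?_, ?_⟩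
    · have := Finset.min'_le _ _ hl
      have := Finset.le_max' _ _ hl5
      omega
    · exact Finset.min'_mem _ _
    · have := Finset.min'_le _ _ hl
      have := Finset.le_max' _ _ hl5
      have e : (Run r).min' hne + ((Run r).max' hne - (Run r).min' hne - 2) + 2 = (Run r).max' hne := by omega
      rw [e]; exact Finset.max'_mem _ _
    · intro i hi
      have := Finset.min'_le _ _ hl
      have := Finset.le_max' _ _ hl5
      have := Finset.min'_le _ _ hi
      have := Finset.le_max' _ _ hi
      omega
  choose! lo N hN hlo1 hhi1 hall using hlo
  have hgrid : ∀ r ∈ act, ∃ a b c d e, Grid L p (N r) (fun i => U (lo r + (i + 1))) a b c d e := by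
    intro r hr
    have hin : ∀ i ≤ N r + 2, lo r + i ∈ Run r := fun i hi =>
      hconv r _ (hlo1 r hr) _ (hhi1 r hr) _ (by omega) (by omega)
    have hlt : lo r + (N r + 2) < m := by
      have := hin (N r + 2) le_rfl
      simp only [hRun, Finset.mem_filter, Finset.mem_range] at this
      exact this.1
    refine grid_of_run hL (V := fun i => U (lo r + i)) (hN r hr) ?_ ?_ ?_
    · intro i hi
      have := hin i hi
      simp only [hRun, Finset.mem_filter, Finset.mem_range] at this
      exact this.2.1
    · intro i hi
      exact hUadj (lo r + i) (by omega)
    · intro i hi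
      exact hU2 _ _ (by omega) (by omega)
  choose! a b c d e hG using hgrid
  set E : Finset (ℝ × ℝ) := Bd.image U ∪ (Finset.range (T + 1)).biUnion (fun r =>
    if r ∈ act then {U (lo r), U (lo r + N r + 2)} else (Run r).image U) with hE
  have hin : ∀ r ∈ act, ∀ i ≤ N r, lo r + (i + 1) ∈ Run r := fun r hr i hi =>
      hconv r _ (hlo1 r hr) _ (hhi1 r hr) _ (by omega) (by omega)
  have hin' : ∀ r ∈ act, ∀ i ≤ N r, lo r + (i + 1) < m ∧ ρ (lo r + (i + 1)) = r ∧
      Good2 L (U (lo r + (i + 1))) := by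
    intro r hr i hi
    have := hin r hr i hi
    simp only [hRun, Finset.mem_filter, Finset.mem_range] at this
    exact ⟨this.1, this.2.2, this.2.1⟩
  have hsep : ∀ r ∈ act, ∀ r' ∈ act, r < r' → ∀ i ≤ N r, ∀ j ≤ N r', ∃ u ∈ E,
      (U (lo r + (i + 1))).1 < u.1 ∧ u.1 < (U (lo r' + (j + 1))).1 := by
    intro r hr r' hr' hlt i hi j hj
    obtain ⟨i1, i2, i3⟩ := hin' r hr i hi
    obtain ⟨j1, j2, j3⟩ := hin' r' hr' j hj
    have : ∃ k ∈ Bd, k < lo r' + (j + 1) ∧ ¬ k < lo r + (i + 1) := by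
      by_contra hc
      push Not at hc
      have : ρ (lo r' + (j + 1)) ≤ ρ (lo r + (i + 1)) := by
        apply Finset.card_le_card
        intro x hx
        rw [Finset.mem_filter] at hx ⊢
        exact ⟨hx.1, hc x hx.1 hx.2⟩
      omega
    obtain ⟨k, hk, hk1, hk2⟩ := this
    refine ⟨U k, ?_, ?_, ?_⟩
    · rw [hE, Finset.mem_union]; left; exact Finset.mem_image_of_mem _ hk
    · have hk' : k < m ∧ ¬ Good2 L (U k) := by simpa [hBd] using hk
      apply hU2 _ _ _ hk'.1
      rcases Nat.lt_or_ge (lo r + (i + 1)) k with h | h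
      · exact h
      · have : k = lo r + (i + 1) := by omega
        rw [this] at hk'; exact absurd i3 hk'.2
    · exact hU2 _ _ hk1 j1
  refine ⟨E, act, N, fun r i => U (lo r + (i + 1)), a, b, c, d, e, ?_, ?_, ?_, ?_, ?_, ?_⟩
  · have h1 : (Bd.image U).card ≤ T := Finset.card_image_le.trans hBdT
    have h2 : ((Finset.range (T + 1)).biUnion (fun r =>
      if r ∈ act then {U (lo r), U (lo r + N r + 2)} else (Run r).image U)).card ≤ (T + 1) * 5 := by
      refine (Finset.card_biUnion_le_card_mul _ _ 5 ?_).trans ?_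
      · intro r hr
        split_ifs with h
        · exact (Finset.card_insert_le _ _).trans (by simp)
        · refine Finset.card_image_le.trans ?_
          by_cases hne : (Run r).Nonempty
          · have hsub : Run r ⊆ Finset.Ico ((Run r).min' hne) ((Run r).min' hne + 5) := by
              intro i hi
              rw [Finset.mem_Ico]
              refine ⟨Finset.min'_le _ _ hi, ?_⟩
              by_contra hc
              apply h
              rw [hact, Finset.mem_filter]
              refine ⟨hr, _, Finset.min'_mem _ hne, ?_⟩
              exact hconv r _ (Finset.min'_mem _ hne) i hi _ (by omega) (by omega)
            have := Finset.card_le_card hsub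
            simpa using this
          · rw [Finset.not_nonempty_iff_eq_empty] at hne
            rw [hne]; simp
      · simp
    have := Finset.card_union_le (Bd.image U) ((Finset.range (T + 1)).biUnion (fun r =>
      if r ∈ act then {U (lo r), U (lo r + N r + 2)} else (Run r).image U))
    rw [← hE] at this
    omega
  · have := Finset.card_filter_le (Finset.range (T + 1)) (fun r => ∃ lo ∈ Run r, lo + 5 ∈ Run r)
    simpa using this
  · intro r hr
    exact ⟨hN r hr, hG r hr⟩
  · intro r hr i j hij hj
    exact hU2 _ _ (by omega) (hin' r hr j hj).1
  · intro r hr r' hr' hne i hi j hj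
    rcases lt_or_gt_of_ne hne with h | h
    · obtain ⟨u, hu, h1, h2⟩ := hsep r hr r' hr' h i hi j hj
      exact ⟨u, hu, mul_pos (by linarith) (by linarith)⟩
    · obtain ⟨u, hu, h1, h2⟩ := hsep r' hr' r hr h j hj i hi
      exact ⟨u, hu, mul_pos_of_neg_of_neg (by linarith) (by linarith)⟩
  · intro v hv hpv
    obtain ⟨i, hi, rfl⟩ := hU3 v (Finset.mem_filter.2 ⟨hv, hpv⟩)
    by_cases hg : Good2 L (U i)
    · have hrT : ρ i < T + 1 := by
        have : ρ i ≤ Bd.card := Finset.card_filter_le _ _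
        omega
      have hiR : i ∈ Run (ρ i) := by
        simp only [hRun, Finset.mem_filter, Finset.mem_range]
        exact ⟨hi, hg, trivial⟩
      by_cases hr : ρ i ∈ act
      · have hh := hall _ hr i hiR
        by_cases h1 : i = lo (ρ i)
        · left
          rw [hE, Finset.mem_union]; right
          rw [Finset.mem_biUnion]
          refine ⟨ρ i, Finset.mem_range.2 hrT, ?_⟩
          rw [if_pos hr, ← h1]; simp
        · by_cases h2 : i = lo (ρ i) + N (ρ i) + 2
          · left
            rw [hE, Finset.mem_union]; right
            rw [Finset.mem_biUnion]
            refine ⟨ρ i, Finset.mem_range.2 hrT, ?_⟩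
            rw [if_pos hr, ← h2]; simp
          · right
            refine ⟨ρ i, hr, i - lo (ρ i) - 1, by omega, ?_⟩
            congr 1; omega
      · left
        rw [hE, Finset.mem_union]; right
        rw [Finset.mem_biUnion]
        refine ⟨ρ i, Finset.mem_range.2 hrT, ?_⟩
        rw [if_neg hr]
        exact Finset.mem_image_of_mem _ hiR
    · left
      rw [hE, Finset.mem_union]; left
      apply Finset.mem_image_of_mem
      simp only [hBd, Finset.mem_filter, Finset.mem_range]
      exact ⟨hi, hg⟩

end FOL

set_option linter.unusedVariables false
namespace FOL

open Finset MvPolynomial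

attribute [local instance] Classical.propDecidable

abbrev Pol := MvPolynomial (Fin 3) ℝ

/-- homogenising substitution -/
noncomputable def Phi : Pol →ₐ[ℝ] Polynomial Pol :=
  MvPolynomial.aeval (fun i => Polynomial.C (X i) * Polynomial.X)

lemma Phi_monomial (d : Fin 3 →₀ ℕ) (r : ℝ) :
    Phi (monomial d r) = Polynomial.monomial d.degree (monomial d r) := by
  rw [Phi, aeval_monomial, Finsupp.prod_fintype _ _ (by simp)]
  simp only [mul_pow, Finset.prod_mul_distrib, Finset.prod_pow_eq_pow_sum]
  rw [← Polynomial.C_mul_X_pow_eq_monomial, MvPolynomial.monomial_eq, map_mul,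
    Finsupp.prod_fintype _ _ (by simp), map_prod, Finsupp.degree_eq_sum]
  simp only [map_pow]
  rw [mul_assoc]
  rfl

lemma Phi_coeff (f : Pol) (k : ℕ) : (Phi f).coeff k = homogeneousComponent k f := by
  conv_lhs => rw [f.as_sum]
  rw [map_sum, Polynomial.finsetSum_coeff, homogeneousComponent_apply, Finset.sum_filter]
  apply Finset.sum_congr rfl
  intro d hd
  rw [Phi_monomial, Polynomial.coeff_monomial]

lemma hom_factor {f g h : Pol} {n : ℕ} (hf : f.IsHomogeneous n) (h0 : f ≠ 0) (he : f = g * h) :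
    ∃ i j, i + j = n ∧ g.IsHomogeneous i ∧ h.IsHomogeneous j := by
  have hPf : Phi f = Polynomial.monomial n f := by
    ext1 k
    rw [Phi_coeff, Polynomial.coeff_monomial]
    rw [homogeneousComponent_of_mem hf]
    simp [eq_comm]
  have key : ∀ g h : Pol, f = g * h → g.IsHomogeneous (Phi g).natDegree ∧ (Phi g).natDegree + (Phi h).natDegree = n := by
    intro g h he
    have hprod : Phi g * Phi h = Polynomial.monomial n f := by rw [← map_mul, ← he, hPf]
    have hne : Phi g * Phi h ≠ 0 := by
      rw [hprod]; simpa using h0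
    have hg0 : Phi g ≠ 0 := left_ne_zero_of_mul hne
    have hh0 : Phi h ≠ 0 := right_ne_zero_of_mul hne
    have d1 := Polynomial.natDegree_mul hg0 hh0
    have d2 := Polynomial.natTrailingDegree_mul hg0 hh0
    rw [hprod, Polynomial.natDegree_monomial_eq _ h0] at d1
    rw [hprod, Polynomial.natTrailingDegree_monomial h0] at d2
    have d3 := Polynomial.natTrailingDegree_le_natDegree (Phi g)
    have d4 := Polynomial.natTrailingDegree_le_natDegree (Phi h)
    refine ⟨?_, by omega⟩
    have d5 : (Phi g).natTrailingDegree = (Phi g).natDegree := by omega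
    intro d hd
    have hh : coeff d (homogeneousComponent d.degree g) ≠ 0 := by
      rw [coeff_homogeneousComponent]; simpa using hd
    have hne' : (Phi g).coeff d.degree ≠ 0 := by
      rw [Phi_coeff]; intro h; rw [h] at hh; simp at hh
    have e1 := Polynomial.le_natDegree_of_ne_zero hne'
    have e2 := Polynomial.natTrailingDegree_le_of_ne_zero hne'
    have : d.degree = (Phi g).natDegree := by omega
    rw [← this, Finsupp.degree_eq_weight_one]; rfl
  obtain ⟨a1, a2⟩ := key g h he
  obtain ⟨b1, b2⟩ := key h g (by rw [he, mul_comm])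
  exact ⟨_, _, a2, a1, b1⟩

abbrev Hm (k : ℕ) : Submodule ℝ Pol := homogeneousSubmodule (Fin 3) ℝ k

instance Hm_fin (k : ℕ) : Module.Finite ℝ (Hm k) :=
  Module.Finite.of_fg (homogeneousSubmodule_fg (Fin 3) ℝ k)

lemma finrank_Hm (k : ℕ) : Module.finrank ℝ (Hm k) = (k + 2).choose 2 := by
  have h := homogeneousSubmodule_eq_finsupp_supported (Fin 3) ℝ k
  have e := (LinearEquiv.ofEq _ _ h).trans (AddMonoidAlgebra.supportedEquivFinsupp {d : Fin 3 →₀ ℕ | d.degree = k})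
  have hs : {d : Fin 3 →₀ ℕ | d.degree = k} = ((Finset.univ.finsuppAntidiag k : Finset (Fin 3 →₀ ℕ)) : Set (Fin 3 →₀ ℕ)) := by
    ext d
    simp [mem_finsuppAntidiag, Finsupp.degree_eq_sum]
  rw [e.finrank_eq, hs]
  rw [Module.finrank_finsupp_self, ← Nat.card_eq_fintype_card, Nat.card_coe_set_eq,
    Set.ncard_coe_finset, card_finsuppAntidiag_nat_eq_choose]
  simp only [Finset.card_univ, Fintype.card_fin]
  rw [show 3 + k - 1 = k + 2 by omega]
  exact Nat.choose_symm_add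

lemma two_choose (k : ℕ) : 2 * (k + 2).choose 2 = (k + 2) * (k + 1) := by
  have := Nat.add_one_mul_choose_eq (k+1) 1
  simp only [Nat.choose_one_right] at this
  rw [mul_comm]; exact this.symm

noncomputable def lin (n : Fin 3 → ℝ) : Pol := ∑ i, C (n i) * X i

lemma lin_hom (n : Fin 3 → ℝ) : (lin n).IsHomogeneous 1 := by
  apply IsHomogeneous.sum
  intro i _
  simpa using (isHomogeneous_C (Fin 3) (n i)).mul (isHomogeneous_X ℝ i)

lemma eval_lin (n x : Fin 3 → ℝ) : eval x (lin n) = n 0 * x 0 + n 1 * x 1 + n 2 * x 2 := by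
  simp [lin, Fin.sum_univ_three]

/-- squared norm of the cross product -/
def crs (x y : Fin 3 → ℝ) : ℝ :=
  (x 1 * y 2 - x 2 * y 1)^2 + (x 2 * y 0 - x 0 * y 2)^2 + (x 0 * y 1 - x 1 * y 0)^2

lemma sep (x y : Fin 3 → ℝ) (h : crs x y ≠ 0) :
    ∃ n, eval x (lin n) = 0 ∧ eval y (lin n) ≠ 0 := by
  refine ⟨![x 1 * (x 0 * y 1 - x 1 * y 0) - x 2 * (x 2 * y 0 - x 0 * y 2),
    x 2 * (x 1 * y 2 - x 2 * y 1) - x 0 * (x 0 * y 1 - x 1 * y 0),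
    x 0 * (x 2 * y 0 - x 0 * y 2) - x 1 * (x 1 * y 2 - x 2 * y 1)], ?_, ?_⟩
  · rw [eval_lin]; simp; ring
  · rw [eval_lin]; intro h0; apply h; simp at h0; simp only [crs]; linarith

lemma bump {ι : Type*} (S : Finset ι) (x : ι → Fin 3 → ℝ)
    (hx : ∀ i ∈ S, ∀ j ∈ S, i ≠ j → crs (x i) (x j) ≠ 0) (hx0 : ∀ i ∈ S, x i ≠ 0) (D : ℕ) (hD : S.card ≤ D)
    (j : ι) (hj : j ∈ S) :
    ∃ h : Pol, h.IsHomogeneous D ∧ eval (x j) h = 1 ∧ ∀ i ∈ S, i ≠ j → eval (x i) h = 0 := by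
  have h1 : ∀ i, ∃ n, i ∈ S → i ≠ j → eval (x i) (lin n) = 0 ∧ eval (x j) (lin n) ≠ 0 := by
    intro i
    by_cases h : i ∈ S ∧ i ≠ j
    · obtain ⟨n, hn⟩ := sep _ _ (hx i h.1 j hj h.2)
      exact ⟨n, fun _ _ => hn⟩
    · exact ⟨0, fun a b => absurd ⟨a, b⟩ h⟩
  choose n hn using h1
  set G : Pol := (∏ i ∈ S.erase j, lin (n i)) * (lin (x j))^(D - (S.card - 1)) with hG
  have hGh : G.IsHomogeneous D := by
    have e1 := IsHomogeneous.prod (S.erase j) (fun i => lin (n i)) (fun _ => 1) (fun i _ => lin_hom _)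
    have e2 := (lin_hom (x j)).pow (D - (S.card - 1))
    have e3 := e1.mul e2
    have hc : 0 < S.card := Finset.card_pos.2 ⟨j, hj⟩
    simp only [Finset.sum_const, Finset.card_erase_of_mem hj, smul_eq_mul, mul_one, one_mul] at e3
    rwa [show S.card - 1 + (D - (S.card - 1)) = D by omega] at e3
  have hGj : eval (x j) G ≠ 0 := by
    rw [hG, map_mul, map_prod, map_pow]
    apply mul_ne_zero
    · rw [Finset.prod_ne_zero_iff]
      intro i hi
      rw [Finset.mem_erase] at hi
      exact (hn i hi.2 hi.1).2
    · apply pow_ne_zero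
      rw [eval_lin]
      intro h0
      apply hx0 j hj
      ext i
      have a0 := sq_nonneg (x j 0)
      have a1 := sq_nonneg (x j 1)
      have a2 := sq_nonneg (x j 2)
      fin_cases i <;> simp <;> nlinarith
  refine ⟨C (eval (x j) G)⁻¹ * G, ?_, ?_, ?_⟩
  · simpa using (isHomogeneous_C (Fin 3) (eval (x j) G)⁻¹).mul hGh
  · rw [map_mul, eval_C, inv_mul_cancel₀ hGj]
  · intro i hi hij
    have h0 : eval (x i) G = 0 := by
      rw [hG, map_mul, map_prod,
        Finset.prod_eq_zero (Finset.mem_erase.2 ⟨hij, hi⟩) (hn i hi hij).1, zero_mul]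
    rw [map_mul, h0, mul_zero]

lemma bezout {ι : Type*} (S : Finset ι) (x : ι → Fin 3 → ℝ)
    (hx : ∀ i ∈ S, ∀ j ∈ S, i ≠ j → crs (x i) (x j) ≠ 0) (hx0 : ∀ i ∈ S, x i ≠ 0)
    {f g : Pol} {d e : ℕ} (hf : Irreducible f) (hfd : f.IsHomogeneous d) (hge : g.IsHomogeneous e)
    (hfg : ¬ f ∣ g) (hSf : ∀ i ∈ S, eval (x i) f = 0) (hSg : ∀ i ∈ S, eval (x i) g = 0) :
    S.card ≤ d * e := by
  set m := S.card with hm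
  have hf0 : f ≠ 0 := hf.ne_zero
  set φ0 : (Hm (m+e) × Hm (m+d)) →ₗ[ℝ] Pol :=
    ((LinearMap.mulLeft ℝ f).comp (Hm (m+e)).subtype).coprod
      ((LinearMap.mulLeft ℝ g).comp (Hm (m+d)).subtype) with hφ0
  have hφv : ∀ z, φ0 z = f * z.1 + g * z.2 := by intro z; simp [hφ0]
  have hran : ∀ z, φ0 z ∈ Hm (m+d+e) := by
    intro z
    rw [hφv]
    apply Submodule.add_mem
    · have := hfd.mul z.1.2
      rw [mem_homogeneousSubmodule]
      convert this using 1; ring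
    · have := hge.mul z.2.2
      rw [mem_homogeneousSubmodule]
      convert this using 1; ring
  set φ := φ0.codRestrict (Hm (m+d+e)) hran with hφ
  set ψ : Hm m →ₗ[ℝ] (Pol × Pol) :=
    ((LinearMap.mulLeft ℝ (-g)).prod (LinearMap.mulLeft ℝ f)).comp (Hm m).subtype with hψ
  have hψv : ∀ z, ψ z = (-g * z, f * z) := by intro z; simp [hψ]
  -- kernel
  have hker : Module.finrank ℝ (LinearMap.ker φ) ≤ Module.finrank ℝ (Hm m) := by
    have hsub : Submodule.map (LinearMap.prodMap (Hm (m+e)).subtype (Hm (m+d)).subtype) (LinearMap.ker φ)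
        ≤ LinearMap.range ψ := by
      rintro _ ⟨⟨A, B⟩, hAB, rfl⟩
      have h0 : f * (A : Pol) + g * (B : Pol) = 0 := by
        have : φ (A, B) = 0 := hAB
        have h2 := congrArg Subtype.val this
        rw [← hφv (A, B)]
        simpa [hφ] using h2
      have hdvd : f ∣ g * (B : Pol) := ⟨-A, by linear_combination h0⟩
      rcases hf.prime.dvd_or_dvd hdvd with h | ⟨Cc, hC⟩
      · exact absurd h hfg
      have hA : (A : Pol) = -g * Cc := by
        have : f * ((A : Pol) + g * Cc) = 0 := by rw [hC] at h0; linear_combination h0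
        rcases mul_eq_zero.1 this with h | h
        · exact absurd h hf0
        · linear_combination h
      have hCm : Cc ∈ Hm m := by
        by_cases hB : (B : Pol) = 0
        · have : Cc = 0 := by
            rw [hB] at hC
            rcases mul_eq_zero.1 hC.symm with h | h
            · exact absurd h hf0
            · exact h
          rw [this]; exact Submodule.zero_mem _
        · obtain ⟨i, j, hij, h1, h2⟩ := hom_factor B.2 hB hC
          have : i = d := h1.inj_right hfd hf0
          rw [mem_homogeneousSubmodule]
          rwa [show j = m by omega] at h2
      refine ⟨⟨Cc, hCm⟩, ?_⟩
      rw [hψv]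
      simp [hA, hC]
    have hinj : Function.Injective (LinearMap.prodMap (Hm (m+e)).subtype (Hm (m+d)).subtype) := by
      intro a b hab
      simpa [Prod.ext_iff] using hab
    rw [(Submodule.equivMapOfInjective _ hinj (LinearMap.ker φ)).finrank_eq]
    exact (Submodule.finrank_mono hsub).trans (LinearMap.finrank_range_le ψ)
  have hrn := LinearMap.finrank_range_add_finrank_ker φ
  rw [Module.finrank_prod, finrank_Hm, finrank_Hm] at hrn
  rw [finrank_Hm] at hker
  -- evaluation
  set E : Hm (m+d+e) →ₗ[ℝ] (S → ℝ) :=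
    LinearMap.pi (fun i : S => ((MvPolynomial.aeval (x i) : Pol →ₐ[ℝ] ℝ).toLinearMap).comp (Hm (m+d+e)).subtype) with hE
  have hEv : ∀ z i, E z i = eval (x i) (z : Pol) := by
    intro z i; simp [hE, MvPolynomial.aeval_eq_eval]
  have hsurj : LinearMap.range E = ⊤ := by
    rw [LinearMap.range_eq_top]
    intro y
    have := fun j : S => bump S x hx hx0 (m+d+e) (by omega) j j.2
    choose h h1 h2 h3 using this
    refine ⟨∑ j, y j • ⟨h j, h1 j⟩, ?_⟩
    funext i
    rw [map_sum, Finset.sum_apply, Finset.sum_eq_single i]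
    · simp [hEv, h2]
    · intro j _ hji
      have := h3 j i i.2 (fun hh => hji (Subtype.ext hh.symm))
      simp [hEv, this]
    · simp
  have hrnE := LinearMap.finrank_range_add_finrank_ker E
  rw [hsurj, finrank_top, Module.finrank_fintype_fun_eq_card, Fintype.card_coe, finrank_Hm, ← hm] at hrnE
  have hle : LinearMap.range φ ≤ LinearMap.ker E := by
    rintro _ ⟨z, rfl⟩
    rw [LinearMap.mem_ker]
    funext i
    rw [hEv]
    have : ((φ z : Hm (m+d+e)) : Pol) = f * z.1 + g * z.2 := by rw [← hφv]; rfl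
    rw [this, map_add, map_mul, map_mul, hSf i i.2, hSg i i.2]; simp
  have hfin := Submodule.finrank_mono hle
  have c1 := two_choose m
  have c2 := two_choose (m+d)
  have c3 := two_choose (m+e)
  have c4 := two_choose (m+d+e)
  nlinarith

end FOL

set_option linter.unusedVariables false
namespace FOL

open Finset MvPolynomial

attribute [local instance] Classical.propDecidable

lemma unit_of_hom0 {f : Pol} (h : f.IsHomogeneous 0) (h0 : f ≠ 0) : IsUnit f := by
  have := (totalDegree_zero_iff_isHomogeneous (Fin 3)).2 h
  have hC := totalDegree_eq_zero_iff_eq_C.1 this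
  rw [isUnit_iff_eq_C_of_isReduced]
  refine ⟨_, ?_, hC⟩
  rw [isUnit_iff_ne_zero]
  intro hh
  rw [hh] at hC
  exact h0 (by simpa using hC)

lemma not_unit_of_hom {f : Pol} {n : ℕ} (h : f.IsHomogeneous n) (hn : 1 ≤ n) : ¬ IsUnit f := by
  intro hu
  have h1 := (isUnit_iff_totalDegree_of_isReduced.1 hu).2
  have h2 := h.inj_right ((totalDegree_zero_iff_isHomogeneous (Fin 3)).1 h1) hu.ne_zero
  omega

lemma irr_of_hom1 {f : Pol} (h : f.IsHomogeneous 1) (h0 : f ≠ 0) : Irreducible f := by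
  refine ⟨not_unit_of_hom h le_rfl, ?_⟩
  intro a b hab
  obtain ⟨i, j, hij, h1, h2⟩ := hom_factor h h0 hab
  have ha : a ≠ 0 := by rintro rfl; apply h0; rw [hab, zero_mul]
  have hb : b ≠ 0 := by rintro rfl; apply h0; rw [hab, mul_zero]
  rcases Nat.eq_zero_or_pos i with hi | hi
  · subst hi; exact Or.inl (unit_of_hom0 h1 ha)
  · have : j = 0 := by omega
    subst this; exact Or.inr (unit_of_hom0 h2 hb)

lemma hom1_eq_lin {f : Pol} (h : f.IsHomogeneous 1) : ∃ n, f = lin n := by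
  let T : (Fin 3 → ℝ) →ₗ[ℝ] Hm 1 :=
    { toFun := fun n => ⟨lin n, lin_hom n⟩
      map_add' := by intro a b; ext1; simp [lin, add_mul, Finset.sum_add_distrib]
      map_smul' := by intro a b; ext1; simp [lin, Finset.smul_sum, smul_eq_C_mul, mul_assoc, Finset.mul_sum] }
  have hinj : Function.Injective T := by
    intro a b hab
    have h1 : lin a = lin b := congrArg Subtype.val hab
    have e := fun x => congrArg (eval x) h1
    simp only [eval_lin] at e
    have e0 := e ![1,0,0]
    have e1 := e ![0,1,0]
    have e2 := e ![0,0,1]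
    simp at e0 e1 e2
    ext i; fin_cases i <;> simp [e0, e1, e2]
  have hs := (LinearMap.injective_iff_surjective_of_finrank_eq_finrank (f := T) (by
    rw [finrank_Hm]; simp [Nat.choose])).1 hinj
  obtain ⟨n, hn⟩ := hs ⟨f, h⟩
  exact ⟨n, (congrArg Subtype.val hn).symm⟩

noncomputable def quad (c : Fin 6 → ℝ) : Pol :=
  C (c 0) * (X 0 * X 0) + C (c 1) * (X 0 * X 1) + C (c 2) * (X 0 * X 2) + C (c 3) * (X 1 * X 1)
   + C (c 4) * (X 1 * X 2) + C (c 5) * (X 2 * X 2)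

lemma quad_hom (c : Fin 6 → ℝ) : (quad c).IsHomogeneous 2 := by
  have h : ∀ (r : ℝ) (i j : Fin 3), (C r * (X i * X j) : Pol).IsHomogeneous 2 := by
    intro r i j
    simpa using (isHomogeneous_C (Fin 3) r).mul ((isHomogeneous_X ℝ i).mul (isHomogeneous_X ℝ j))
  exact (((((h _ _ _).add (h _ _ _)).add (h _ _ _)).add (h _ _ _)).add (h _ _ _)).add (h _ _ _)

lemma hom2_eq_quad {f : Pol} (h : f.IsHomogeneous 2) : ∃ c, f = quad c := by
  let T : (Fin 6 → ℝ) →ₗ[ℝ] Hm 2 :=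
    { toFun := fun n => ⟨quad n, quad_hom n⟩
      map_add' := by intro a b; ext1; simp [quad]; ring
      map_smul' := by intro a b; ext1; simp [quad, smul_eq_C_mul]; ring }
  have hinj : Function.Injective T := by
    intro a b hab
    have h1 : quad a = quad b := congrArg Subtype.val hab
    have e := fun x => congrArg (eval x) h1
    simp only [quad, map_add, map_mul, eval_C, eval_X] at e
    have e0 := e ![1,0,0]
    have e1 := e ![0,1,0]
    have e2 := e ![0,0,1]
    have e3 := e ![1,1,0]
    have e4 := e ![1,0,1]
    have e5 := e ![0,1,1]
    simp at e0 e1 e2 e3 e4 e5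
    have f3 : a 1 = b 1 := by linarith
    have f4 : a 2 = b 2 := by linarith
    have f5 : a 4 = b 4 := by linarith
    ext i; fin_cases i <;> simp [e0, e1, e2, f3, f4, f5]
  have hs := (LinearMap.injective_iff_surjective_of_finrank_eq_finrank (f := T) (by
    rw [finrank_Hm]; simp [Nat.choose])).1 hinj
  obtain ⟨n, hn⟩ := hs ⟨f, h⟩
  exact ⟨n, (congrArg Subtype.val hn).symm⟩

/-- zero sets are covered by irreducible homogeneous factors -/
lemma factor_cover (n : ℕ) : ∀ F : Pol, F ≠ 0 → F.IsHomogeneous n →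
    ∃ l : List Pol, l.length ≤ n ∧ (∀ f ∈ l, Irreducible f ∧ f ∣ F ∧ ∃ d, 1 ≤ d ∧ d ≤ n ∧ f.IsHomogeneous d) ∧
      ∀ x : Fin 3 → ℝ, eval x F = 0 → ∃ f ∈ l, eval x f = 0 := by
  induction n using Nat.strong_induction_on with
  | _ n ih =>
  intro F h0 hF
  rcases Nat.eq_zero_or_pos n with hn | hn
  · subst hn
    refine ⟨[], by simp, by simp, ?_⟩
    intro x hx
    exact absurd hx ((unit_of_hom0 hF h0).map (eval x)).ne_zero
  by_cases hirr : Irreducible F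
  · refine ⟨[F], by simp; omega, ?_, ?_⟩
    · intro f hf
      simp only [List.mem_singleton] at hf
      subst hf
      exact ⟨hirr, dvd_rfl, n, hn, le_rfl, hF⟩
    · intro x hx; exact ⟨F, by simp, hx⟩
  · have hnu := not_unit_of_hom hF hn
    have : ∃ a b, F = a * b ∧ ¬ IsUnit a ∧ ¬ IsUnit b := by
      by_contra hc
      push Not at hc
      apply hirr
      refine ⟨hnu, ?_⟩
      intro a b hab
      by_cases ha : IsUnit a
      · exact Or.inl ha
      · exact Or.inr (hc a b hab ha)
    obtain ⟨a, b, hab, ha, hb⟩ := this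
    obtain ⟨i, j, hij, h1, h2⟩ := hom_factor hF h0 hab
    have ha0 : a ≠ 0 := by rintro rfl; apply h0; rw [hab, zero_mul]
    have hb0 : b ≠ 0 := by rintro rfl; apply h0; rw [hab, mul_zero]
    have hi : 1 ≤ i := by
      by_contra hc
      have : i = 0 := by omega
      subst this; exact ha (unit_of_hom0 h1 ha0)
    have hj : 1 ≤ j := by
      by_contra hc
      have : j = 0 := by omega
      subst this; exact hb (unit_of_hom0 h2 hb0)
    obtain ⟨l1, a1, a2, a3⟩ := ih i (by omega) a ha0 h1
    obtain ⟨l2, b1, b2, b3⟩ := ih j (by omega) b hb0 h2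
    refine ⟨l1 ++ l2, by simp; omega, ?_, ?_⟩
    · intro f hf
      rw [List.mem_append] at hf
      rcases hf with hf | hf
      · obtain ⟨c1, c2, d, c3, c4, c5⟩ := a2 f hf
        exact ⟨c1, c2.trans ⟨b, hab⟩, d, c3, by omega, c5⟩
      · obtain ⟨c1, c2, d, c3, c4, c5⟩ := b2 f hf
        exact ⟨c1, c2.trans ⟨a, by rw [hab, mul_comm]⟩, d, c3, by omega, c5⟩
    · intro x hx
      rw [hab, map_mul] at hx
      rcases mul_eq_zero.1 hx with h | h
      · obtain ⟨f, hf, hf'⟩ := a3 x h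
        exact ⟨f, by simp [hf], hf'⟩
      · obtain ⟨f, hf, hf'⟩ := b3 x h
        exact ⟨f, by simp [hf], hf'⟩

/-- a nonzero cubic through nine given vectors -/
lemma cubic_through (x : Fin 9 → Fin 3 → ℝ) :
    ∃ F : Pol, F ≠ 0 ∧ F.IsHomogeneous 3 ∧ ∀ i, eval (x i) F = 0 := by
  set E : Hm 3 →ₗ[ℝ] (Fin 9 → ℝ) :=
    LinearMap.pi (fun i => ((MvPolynomial.aeval (x i) : Pol →ₐ[ℝ] ℝ).toLinearMap).comp (Hm 3).subtype) with hE
  have hEv : ∀ z i, E z i = eval (x i) (z : Pol) := by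
    intro z i; simp [hE, MvPolynomial.aeval_eq_eval]
  have : LinearMap.ker E ≠ ⊥ := by
    apply LinearMap.ker_ne_bot_of_finrank_lt
    rw [finrank_Hm]; simp [Nat.choose]
  obtain ⟨z, hz, hz0⟩ := (Submodule.ne_bot_iff _).1 this
  refine ⟨z, by simpa using hz0, z.2, fun i => ?_⟩
  rw [← hEv, LinearMap.mem_ker.1 hz]; rfl

lemma crs_ne_of_sep {x y : Fin 3 → ℝ} (hx : x ≠ 0) {n : Fin 3 → ℝ} (h1 : eval x (lin n) = 0)
    (h2 : eval y (lin n) ≠ 0) : crs x y ≠ 0 := by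
  intro h
  simp only [crs] at h
  have q1 := sq_nonneg (x 1 * y 2 - x 2 * y 1)
  have q2 := sq_nonneg (x 2 * y 0 - x 0 * y 2)
  have q3 := sq_nonneg (x 0 * y 1 - x 1 * y 0)
  have m1 : x 1 * y 2 - x 2 * y 1 = 0 := by
    have : (x 1 * y 2 - x 2 * y 1)^2 = 0 := by linarith
    exact pow_eq_zero_iff (two_ne_zero) |>.1 this
  have m2 : x 2 * y 0 - x 0 * y 2 = 0 := by
    have : (x 2 * y 0 - x 0 * y 2)^2 = 0 := by linarith
    exact pow_eq_zero_iff (two_ne_zero) |>.1 this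
  have m3 : x 0 * y 1 - x 1 * y 0 = 0 := by
    have : (x 0 * y 1 - x 1 * y 0)^2 = 0 := by linarith
    exact pow_eq_zero_iff (two_ne_zero) |>.1 this
  rw [eval_lin] at h1 h2
  apply hx
  ext i
  fin_cases i <;> simp <;> by_contra hh <;> apply h2 <;> apply mul_left_cancel₀ hh
  · linear_combination y 0 * h1 + n 1 * m3 - n 2 * m2
  · linear_combination y 1 * h1 - n 0 * m3 + n 2 * m1
  · linear_combination y 2 * h1 + n 0 * m2 - n 1 * m1

lemma crs_symm (x y : Fin 3 → ℝ) : crs x y = crs y x := by simp only [crs]; ring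

/-- if `crs x y ≠ 0` and a line contains both and `z`, then linear forms vanishing at x,y vanish at z -/
lemma lin_zero_of_col {x y z n m : Fin 3 → ℝ} (hxy : crs x y ≠ 0) (hn : n ≠ 0)
    (h1 : eval x (lin n) = 0) (h2 : eval y (lin n) = 0) (h3 : eval z (lin n) = 0)
    (g1 : eval x (lin m) = 0) (g2 : eval y (lin m) = 0) : eval z (lin m) = 0 := by
  -- m and n are both parallel to x × y
  by_contra hz
  have c1 := crs_ne_of_sep (x := n) (y := m) hn (n := z) (by rw [eval_lin] at *; linarith) (by rw [eval_lin] at *; intro h; apply hz; linarith)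
  rw [eval_lin] at *
  -- cross product n × m is parallel to x and y, contradiction
  set p0 := n 1 * m 2 - n 2 * m 1 with hp0
  set p1 := n 2 * m 0 - n 0 * m 2 with hp1
  set p2 := n 0 * m 1 - n 1 * m 0 with hp2
  have e1 : x 1 * p2 - x 2 * p1 = 0 := by rw [hp2, hp1]; linear_combination n 0 * g1 - m 0 * h1
  have e2 : x 2 * p0 - x 0 * p2 = 0 := by rw [hp2, hp0]; linear_combination n 1 * g1 - m 1 * h1
  have e3 : x 0 * p1 - x 1 * p0 = 0 := by rw [hp0, hp1]; linear_combination n 2 * g1 - m 2 * h1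
  have f1 : y 1 * p2 - y 2 * p1 = 0 := by rw [hp2, hp1]; linear_combination n 0 * g2 - m 0 * h2
  have f2 : y 2 * p0 - y 0 * p2 = 0 := by rw [hp2, hp0]; linear_combination n 1 * g2 - m 1 * h2
  have f3 : y 0 * p1 - y 1 * p0 = 0 := by rw [hp0, hp1]; linear_combination n 2 * g2 - m 2 * h2
  have : p0 = 0 ∧ p1 = 0 ∧ p2 = 0 := by
    by_contra hc
    apply hxy
    simp only [crs]
    have : p0 ≠ 0 ∨ p1 ≠ 0 ∨ p2 ≠ 0 := by tauto
    have key : x 1 * y 2 - x 2 * y 1 = 0 ∧ x 2 * y 0 - x 0 * y 2 = 0 ∧ x 0 * y 1 - x 1 * y 0 = 0 := by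
      rcases this with h | h | h <;> refine ⟨?_, ?_, ?_⟩ <;> apply mul_left_cancel₀ h
      · linear_combination (-y 2) * e3 + y 1 * (-e2) - x 0 * f1
      · linear_combination y 0 * e2 - x 0 * f2
      · linear_combination y 0 * e3 - x 0 * f3
      · linear_combination y 1 * e1 - x 1 * f1
      · linear_combination (-y 0) * e1 - y 2 * e3 - x 1 * f2
      · linear_combination y 1 * e3 - x 1 * f3
      · linear_combination y 2 * e1 - x 2 * f1
      · linear_combination y 2 * e2 - x 2 * f2
      · linear_combination (-y 0) * e1 - y 1 * e2 - x 2 * f3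
    rw [key.1, key.2.1, key.2.2]; simp
  apply c1
  simp only [crs]
  rw [← hp0, ← hp1, ← hp2, this.1, this.2.1, this.2.2]; simp


lemma ne_zero_of_eval {x n : Fin 3 → ℝ} (h : eval x (lin n) ≠ 0) : n ≠ 0 := by
  rintro rfl; apply h; rw [eval_lin]; simp

lemma lin_ne_zero {n : Fin 3 → ℝ} (h : n ≠ 0) : lin n ≠ 0 := by
  intro h0
  apply h
  have e := fun x => congrArg (eval x) h0
  simp only [eval_lin, map_zero] at e
  have e0 := e ![1,0,0]
  have e1 := e ![0,1,0]
  have e2 := e ![0,0,1]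
  simp at e0 e1 e2
  ext i; fin_cases i <;> simp [e0, e1, e2]

lemma vec_ne_zero {x n : Fin 3 → ℝ} (h : eval x (lin n) ≠ 0) : x ≠ 0 := by
  rintro rfl; apply h; rw [eval_lin]; simp

/-- a line with too many zeros divides -/
lemma lin_dvd {n : Fin 3 → ℝ} (hn : n ≠ 0) {g : Pol} {e k : ℕ} (hg : g.IsHomogeneous e) (hk : e < k)
    (x : Fin k → Fin 3 → ℝ) (hx : ∀ i j, i < j → crs (x i) (x j) ≠ 0)
    (hx0 : ∀ i, x i ≠ 0)
    (h1 : ∀ i, eval (x i) (lin n) = 0) (h2 : ∀ i, eval (x i) g = 0) : lin n ∣ g := by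
  by_contra hc
  have := bezout (Finset.univ : Finset (Fin k)) x (by
    intro i _ j _ hij
    rcases lt_or_gt_of_ne hij with h | h
    · exact hx i j h
    · rw [crs_symm]; exact hx j i h) (fun i _ => hx0 i) (irr_of_hom1 (lin_hom n) (lin_ne_zero hn)) (lin_hom n) hg hc
    (fun i _ => h1 i) (fun i _ => h2 i)
  simp at this
  omega

lemma hom_quot {f g h : Pol} {d e : ℕ} (hf : f.IsHomogeneous d) (hf0 : f ≠ 0) (hg : g.IsHomogeneous (d + e))
    (he : g = f * h) : h.IsHomogeneous e := by
  by_cases h0 : h = 0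
  · rw [h0]; exact isHomogeneous_zero _ _ _
  · obtain ⟨i, j, hij, h1, h2⟩ := hom_factor hg (by rw [he]; exact mul_ne_zero hf0 h0) he
    have : i = d := h1.inj_right hf hf0
    rwa [show j = e by omega] at h2

theorem chasles {F : Pol} (hF : F.IsHomogeneous 3)
    {l1 l2 l3 m1 m2 m3 X z2 z3 u1 u2 u3 w1 w2 w3 : Fin 3 → ℝ}
    (hX : eval X (lin l1) = 0) (hz2 : eval z2 (lin l1) = 0) (hz3 : eval z3 (lin l1) = 0) (hl1 : l1 ≠ 0)
    (hu1 : eval u1 (lin l2) = 0) (hu2 : eval u2 (lin l2) = 0) (hu3 : eval u3 (lin l2) = 0)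
    (hw1 : eval w1 (lin l3) = 0) (hw2 : eval w2 (lin l3) = 0) (hw3 : eval w3 (lin l3) = 0)
    (gX : eval X (lin m1) = 0) (gu1 : eval u1 (lin m1) = 0) (gw1 : eval w1 (lin m1) = 0)
    (gz2 : eval z2 (lin m2) = 0) (gu2 : eval u2 (lin m2) = 0) (gw2 : eval w2 (lin m2) = 0)
    (gz3 : eval z3 (lin m3) = 0) (gu3 : eval u3 (lin m3) = 0) (gw3 : eval w3 (lin m3) = 0)
    (a1 : eval w1 (lin l2) ≠ 0) (a2 : eval w2 (lin l2) ≠ 0) (a3 : eval w3 (lin l2) ≠ 0)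
    (b2 : eval z2 (lin l2) ≠ 0) (b3 : eval z3 (lin l2) ≠ 0)
    (c2 : eval z2 (lin l3) ≠ 0) (c3 : eval z3 (lin l3) ≠ 0)
    (d12 : eval u2 (lin m1) ≠ 0) (d21 : eval u1 (lin m2) ≠ 0) (d31 : eval u1 (lin m3) ≠ 0)
    (d32 : eval u2 (lin m3) ≠ 0)
    (e12 : eval w2 (lin m1) ≠ 0) (e13 : eval w3 (lin m1) ≠ 0) (e23 : eval w3 (lin m2) ≠ 0)
    (k23 : eval z3 (lin m2) ≠ 0) (hu3' : u3 ≠ 0) 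
    (f2 : eval z2 F = 0) (f3 : eval z3 F = 0) (f4 : eval u1 F = 0) (f5 : eval u2 F = 0)
    (f6 : eval u3 F = 0) (f7 : eval w1 F = 0) (f8 : eval w2 F = 0) (f9 : eval w3 F = 0) :
    eval X F = 0 := by
  have hy : ∃ y : Fin 3 → ℝ, eval y (lin l2) = 0 ∧ eval y (lin m1) ≠ 0 ∧ eval y (lin m2) ≠ 0 ∧
      eval y (lin m3) ≠ 0 := by
    have key : ∀ t : ℝ, t ≠ 0 → eval u1 (lin m3) + t * eval u2 (lin m3) ≠ 0 →
        ∃ y : Fin 3 → ℝ, eval y (lin l2) = 0 ∧ eval y (lin m1) ≠ 0 ∧ eval y (lin m2) ≠ 0 ∧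
      eval y (lin m3) ≠ 0 := by
      intro t ht h
      have lc : ∀ n : Fin 3 → ℝ, eval (fun i => u1 i + t * u2 i) (lin n) =
          eval u1 (lin n) + t * eval u2 (lin n) := by
        intro n; simp only [eval_lin]; ring
      refine ⟨fun i => u1 i + t * u2 i, ?_, ?_, ?_, ?_⟩
      · rw [lc, hu1, hu2]; simp
      · rw [lc, gu1, zero_add]; exact mul_ne_zero ht d12
      · rw [lc, gu2, mul_zero, add_zero]; exact d21
      · rw [lc]; exact h
    by_cases h1 : eval u1 (lin m3) + 1 * eval u2 (lin m3) = 0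
    · apply key 2 two_ne_zero
      intro h2
      apply d32; linarith
    · exact key 1 one_ne_zero h1
  obtain ⟨y, y0, y1, y2, y3⟩ := hy
  set M : Pol := lin m1 * lin m2 * lin m3 with hM
  have hMh : M.IsHomogeneous 3 := ((lin_hom m1).mul (lin_hom m2)).mul (lin_hom m3)
  have hMe : ∀ x, eval x M = eval x (lin m1) * eval x (lin m2) * eval x (lin m3) := by
    intro x; rw [hM, map_mul, map_mul]
  have hMy : eval y M ≠ 0 := by rw [hMe]; exact mul_ne_zero (mul_ne_zero y1 y2) y3
  set G : Pol := F - C (eval y F / eval y M) * M with hG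
  have hGh : G.IsHomogeneous (1 + 2) := by
    apply hF.sub
    simpa using (isHomogeneous_C (Fin 3) (eval y F / eval y M)).mul hMh
  have hGe : ∀ x, eval x G = eval x F - eval y F / eval y M * eval x M := by
    intro x; rw [hG, map_sub, map_mul, eval_C]
  have G0 : ∀ x, eval x F = 0 → eval x M = 0 → eval x G = 0 := by
    intro x h1 h2; rw [hGe, h1, h2]; simp
  have Gy : eval y G = 0 := by rw [hGe]; field_simp; ring
  have Mu1 : eval u1 M = 0 := by rw [hMe, gu1]; simp
  have Mu2 : eval u2 M = 0 := by rw [hMe, gu2]; simp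
  have Mu3 : eval u3 M = 0 := by rw [hMe, gu3]; simp
  have Mw1 : eval w1 M = 0 := by rw [hMe, gw1]; simp
  have Mw2 : eval w2 M = 0 := by rw [hMe, gw2]; simp
  have Mw3 : eval w3 M = 0 := by rw [hMe, gw3]; simp
  have Mz2 : eval z2 M = 0 := by rw [hMe, gz2]; simp
  have Mz3 : eval z3 M = 0 := by rw [hMe, gz3]; simp
  have MX : eval X M = 0 := by rw [hMe, gX]; simp
  have u1n : u1 ≠ 0 := vec_ne_zero d21
  have u2n : u2 ≠ 0 := vec_ne_zero d12
  have yn : y ≠ 0 := vec_ne_zero y1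
  have l2n := ne_zero_of_eval a1
  have l3n := ne_zero_of_eval c2
  have D1 : lin l2 ∣ G := by
    apply lin_dvd l2n hGh (k := 4) (by norm_num) ![u1, u2, u3, y]
    · intro i j hij
      fin_cases i <;> fin_cases j <;> simp at hij ⊢
      · exact crs_ne_of_sep u1n gu1 d12
      · rw [crs_symm]; exact crs_ne_of_sep hu3' gu3 d31
      · exact crs_ne_of_sep u1n gu1 y1
      · rw [crs_symm]; exact crs_ne_of_sep hu3' gu3 d32
      · exact crs_ne_of_sep u2n gu2 y2
      · exact crs_ne_of_sep hu3' gu3 y3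
    · intro i; fin_cases i <;> simp [u1n, u2n, hu3', yn]
    · intro i; fin_cases i <;> simp [*]
    · intro i; fin_cases i
      · exact G0 _ f4 Mu1
      · exact G0 _ f5 Mu2
      · exact G0 _ f6 Mu3
      · exact Gy
  obtain ⟨Q, hQ⟩ := D1
  have hQh : Q.IsHomogeneous (1+1) := hom_quot (lin_hom l2) (lin_ne_zero l2n) hGh hQ
  have Q0 : ∀ x, eval x G = 0 → eval x (lin l2) ≠ 0 → eval x Q = 0 := by
    intro x h1 h2
    rw [hQ, map_mul] at h1
    exact (mul_eq_zero.1 h1).resolve_left h2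
  have D2 : lin l3 ∣ Q := by
    apply lin_dvd l3n hQh (k := 3) (by norm_num) ![w1, w2, w3]
    · intro i j hij
      fin_cases i <;> fin_cases j <;> simp at hij ⊢
      · exact crs_ne_of_sep (vec_ne_zero a1) gw1 e12
      · exact crs_ne_of_sep (vec_ne_zero a1) gw1 e13
      · exact crs_ne_of_sep (vec_ne_zero a2) gw2 e23
    · intro i; fin_cases i
      · exact vec_ne_zero a1
      · exact vec_ne_zero a2
      · exact vec_ne_zero a3
    · intro i; fin_cases i <;> simp [*]
    · intro i; fin_cases i
      · exact Q0 _ (G0 _ f7 Mw1) a1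
      · exact Q0 _ (G0 _ f8 Mw2) a2
      · exact Q0 _ (G0 _ f9 Mw3) a3
  obtain ⟨N, hN⟩ := D2
  have hNh : N.IsHomogeneous 1 := hom_quot (lin_hom l3) (lin_ne_zero l3n) hQh hN
  obtain ⟨n, rfl⟩ := hom1_eq_lin hNh
  have N0 : ∀ x, eval x Q = 0 → eval x (lin l3) ≠ 0 → eval x (lin n) = 0 := by
    intro x h1 h2
    rw [hN, map_mul] at h1
    exact (mul_eq_zero.1 h1).resolve_left h2
  have n2 := N0 _ (Q0 _ (G0 _ f2 Mz2) b2) c2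
  have n3 := N0 _ (Q0 _ (G0 _ f3 Mz3) b3) c3
  have nX := lin_zero_of_col (crs_ne_of_sep (vec_ne_zero b2) gz2 k23) hl1 hz2 hz3 hX n2 n3
  have : eval X G = 0 := by rw [hQ, hN, map_mul, map_mul, nX]; simp
  rw [hGe, MX] at this
  simpa using this

/-- chart vector -/
def uu (p : ℝ × ℝ) : Fin 3 → ℝ := ![1, p.1, p.2]

/-- linear form of a dual vertex -/
def vf (v : ℝ × ℝ) : Fin 3 → ℝ := ![v.2, -v.1, -1]

lemma eval_vf (p v : ℝ × ℝ) : eval (uu p) (lin (vf v)) = ev p v := by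
  rw [eval_lin]; simp [uu, vf, ev]; ring

lemma uu_ne (p : ℝ × ℝ) : uu p ≠ 0 := by
  intro h; have := congrFun h 0; simp [uu] at this

lemma vf_ne (p : ℝ × ℝ) : vf p ≠ 0 := by
  intro h; have := congrFun h 2; simp [vf] at this

lemma crs_uu {p q : ℝ × ℝ} (h : p ≠ q) : crs (uu p) (uu q) ≠ 0 := by
  intro h0
  apply h
  simp [crs, uu] at h0
  have h1 := sq_nonneg (p.1 * q.2 - p.2 * q.1)
  have h2 := sq_nonneg (p.2 - q.2)
  have h3 := sq_nonneg (q.1 - p.1)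
  have e2 : (p.2 - q.2)^2 = 0 := by linarith
  have e3 : (q.1 - p.1)^2 = 0 := by linarith
  have e2 := pow_eq_zero_iff (two_ne_zero) |>.1 e2
  have e3 := pow_eq_zero_iff (two_ne_zero) |>.1 e3
  ext
  · linarith
  · linarith

/-- Bezout in the chart -/
lemma bez (S : Finset (ℝ × ℝ)) {f g : Pol} {d e : ℕ} (hf : Irreducible f) (hfd : f.IsHomogeneous d)
    (hge : g.IsHomogeneous e)
    (hfg : ¬ f ∣ g) (hSf : ∀ i ∈ S, eval (uu i) f = 0) (hSg : ∀ i ∈ S, eval (uu i) g = 0) :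
    S.card ≤ d * e :=
  bezout S uu (fun i _ j _ h => crs_uu h) (fun i _ => uu_ne i) hf hfd hge hfg hSf hSg

end FOL

set_option linter.unusedVariables false
namespace FOL

open Finset MvPolynomial

attribute [local instance] Classical.propDecidable

variable {L : Finset (ℝ × ℝ)}

def Zr (F : Pol) (p : ℝ × ℝ) : Prop := eval (uu p) F = 0

lemma Tri.off {v p q r s : ℝ × ℝ} (h : Tri L v p q r) (hs : s ∈ L) (h1 : s ≠ p) (h2 : s ≠ q)
    (h3 : s ≠ r) : ev s v ≠ 0 := by
  intro h0
  rcases (h.mem s).1 ⟨hs, h0⟩ with h | h | h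
  · exact h1 h
  · exact h2 h
  · exact h3 h

lemma chasles_tri {F : Pol} (hF : F.IsHomogeneous 3)
    {l1 l2 l3 m1 m2 m3 X z2 z3 u1 u2 u3 w1 w2 w3 : ℝ × ℝ}
    (r1 : Tri L l1 X z2 z3) (r2 : Tri L l2 u1 u2 u3) (r3 : Tri L l3 w1 w2 w3)
    (c1 : Tri L m1 X u1 w1) (c2 : Tri L m2 z2 u2 w2) (c3 : Tri L m3 z3 u3 w3)
    (hnd : [X, z2, z3, u1, u2, u3, w1, w2, w3].Nodup)
    (f2 : Zr F z2) (f3 : Zr F z3) (f4 : Zr F u1) (f5 : Zr F u2)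
    (f6 : Zr F u3) (f7 : Zr F w1) (f8 : Zr F w2) (f9 : Zr F w3) : Zr F X := by
  simp only [List.nodup_cons, List.mem_cons, not_or, List.not_mem_nil, not_false_eq_true] at hnd
  obtain ⟨⟨x1, x2, x3, x4, x5, x6, x7, x8, -⟩, ⟨y1, y2, y3, y4, y5, y6, y7, -⟩,
    ⟨z1, z4, z5, z6, z7, z8, -⟩, ⟨p1, p2, p3, p4, p5, -⟩, ⟨q1, q2, q3, q4, -⟩, ⟨s1, s2, s3, -⟩, -, -, -⟩ := hnd
  unfold Zr at *
  refine chasles hF (l1 := vf l1) (l2 := vf l2) (l3 := vf l3) (m1 := vf m1) (m2 := vf m2) (m3 := vf m3)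
    (z2 := uu z2) (z3 := uu z3) (u1 := uu u1) (u2 := uu u2) (u3 := uu u3) (w1 := uu w1) (w2 := uu w2)
    (w3 := uu w3) ?_ ?_ ?_ (vf_ne _)
    ?_ ?_ ?_ ?_ ?_ ?_ ?_ ?_ ?_ ?_ ?_ ?_ ?_ ?_ ?_ ?_ ?_ ?_ ?_ ?_ ?_ ?_ ?_ ?_ ?_ ?_ ?_ ?_ ?_ ?_ (uu_ne _)
    f2 f3 f4 f5 f6 f7 f8 f9 <;> rw [eval_vf]
  · exact r1.m1.2
  · exact r1.m2.2
  · exact r1.m3.2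
  · exact r2.m1.2
  · exact r2.m2.2
  · exact r2.m3.2
  · exact r3.m1.2
  · exact r3.m2.2
  · exact r3.m3.2
  · exact c1.m1.2
  · exact c1.m2.2
  · exact c1.m3.2
  · exact c2.m1.2
  · exact c2.m2.2
  · exact c2.m3.2
  · exact c3.m1.2
  · exact c3.m2.2
  · exact c3.m3.2
  · exact r2.off r3.m1.1 (Ne.symm p3) (Ne.symm q2) (Ne.symm s1)
  · exact r2.off r3.m2.1 (Ne.symm p4) (Ne.symm q3) (Ne.symm s2)
  · exact r2.off r3.m3.1 (Ne.symm p5) (Ne.symm q4) (Ne.symm s3)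
  · exact r2.off r1.m2.1 y2 y3 y4
  · exact r2.off r1.m3.1 z1 z4 z5
  · exact r3.off r1.m2.1 y5 y6 y7
  · exact r3.off r1.m3.1 z6 z7 z8
  · exact c1.off r2.m2.1 (Ne.symm x4) (Ne.symm p1) q2
  · exact c2.off r2.m1.1 (Ne.symm y2) p1 p4
  · exact c3.off r2.m1.1 (Ne.symm z1) p2 p5
  · exact c3.off r2.m2.1 (Ne.symm z4) q1 q4
  · exact c1.off r3.m2.1 (Ne.symm x7) (Ne.symm p4) r3.pq.symm
  · exact c1.off r3.m3.1 (Ne.symm x8) (Ne.symm p5) r3.pr.symm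
  · exact c2.off r3.m3.1 (Ne.symm y7) (Ne.symm q4) r3.qr.symm
  · exact c2.off r1.m3.1 (Ne.symm y1) z4 z7

/-- two shared points determine the line -/
lemma Tri.same {v w p q r q' : ℝ × ℝ} {r' : ℝ × ℝ} (h : Tri L v p q r) (h' : Tri L w p q r') : r = r' := by
  have hvw : v = w := by
    exact pt_eq h.m1.2 h.m2.2 h'.m1.2 h'.m2.2 h.pq
  subst hvw
  rcases (h'.mem r).1 h.m3 with e | e | e
  · exact absurd e.symm h.pr
  · exact absurd e.symm h.qr
  · exact e

/-- distinctness bookkeeping for grids -/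
structure GD (p : ℝ × ℝ) (N : ℕ) (a b : ℕ → ℝ × ℝ) (c d e : ℝ × ℝ) : Prop where
  aa : ∀ i j, i ≤ N → j ≤ N → i ≠ j → a i ≠ a j
  bb : ∀ i j, i ≤ N → j ≤ N → i ≠ j → b i ≠ b j
  ab : ∀ i j, i ≤ N → j ≤ N → a i ≠ b j
  ap : ∀ i, i ≤ N → a i ≠ p
  bp : ∀ i, i ≤ N → b i ≠ p
  ac : ∀ i, i ≤ N → a i ≠ c
  bc : ∀ i, i ≤ N → b i ≠ c
  ad : ∀ i, i ≤ N → a i ≠ d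
  bd : ∀ i, i ≤ N → b i ≠ d
  ae : ∀ i, i ≤ N → a i ≠ e
  be : ∀ i, i ≤ N → b i ≠ e
  pc : p ≠ c
  pd : p ≠ d
  pe : p ≠ e
  cd : c ≠ d
  ce : c ≠ e
  de : d ≠ e

lemma grid_gd {p : ℝ × ℝ} {N : ℕ} {V a b : ℕ → ℝ × ℝ} {c d e : ℝ × ℝ} (h : Grid L p N V a b c d e)
    (hN : 3 ≤ N) (hV : ∀ i j, i < j → j ≤ N → V i ≠ V j) : GD p N a b c d e := by
  have hV' : ∀ i j, i ≤ N → j ≤ N → i ≠ j → V i ≠ V j := by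
    intro i j hi hj hij
    rcases lt_or_gt_of_ne hij with h | h
    · exact hV i j h hj
    · exact (hV j i h hi).symm
  have ap : ∀ i, i ≤ N → a i ≠ p := fun i hi => (h.t0 i hi).pq.symm
  have bp : ∀ i, i ≤ N → b i ≠ p := fun i hi => (h.t0 i hi).pr.symm
  have aa : ∀ i j, i ≤ N → j ≤ N → i ≠ j → a i ≠ a j := by
    intro i j hi hj hij he
    refine hV' i j hi hj hij (pt_eq (h.t0 i hi).m1.2 (h.t0 i hi).m2.2 (h.t0 j hj).m1.2 ?_ (ap i hi).symm)
    rw [he]; exact (h.t0 j hj).m2.2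
  have bb : ∀ i j, i ≤ N → j ≤ N → i ≠ j → b i ≠ b j := by
    intro i j hi hj hij he
    refine hV' i j hi hj hij (pt_eq (h.t0 i hi).m1.2 (h.t0 i hi).m3.2 (h.t0 j hj).m1.2 ?_ (bp i hi).symm)
    rw [he]; exact (h.t0 j hj).m3.2
  have ab : ∀ i j, i ≤ N → j ≤ N → a i ≠ b j := by
    intro i j hi hj he
    by_cases hij : i = j
    · subst hij; exact (h.t0 i hi).qr he
    refine hV' i j hi hj hij (pt_eq (h.t0 i hi).m1.2 (h.t0 i hi).m2.2 (h.t0 j hj).m1.2 ?_ (ap i hi).symm)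
    rw [he]; exact (h.t0 j hj).m3.2
  -- uniform statements
  have t1' : ∀ i j, j = i + 1 → j ≤ N → ∃ W, Tri L W c (a i) (b j) := by
    rintro i j rfl hj; exact h.t1 i (by omega)
  have t2' : ∀ i j, j = i + 2 → j ≤ N → ∃ W, Tri L W d (a i) (b j) := by
    rintro i j rfl hj; exact h.t2 i (by omega)
  have tm' : ∀ i j, i = j + 1 → i ≤ N → ∃ W, Tri L W e (a i) (b j) := by
    rintro i j rfl hj; exact h.tm j (by omega)
  -- a r-point is not an a_j having line with b_j
  have keyA : ∀ r i j, i ≤ N → j ≤ N → (∃ W, Tri L W r (a i) (b j)) → r = a j → False := by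
    rintro r i j hi hj ⟨W, hW⟩ hr
    subst hr
    have h1 : Tri L W (a j) (b j) (a i) := hW.swap
    have h2 : Tri L (V j) (a j) (b j) p := (h.t0 j hj).rot
    exact ap i hi (h1.same (q' := p) h2)
  have keyB : ∀ r i j, i ≤ N → j ≤ N → (∃ W, Tri L W r (a i) (b j)) → r = b i → False := by
    rintro r i j hi hj ⟨W, hW⟩ hr
    subst hr
    have h2 : Tri L (V i) (b i) (a i) p := (h.t0 i hi).rot.rot.swap
    exact bp j hj (hW.same (q' := p) h2)
  have keyR : ∀ r i j j', i ≤ N → j ≤ N → j' ≤ N → j ≠ j' → (∃ W, Tri L W r (a i) (b j)) →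
      (∃ W, Tri L W r (a i) (b j')) → False := by
    rintro r i j j' hi hj hj' hne ⟨W, hW⟩ ⟨W', hW'⟩
    exact bb j j' hj hj' hne (hW.same (q' := p) hW')
  have t0' : ∀ i, i ≤ N → ∃ W, Tri L W p (a i) (b i) := fun i hi => ⟨_, h.t0 i hi⟩
  refine ⟨aa, bb, ab, ap, bp, ?_, ?_, ?_, ?_, ?_, ?_, ?_, ?_, ?_, ?_, ?_, ?_⟩
  · intro i hi he
    by_cases h1 : i < N
    · obtain ⟨W, hW⟩ := t1' i (i+1) rfl (by omega)
      exact hW.pq he.symm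
    · exact keyA c (i-1) i (by omega) hi (t1' _ _ (by omega) hi) he.symm
  · intro i hi he
    by_cases h1 : 1 ≤ i
    · obtain ⟨W, hW⟩ := t1' (i-1) i (by omega) (by omega)
      exact hW.pr he.symm
    · exact keyB c i (i+1) (by omega) (by omega) (t1' _ _ (by omega) (by omega)) he.symm
  · intro i hi he
    by_cases h1 : i + 2 ≤ N
    · obtain ⟨W, hW⟩ := t2' i (i+2) rfl (by omega)
      exact hW.pq he.symm
    · exact keyA d (i-2) i (by omega) hi (t2' _ _ (by omega) hi) he.symm
  · intro i hi he
    by_cases h1 : 2 ≤ i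
    · obtain ⟨W, hW⟩ := t2' (i-2) i (by omega) (by omega)
      exact hW.pr he.symm
    · exact keyB d i (i+2) (by omega) (by omega) (t2' _ _ (by omega) (by omega)) he.symm
  · intro i hi he
    by_cases h1 : 1 ≤ i
    · obtain ⟨W, hW⟩ := tm' i (i-1) (by omega) (by omega)
      exact hW.pq he.symm
    · exact keyA e (i+1) i (by omega) hi (tm' _ _ (by omega) (by omega)) he.symm
  · intro i hi he
    by_cases h1 : i < N
    · obtain ⟨W, hW⟩ := tm' (i+1) i (by omega) (by omega)
      exact hW.pr he.symm
    · exact keyB e i (i-1) (by omega) (by omega) (tm' _ _ (by omega) (by omega)) he.symm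
  · intro he
    exact keyR p 0 0 1 (by omega) (by omega) (by omega) (by omega) (t0' 0 (by omega)) (he ▸ t1' 0 1 rfl (by omega))
  · intro he
    exact keyR p 0 0 2 (by omega) (by omega) (by omega) (by omega) (t0' 0 (by omega)) (he ▸ t2' 0 2 rfl (by omega))
  · intro he
    exact keyR p 1 1 0 (by omega) (by omega) (by omega) (by omega) (t0' 1 (by omega)) (he ▸ tm' 1 0 rfl (by omega))
  · intro he
    exact keyR c 0 1 2 (by omega) (by omega) (by omega) (by omega) (t1' 0 1 rfl (by omega)) (he ▸ t2' 0 2 rfl (by omega))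
  · intro he
    exact keyR c 1 2 0 (by omega) (by omega) (by omega) (by omega) (t1' 1 2 rfl (by omega)) (he ▸ tm' 1 0 rfl (by omega))
  · intro he
    exact keyR d 1 3 0 (by omega) (by omega) (by omega) (by omega) (t2' 1 3 rfl (by omega)) (he ▸ tm' 1 0 rfl (by omega))

/-- the hexagon configuration -/
structure Hex (L : Finset (ℝ × ℝ)) (A0 A1 A2 B0 B1 B2 R0 R1 R2 : ℝ × ℝ) : Prop where
  r1 : ∃ W, Tri L W R1 A0 B0
  r2 : ∃ W, Tri L W R2 A1 B2
  r3 : ∃ W, Tri L W R0 A2 B1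
  c1 : ∃ W, Tri L W R2 A0 B1
  c2 : ∃ W, Tri L W R0 A1 B0
  c3 : ∃ W, Tri L W R1 A2 B2
  nd : [A0, A1, A2, B0, B1, B2, R0, R1, R2].Nodup

lemma Hex.B2z {F : Pol} (hF : F.IsHomogeneous 3) {A0 A1 A2 B0 B1 B2 R0 R1 R2 : ℝ × ℝ}
    (h : Hex L A0 A1 A2 B0 B1 B2 R0 R1 R2) (hA0 : Zr F A0) (hA1 : Zr F A1) (hA2 : Zr F A2)
    (hB0 : Zr F B0) (hB1 : Zr F B1) (h0 : Zr F R0) (h1 : Zr F R1) (h2 : Zr F R2) : Zr F B2 := by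
  obtain ⟨⟨_, r1⟩, ⟨_, r2⟩, ⟨_, r3⟩, ⟨_, c1⟩, ⟨_, c2⟩, ⟨_, c3⟩, nd⟩ := h
  refine chasles_tri hF (X := B2) (z2 := A1) (z3 := R2) (u1 := R1) (u2 := B0) (u3 := A0) (w1 := A2)
    (w2 := R0) (w3 := B1) r2.rot.rot.swap r1.swap r3.rot.swap c3.rot.rot c2.rot c1
    ?_ hA1 h2 h1 hB0 hA0 hA2 h0 hB1
  simp only [List.nodup_cons, List.mem_cons, not_or, not_false_eq_true,
    List.nodup_nil, and_true, List.mem_nil_iff] at nd ⊢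
  clear r1 r2 r3 c1 c2 c3
  grind

lemma Hex.A2z {F : Pol} (hF : F.IsHomogeneous 3) {A0 A1 A2 B0 B1 B2 R0 R1 R2 : ℝ × ℝ}
    (h : Hex L A0 A1 A2 B0 B1 B2 R0 R1 R2) (hA0 : Zr F A0) (hA1 : Zr F A1) (hB2 : Zr F B2)
    (hB0 : Zr F B0) (hB1 : Zr F B1) (h0 : Zr F R0) (h1 : Zr F R1) (h2 : Zr F R2) : Zr F A2 := by
  obtain ⟨⟨_, r1⟩, ⟨_, r2⟩, ⟨_, r3⟩, ⟨_, c1⟩, ⟨_, c2⟩, ⟨_, c3⟩, nd⟩ := h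
  refine chasles_tri hF (X := A2) (z2 := B1) (z3 := R0) (u1 := R1) (u2 := A0) (u3 := B0) (w1 := B2)
    (w2 := R2) (w3 := A1) r3.rot r1 r2.rot.rot c3.rot.swap c1.rot.rot.swap c2.swap
    ?_ hB1 h0 h1 hA0 hB0 hB2 h2 hA1
  simp only [List.nodup_cons, List.mem_cons, not_or, not_false_eq_true,
    List.nodup_nil, and_true, List.mem_nil_iff] at nd ⊢
  clear r1 r2 r3 c1 c2 c3
  grind

lemma Hex.B0z {F : Pol} (hF : F.IsHomogeneous 3) {A0 A1 A2 B0 B1 B2 R0 R1 R2 : ℝ × ℝ}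
    (h : Hex L A0 A1 A2 B0 B1 B2 R0 R1 R2) (hA0 : Zr F A0) (hA1 : Zr F A1) (hA2 : Zr F A2)
    (hB2 : Zr F B2) (hB1 : Zr F B1) (h0 : Zr F R0) (h1 : Zr F R1) (h2 : Zr F R2) : Zr F B0 := by
  obtain ⟨⟨_, r1⟩, ⟨_, r2⟩, ⟨_, r3⟩, ⟨_, c1⟩, ⟨_, c2⟩, ⟨_, c3⟩, nd⟩ := h
  refine chasles_tri hF (X := B0) (z2 := A0) (z3 := R1) (u1 := A1) (u2 := R2) (u3 := B2) (w1 := R0)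
    (w2 := B1) (w3 := A2) r1.rot.rot.swap r2.rot.swap r3.swap c2.rot.rot.swap c1.rot.swap c3.swap
    ?_ hA0 h1 hA1 h2 hB2 h0 hB1 hA2
  simp only [List.nodup_cons, List.mem_cons, not_or, not_false_eq_true,
    List.nodup_nil, and_true, List.mem_nil_iff] at nd ⊢
  clear r1 r2 r3 c1 c2 c3
  grind

lemma grid_hexA {p : ℝ × ℝ} {N : ℕ} {V a b : ℕ → ℝ × ℝ} {c d e : ℝ × ℝ} (h : Grid L p N V a b c d e)
    (g : GD p N a b c d e) (i : ℕ) (hi : i + 2 ≤ N) :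
    Hex L (a i) (a (i+1)) (a (i+2)) (b i) (b (i+1)) (b (i+2)) e p c := by
  refine ⟨⟨_, h.t0 i (by omega)⟩, h.t1 (i+1) (by omega), h.tm (i+1) (by omega), h.t1 i (by omega),
    h.tm i (by omega), ⟨_, h.t0 (i+2) (by omega)⟩, ?_⟩
  have := g.aa; have := g.bb; have := g.ab; have := g.ap; have := g.bp; have := g.ac; have := g.bc
  have := g.ae; have := g.be; have := g.pc; have := g.pe; have := g.ce
  simp only [List.nodup_cons, List.mem_cons, not_or, not_false_eq_true,
    List.nodup_nil, and_true, List.mem_nil_iff]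
  clear h
  grind

lemma grid_hexB {p : ℝ × ℝ} {N : ℕ} {V a b : ℕ → ℝ × ℝ} {c d e : ℝ × ℝ} (h : Grid L p N V a b c d e)
    (g : GD p N a b c d e) (i : ℕ) (hi : i + 3 ≤ N) :
    Hex L (a i) (a (i+1)) (a (i+2)) (b (i+1)) (b (i+2)) (b (i+3)) p c d := by
  refine ⟨h.t1 i (by omega), h.t2 (i+1) (by omega), ⟨_, h.t0 (i+2) (by omega)⟩, h.t2 i (by omega),
    ⟨_, h.t0 (i+1) (by omega)⟩, h.t1 (i+2) (by omega), ?_⟩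
  have := g.aa; have := g.bb; have := g.ab; have := g.ap; have := g.bp; have := g.ac; have := g.bc
  have := g.ad; have := g.bd; have := g.pc; have := g.pd; have := g.cd
  simp only [List.nodup_cons, List.mem_cons, not_or, not_false_eq_true,
    List.nodup_nil, and_true, List.mem_nil_iff]
  clear h
  grind

theorem grid_cubic {p : ℝ × ℝ} {N : ℕ} {V a b : ℕ → ℝ × ℝ} {c d e : ℝ × ℝ} (h : Grid L p N V a b c d e)
    (hN : 3 ≤ N) (hV : ∀ i j, i < j → j ≤ N → V i ≠ V j) :
    ∃ F : Pol, F ≠ 0 ∧ F.IsHomogeneous 3 ∧ Zr F p ∧ Zr F c ∧ Zr F d ∧ Zr F e ∧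
      ∀ i ≤ N, Zr F (a i) ∧ Zr F (b i) := by
  have g := grid_gd h hN hV
  obtain ⟨F, F0, hF, hz⟩ := cubic_through ![uu p, uu c, uu d, uu e, uu (a 0), uu (a 1), uu (a 2), uu (b 1), uu (b 2)]
  have zp : Zr F p := hz 0
  have zc : Zr F c := hz 1
  have zd : Zr F d := hz 2
  have ze : Zr F e := hz 3
  have za0 : Zr F (a 0) := hz 4
  have za1 : Zr F (a 1) := hz 5
  have za2 : Zr F (a 2) := hz 6
  have zb1 : Zr F (b 1) := hz 7
  have zb2 : Zr F (b 2) := hz 8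
  have zb0 : Zr F (b 0) := (grid_hexA h g 0 (by omega)).B0z hF za0 za1 za2 zb2 zb1 ze zp zc
  refine ⟨F, F0, hF, zp, zc, zd, ze, ?_⟩
  have key : ∀ m, m + 2 ≤ N → ∀ i ≤ m + 2, Zr F (a i) ∧ Zr F (b i) := by
    intro m
    induction m with
    | zero =>
      intro _ i hi
      have : i = 0 ∨ i = 1 ∨ i = 2 := by omega
      rcases this with rfl | rfl | rfl
      · exact ⟨za0, zb0⟩
      · exact ⟨za1, zb1⟩
      · exact ⟨za2, zb2⟩
    | succ m ih =>
      intro hm i hi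
      have ih := ih (by omega)
      by_cases h1 : i ≤ m + 2
      · exact ih i h1
      have : i = m + 3 := by omega
      subst this
      have hb : Zr F (b (m+3)) := (grid_hexB h g m (by omega)).B2z hF (ih m (by omega)).1 (ih (m+1) (by omega)).1
        (ih (m+2) (by omega)).1 (ih (m+1) (by omega)).2 (ih (m+2) (by omega)).2 zp zc zd
      have ha : Zr F (a (m+1+2)) := (grid_hexA h g (m+1) (by omega)).A2z hF (ih (m+1) (by omega)).1
        (ih (m+2) (by omega)).1 hb (ih (m+1) (by omega)).2 (ih (m+2) (by omega)).2 ze zp zc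
      exact ⟨ha, hb⟩
  intro i hi
  exact key (N-2) (by omega) i (by omega)

end FOL

set_option linter.unusedVariables false
namespace FOL

open Finset MvPolynomial

attribute [local instance] Classical.propDecidable

variable {L : Finset (ℝ × ℝ)}

/-- points of L on a curve -/
noncomputable def on (L : Finset (ℝ × ℝ)) (G : Pol) : Finset (ℝ × ℝ) := L.filter (fun q => Zr G q)

lemma mem_on {G : Pol} {q : ℝ × ℝ} : q ∈ on L G ↔ q ∈ L ∧ Zr G q := by simp [on]

lemma sum_BadOn (k : ℕ) (hk : 1 ≤ k) (hL : Gen L) (hN : N2 L ≤ k * L.card) :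
    ∑ p ∈ L, (BadOn L p).card ≤ 1180 * k * L.card := by
  have h := card_Bad hL k hk hN
  have : (Flg L (Bad L)).card = ∑ p ∈ L, (BadOn L p).card := by
    rw [card_Flg]
    simp only [thr, BadOn, Finset.card_filter]
    rw [Finset.sum_comm]
  rw [← this]; linarith

/-- packaged decomposition seen from a point `p` -/
structure Dec (L : Finset (ℝ × ℝ)) (p : ℝ × ℝ) (T : ℕ) where
  E : Finset (ℝ × ℝ)
  act : Finset ℕ
  N : ℕ → ℕ
  V : ℕ → ℕ → ℝ × ℝ
  a : ℕ → ℕ → ℝ × ℝ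
  b : ℕ → ℕ → ℝ × ℝ
  F : ℕ → Pol
  hE : E.card ≤ 6 * (T + 1)
  hEp : ∀ v ∈ E, ev p v = 0
  hact : act.card ≤ T + 1
  tri : ∀ r ∈ act, ∀ i ≤ N r, Tri L (V r i) p (a r i) (b r i)
  F0 : ∀ r ∈ act, F r ≠ 0
  Fh : ∀ r ∈ act, (F r).IsHomogeneous 3
  Fp : ∀ r ∈ act, Zr (F r) p
  Fa : ∀ r ∈ act, ∀ i ≤ N r, Zr (F r) (a r i)
  Fb : ∀ r ∈ act, ∀ i ≤ N r, Zr (F r) (b r i)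
  cov : ∀ v ∈ Vx L, ev p v = 0 → v ∈ E ∨ ∃ r ∈ act, ∃ i ≤ N r, v = V r i

theorem dec (hL : Gen L) {p : ℝ × ℝ} (hp : p ∈ L) {T : ℕ} (hT : (BadOn L p).card ≤ T) :
    Nonempty (Dec L p T) := by
  obtain ⟨E, act, N, V, a, b, c, d, e, h1, h2, h3, h4, h5, h6⟩ := runs hL hp hT
  have hF : ∀ r, ∃ F : Pol, r ∈ act → (F ≠ 0 ∧ F.IsHomogeneous 3 ∧ Zr F p ∧ Zr F (c r) ∧ Zr F (d r) ∧
      Zr F (e r) ∧ ∀ i ≤ N r, Zr F (a r i) ∧ Zr F (b r i)) := by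
    intro r
    by_cases hr : r ∈ act
    · obtain ⟨F, hF⟩ := grid_cubic (h3 r hr).2 (h3 r hr).1 (by
        intro i j hij hj he
        have := h4 r hr i j hij hj
        rw [he] at this; exact lt_irrefl _ this)
      exact ⟨F, fun _ => hF⟩
    · exact ⟨0, fun h => absurd h hr⟩
  choose F hF using hF
  exact ⟨{ E := E.filter (fun v => ev p v = 0), act := act, N := N, V := V, a := a, b := b, F := F
           hE := (Finset.card_filter_le _ _).trans h1
           hEp := fun v hv => (Finset.mem_filter.1 hv).2
           hact := h2
           tri := fun r hr i hi => (h3 r hr).2.t0 i hi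
           F0 := fun r hr => (hF r hr).1
           Fh := fun r hr => (hF r hr).2.1
           Fp := fun r hr => (hF r hr).2.2.1
           Fa := fun r hr i hi => ((hF r hr).2.2.2.2.2.2 i hi).1
           Fb := fun r hr i hi => ((hF r hr).2.2.2.2.2.2 i hi).2
           cov := by
             intro v hv hpv
             rcases h6 v hv hpv with h | h
             · exact Or.inl (Finset.mem_filter.2 ⟨h, hpv⟩)
             · exact Or.inr h }⟩

lemma inter_mem (hL : Gen L) {p q : ℝ × ℝ} (hp : p ∈ L) (hq : q ∈ L) (h : p ≠ q) :
    inter p q ∈ Vx L ∧ ev p (inter p q) = 0 ∧ ev q (inter p q) = 0 := by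
  have hx : p.1 ≠ q.1 := fun hx => h (hL.inj _ hp _ hq hx)
  have h1 := ev_inter_left p q
  have h2 := ev_inter_right hx
  exact ⟨(mem_Vx hL).2 ⟨p, hp, q, hq, h, h1, h2⟩, h1, h2⟩

/-- every other point is on an exceptional line or on a run -/
lemma Dec.loc (hL : Gen L) {p : ℝ × ℝ} {T : ℕ} (D : Dec L p T) (hp : p ∈ L) {q : ℝ × ℝ} (hq : q ∈ L)
    (hpq : q ≠ p) : (∃ v ∈ D.E, ev q v = 0) ∨
      ∃ r ∈ D.act, ∃ i ≤ D.N r, q = D.a r i ∨ q = D.b r i := by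
  obtain ⟨h1, h2, h3⟩ := inter_mem hL hp hq hpq.symm
  rcases D.cov _ h1 h2 with h | ⟨r, hr, i, hi, h⟩
  · exact Or.inl ⟨_, h, h3⟩
  · right
    refine ⟨r, hr, i, hi, ?_⟩
    rw [h] at h3
    rcases ((D.tri r hr i hi).mem q).1 ⟨hq, h3⟩ with h | h
    · exact absurd h hpq
    · exact h

lemma Dec.loc' (hL : Gen L) {p : ℝ × ℝ} {T : ℕ} (D : Dec L p T) (hp : p ∈ L) {q : ℝ × ℝ} (hq : q ∈ L)
    (hpq : q ≠ p) : (∃ v ∈ D.E, ev q v = 0) ∨ ∃ r ∈ D.act, Zr (D.F r) q := by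
  rcases D.loc hL hp hq hpq with h | ⟨r, hr, i, hi, h⟩
  · exact Or.inl h
  · right
    refine ⟨r, hr, ?_⟩
    rcases h with h | h
    · rw [h]; exact D.Fa r hr i hi
    · rw [h]; exact D.Fb r hr i hi

/-- lines do not divide irreducible curves of degree at least 2 -/
lemma vf_not_dvd {G : Pol} {δ : ℕ} (hG : Irreducible G) (hGd : G.IsHomogeneous δ) (hδ : 2 ≤ δ)
    {n : Fin 3 → ℝ} (hn : n ≠ 0) : ¬ lin n ∣ G := by
  intro h
  have hl := irr_of_hom1 (lin_hom n) (lin_ne_zero hn)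
  obtain ⟨c, hc⟩ := h
  rcases hG.isUnit_or_isUnit hc with h | h
  · exact hl.not_isUnit h
  · obtain ⟨i, j, hij, h1, h2⟩ := hom_factor hGd hG.ne_zero hc
    have e1 := h1.inj_right (lin_hom n) hl.ne_zero
    have : ¬ (1 ≤ j) := fun hj => not_unit_of_hom h2 hj h
    omega

lemma line_count {G : Pol} {δ : ℕ} (hG : Irreducible G) (hGd : G.IsHomogeneous δ) (hδ : 2 ≤ δ)
    {n : Fin 3 → ℝ} (hn : n ≠ 0) (S : Finset (ℝ × ℝ)) (h1 : ∀ q ∈ S, Zr G q) (h2 : ∀ q ∈ S, Zr (lin n) q) :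
    S.card ≤ δ := by
  have := bez S (irr_of_hom1 (lin_hom n) (lin_ne_zero hn)) (lin_hom n) hGd (vf_not_dvd hG hGd hδ hn) h2 h1
  simpa using this

lemma Zr_vf {q v : ℝ × ℝ} : Zr (lin (vf v)) q ↔ ev q v = 0 := by
  unfold Zr; rw [eval_vf]

lemma dvd_zr {F G : Pol} (h : G ∣ F) {q : ℝ × ℝ} (hq : Zr G q) : Zr F q := by
  obtain ⟨c, rfl⟩ := h
  unfold Zr at *; rw [map_mul, hq, zero_mul]

lemma cubic_dvd {F G : Pol} (hF0 : F ≠ 0) (hF : F.IsHomogeneous 3) (hG0 : G ≠ 0) (hG : G.IsHomogeneous 3) (h : G ∣ F)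
    {q : ℝ × ℝ} (hq : Zr F q) : Zr G q := by
  obtain ⟨c, hc⟩ := h
  have h0 : c ≠ 0 := by rintro rfl; exact hF0 (by rw [hc, mul_zero])
  have := hom_quot (e := 0) hG hG0 hF hc
  have hu := (unit_of_hom0 this h0).map (eval (uu q))
  unfold Zr at *
  rw [hc, map_mul] at hq
  exact (mul_eq_zero.1 hq).resolve_right hu.ne_zero

/-- the cubic case, one point -/
lemma cubic_one (hL : Gen L) {G : Pol} (hG : Irreducible G) (hGd : G.IsHomogeneous 3) {p : ℝ × ℝ} (hp : p ∈ L)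
    (hpG : ¬ Zr G p) : (on L G).card ≤ 27 * ((BadOn L p).card + 1) := by
  obtain ⟨D⟩ := dec hL hp (le_refl (BadOn L p).card)
  set T := (BadOn L p).card
  have hsub : on L G ⊆ (D.E.biUnion fun v => (on L G).filter (fun q => ev q v = 0)) ∪
      (D.act.biUnion fun r => (on L G).filter (fun q => Zr (D.F r) q)) := by
    intro q hq
    have hq' := mem_on.1 hq
    have hne : q ≠ p := by rintro rfl; exact hpG hq'.2
    rw [Finset.mem_union, Finset.mem_biUnion, Finset.mem_biUnion]
    rcases D.loc' hL hp hq'.1 hne with ⟨v, hv, h⟩ | ⟨r, hr, h⟩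
    · exact Or.inl ⟨v, hv, Finset.mem_filter.2 ⟨hq, h⟩⟩
    · exact Or.inr ⟨r, hr, Finset.mem_filter.2 ⟨hq, h⟩⟩
  have h1 : (D.E.biUnion fun v => (on L G).filter (fun q => ev q v = 0)).card ≤ D.E.card * 3 := by
    apply Finset.card_biUnion_le_card_mul
    intro v hv
    apply line_count hG hGd (by norm_num) (vf_ne v)
    · intro q hq; exact (mem_on.1 (Finset.mem_filter.1 hq).1).2
    · intro q hq; rw [Zr_vf]; exact (Finset.mem_filter.1 hq).2
  have h2 : (D.act.biUnion fun r => (on L G).filter (fun q => Zr (D.F r) q)).card ≤ D.act.card * 9 := by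
    apply Finset.card_biUnion_le_card_mul
    intro r hr
    apply bez _ hG hGd (D.Fh r hr)
    · intro hd
      exact hpG (cubic_dvd (D.F0 r hr) (D.Fh r hr) hG.ne_zero hGd hd (D.Fp r hr))
    · intro q hq; exact (mem_on.1 (Finset.mem_filter.1 hq).1).2
    · intro q hq; exact (Finset.mem_filter.1 hq).2
  have h3 := Finset.card_le_card hsub
  have h4 := Finset.card_union_le (D.E.biUnion fun v => (on L G).filter (fun q => ev q v = 0))
      (D.act.biUnion fun r => (on L G).filter (fun q => Zr (D.F r) q))
  have h5 := D.hE
  have h6 := D.hact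
  omega

/-- points of L off a curve -/
noncomputable def off (L : Finset (ℝ × ℝ)) (G : Pol) : Finset (ℝ × ℝ) := L.filter (fun q => ¬ Zr G q)

lemma on_off (G : Pol) : (on L G).card + (off L G).card = L.card :=
  Finset.card_filter_add_card_filter_not _

theorem cubic_case (k : ℕ) (hk : 1 ≤ k) (hL : Gen L) (hN : N2 L ≤ k * L.card) {G : Pol}
    (hG : Irreducible G) (hGd : G.IsHomogeneous 3) (hm : 54 * (1180 * k) + 54 ≤ (on L G).card) :
    (off L G).card ≤ 54 * (1180 * k) := by
  have hs := sum_BadOn k hk hL hN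
  set B := 1180 * k
  have h1 : ∑ p ∈ off L G, (on L G).card ≤ ∑ p ∈ off L G, 27 * ((BadOn L p).card + 1) := by
    apply Finset.sum_le_sum
    intro p hp
    have := Finset.mem_filter.1 hp
    exact cubic_one hL hG hGd this.1 this.2
  rw [Finset.sum_const, smul_eq_mul, ← Finset.mul_sum, Finset.sum_add_distrib, Finset.sum_const, smul_eq_mul, mul_one] at h1
  have h2 : ∑ p ∈ off L G, (BadOn L p).card ≤ ∑ p ∈ L, (BadOn L p).card :=
    Finset.sum_le_sum_of_subset (Finset.filter_subset _ _)
  have h3 := on_off (L := L) G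
  set x := (off L G).card
  set m := (on L G).card
  rw [← h3] at hs
  by_contra hc
  push Not at hc
  have h4 : x * m ≤ 27 * (B * (m + x) + x) := by
    refine h1.trans (Nat.mul_le_mul_left _ ?_)
    omega
  zify at *
  nlinarith [mul_nonneg (sub_nonneg.2 hm) (sub_nonneg.2 hc.le)]

end FOL

set_option linter.unusedVariables false
namespace FOL

open Finset MvPolynomial

attribute [local instance] Classical.propDecidable

variable {L : Finset (ℝ × ℝ)}

/-- extremal points of `G` on the lines of `M` with respect to `1 / ev · o` -/
noncomputable def Ex (o : ℝ × ℝ) (M G : Finset (ℝ × ℝ)) : Finset (ℝ × ℝ) :=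
  M.biUnion fun v => (G.filter fun x => ev x v = 0 ∧ ∀ y ∈ G, ev y v = 0 → 1 / ev y o ≤ 1 / ev x o) ∪
    (G.filter fun x => ev x v = 0 ∧ ∀ y ∈ G, ev y v = 0 → 1 / ev x o ≤ 1 / ev y o)

lemma H_inj {o v x y : ℝ × ℝ} (hov : o.1 ≠ v.1) (hx : ev x v = 0) (hy : ev y v = 0)
    (h : 1 / ev x o = 1 / ev y o) : x = y := by
  have h1 : ev x o = ev y o := by
    have := congrArg (fun z => 1 / z) h
    simpa using this
  simp only [ev] at *
  have hd : o.1 - v.1 ≠ 0 := sub_ne_zero.2 hov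
  have e1 : (x.1 - y.1) * (o.1 - v.1) = 0 := by linarith
  have e2 : x.1 = y.1 := by
    rcases mul_eq_zero.1 e1 with h | h
    · linarith
    · exact absurd h hd
  ext
  · exact e2
  · rw [e2] at hx; linarith

lemma Ex_sub {o : ℝ × ℝ} {M G : Finset (ℝ × ℝ)} : Ex o M G ⊆ G := by
  intro x hx
  simp only [Ex, Finset.mem_biUnion, Finset.mem_union, Finset.mem_filter] at hx
  obtain ⟨v, hv, h | h⟩ := hx
  · exact h.1
  · exact h.1

lemma Ex_card {o : ℝ × ℝ} {M G : Finset (ℝ × ℝ)} (hM : ∀ v ∈ M, o.1 ≠ v.1) :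
    (Ex o M G).card ≤ M.card * 2 := by
  apply Finset.card_biUnion_le_card_mul
  intro v hv
  refine (Finset.card_union_le _ _).trans ?_
  have h1 : (G.filter fun x => ev x v = 0 ∧ ∀ y ∈ G, ev y v = 0 → 1 / ev y o ≤ 1 / ev x o).card ≤ 1 := by
    rw [Finset.card_le_one]
    intro a ha b hb
    rw [Finset.mem_filter] at ha hb
    exact H_inj (hM v hv) ha.2.1 hb.2.1 (le_antisymm (hb.2.2 a ha.1 ha.2.1) (ha.2.2 b hb.1 hb.2.1))
  have h2 : (G.filter fun x => ev x v = 0 ∧ ∀ y ∈ G, ev y v = 0 → 1 / ev x o ≤ 1 / ev y o).card ≤ 1 := by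
    rw [Finset.card_le_one]
    intro a ha b hb
    rw [Finset.mem_filter] at ha hb
    exact H_inj (hM v hv) ha.2.1 hb.2.1 (le_antisymm (ha.2.2 b hb.1 hb.2.1) (hb.2.2 a ha.1 ha.2.1))
  omega

lemma psi_form {o v x α : ℝ × ℝ} (hov : v.1 - o.1 ≠ 0) (hx : ev x v = 0) (hα : ev α o = 0) (hxo : ev x o ≠ 0) :
    (x.1 - α.1) / ev x o = 1 / (v.1 - o.1) + (ev α v / (v.1 - o.1)) * (1 / ev x o) := by
  field_simp
  simp only [ev] at *
  linear_combination (-1 : ℝ) * hx - hα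

lemma max_mem_Ex {o α x : ℝ × ℝ} {M G : Finset (ℝ × ℝ)} (hM : ∀ v ∈ M, o.1 ≠ v.1)
    (hG : ∀ y ∈ G, ev y o ≠ 0) (hα : ev α o = 0) (hαM : ∀ v ∈ M, ev α v ≠ 0)
    (hcov : ∀ y ∈ G, ∃ v ∈ M, ev y v = 0) (hx : x ∈ G)
    (hmax : ∀ y ∈ G, (y.1 - α.1) / ev y o ≤ (x.1 - α.1) / ev x o) : x ∈ Ex o M G := by
  obtain ⟨v, hv, hxv⟩ := hcov x hx
  have hd : v.1 - o.1 ≠ 0 := sub_ne_zero.2 (hM v hv).symm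
  have hb : ev α v / (v.1 - o.1) ≠ 0 := div_ne_zero (hαM v hv) hd
  have key : ∀ y ∈ G, ev y v = 0 → (ev α v / (v.1 - o.1)) * (1 / ev y o) ≤ (ev α v / (v.1 - o.1)) * (1 / ev x o) := by
    intro y hy hyv
    have := hmax y hy
    rw [psi_form hd hyv hα (hG y hy), psi_form hd hxv hα (hG x hx)] at this
    linarith
  simp only [Ex, Finset.mem_biUnion, Finset.mem_union, Finset.mem_filter]
  refine ⟨v, hv, ?_⟩
  rcases lt_or_gt_of_ne hb with h | h
  · right
    refine ⟨hx, hxv, fun y hy hyv => ?_⟩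
    exact (mul_le_mul_left_of_neg h).1 (key y hy hyv)
  · left
    refine ⟨hx, hxv, fun y hy hyv => ?_⟩
    exact (mul_le_mul_iff_right₀ h).1 (key y hy hyv)

/-- collinear points have the same projection -/
lemma psi_eq {o α x y v : ℝ × ℝ} (hα : ev α o = 0) (h1 : ev α v = 0) (h2 : ev x v = 0) (h3 : ev y v = 0)
    (hx : ev x o ≠ 0) (hy : ev y o ≠ 0) : (x.1 - α.1) / ev x o = (y.1 - α.1) / ev y o := by
  have hd : v.1 - o.1 ≠ 0 := by
    intro h
    have hvo : v = o := pt_eq_x h1 hα (by linarith)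
    rw [hvo] at h2; exact hx h2
  rw [psi_form hd h2 hα hx, psi_form hd h3 hα hy, h1]; ring

noncomputable def peel (o : ℝ × ℝ) (M F : Finset (ℝ × ℝ)) : ℕ → Finset (ℝ × ℝ)
  | 0 => F
  | i + 1 => peel o M F i \ Ex o M (peel o M F i)

lemma peel_anti {o : ℝ × ℝ} {M F : Finset (ℝ × ℝ)} : Antitone (peel o M F) :=
  antitone_nat_of_succ_le fun i => Finset.sdiff_subset

noncomputable def peelU (o : ℝ × ℝ) (M F : Finset (ℝ × ℝ)) (t : ℕ) : Finset (ℝ × ℝ) :=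
  (Finset.range t).biUnion fun i => Ex o M (peel o M F i)

lemma peelU_card {o : ℝ × ℝ} {M F : Finset (ℝ × ℝ)} (hM : ∀ v ∈ M, o.1 ≠ v.1) (t : ℕ) :
    (peelU o M F t).card ≤ t * (M.card * 2) := by
  have := Finset.card_biUnion_le_card_mul (Finset.range t) (fun i => Ex o M (peel o M F i)) (M.card * 2)
    (fun i _ => Ex_card hM)
  simpa [peelU] using this

lemma not_peel {o : ℝ × ℝ} {M F : Finset (ℝ × ℝ)} {x : ℝ × ℝ} (hx : x ∈ F) :
    ∀ i, x ∉ peel o M F i → x ∈ peelU o M F i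
  | 0, h => absurd hx h
  | i + 1, h => by
    rw [peelU, Finset.mem_biUnion]
    by_cases hi : x ∈ peel o M F i
    · refine ⟨i, by simp, ?_⟩
      by_contra hh
      exact h (by rw [peel, Finset.mem_sdiff]; exact ⟨hi, hh⟩)
    · have := not_peel hx i hi
      rw [peelU, Finset.mem_biUnion] at this
      obtain ⟨j, hj, h⟩ := this
      exact ⟨j, by simp at hj ⊢; omega, h⟩

lemma peelU_mono {o : ℝ × ℝ} {M F : Finset (ℝ × ℝ)} {i t : ℕ} (h : i ≤ t) : peelU o M F i ⊆ peelU o M F t :=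
  Finset.biUnion_subset_biUnion_of_subset_left _ (by intro j; simp; omega)

lemma Ex_sub_U {o : ℝ × ℝ} {M F : Finset (ℝ × ℝ)} {i t : ℕ} (h : i < t) : Ex o M (peel o M F i) ⊆ peelU o M F t := by
  intro x hx
  rw [peelU, Finset.mem_biUnion]
  exact ⟨i, by simpa using h, hx⟩

lemma peel_nonempty {o : ℝ × ℝ} {M F : Finset (ℝ × ℝ)} (hM : ∀ v ∈ M, o.1 ≠ v.1) {t : ℕ}
    (h : t * (M.card * 2) < F.card) (i : ℕ) (hi : i ≤ t) : (peel o M F i).Nonempty := by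
  by_contra hh
  rw [Finset.not_nonempty_iff_eq_empty] at hh
  have : F ⊆ peelU o M F t := by
    intro x hx
    apply peelU_mono hi
    apply not_peel hx
    rw [hh]; simp
  have := (Finset.card_le_card this).trans (peelU_card hM t)
  omega

/-- lines through `α` other than `o` containing exactly two points of `Q` -/
noncomputable def Wd (L Q : Finset (ℝ × ℝ)) (o α : ℝ × ℝ) : Finset (ℝ × ℝ) :=
  (Vx L).filter fun v => ev α v = 0 ∧ v ≠ o ∧ (∃ x ∈ Q, x ≠ α ∧ ev x v = 0) ∧ (Q.filter fun x => ev x v = 0).card = 2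

lemma good_alpha (hL : Gen L) {Q M : Finset (ℝ × ℝ)} (hQ : Q ⊆ L) {o α : ℝ × ℝ} (hM : ∀ v ∈ M, o.1 ≠ v.1)
    (hcov : ∀ q ∈ Q, ev q o ≠ 0 → ∃ v ∈ M, ev q v = 0) (t : ℕ)
    (hF : t * (M.card * 2) < (Q.filter fun x => ev x o ≠ 0).card) (hαQ : α ∈ Q) (hα : ev α o = 0)
    (hαM : ∀ v ∈ M, ev α v ≠ 0)
    (hαU : ∀ x ∈ peelU o M (Q.filter fun x => ev x o ≠ 0) t, ∀ y ∈ peelU o M (Q.filter fun x => ev x o ≠ 0) t,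
      x ≠ y → ∀ v, ev x v = 0 → ev y v = 0 → ev α v ≠ 0) :
    t ≤ (Wd L Q o α).card := by
  set F := Q.filter fun x => ev x o ≠ 0 with hFd
  have hmem : ∀ i, peel o M F i ⊆ F := fun i => peel_anti (Nat.zero_le i)
  have hm : ∀ i, ∃ x, i < t → x ∈ peel o M F i ∧ ∀ y ∈ peel o M F i, (y.1 - α.1) / ev y o ≤ (x.1 - α.1) / ev x o := by
    intro i
    by_cases hi : i < t
    · obtain ⟨x, hx, h⟩ := Finset.exists_max_image (peel o M F i) (fun y => (y.1 - α.1) / ev y o) (peel_nonempty hM hF i hi.le)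
      exact ⟨x, fun _ => ⟨hx, h⟩⟩
    · exact ⟨0, fun h => absurd h hi⟩
  choose x hx using hm
  have hFm : ∀ y ∈ F, y ∈ Q ∧ ev y o ≠ 0 := fun y hy => by simpa [hFd] using hy
  have hxF : ∀ i < t, x i ∈ F := fun i hi => hmem i (hx i hi).1
  have hEx : ∀ i < t, ∀ z ∈ peel o M F i, (∀ y ∈ peel o M F i, (y.1 - α.1) / ev y o ≤ (z.1 - α.1) / ev z o) →
      z ∈ Ex o M (peel o M F i) := by
    intro i hi z hz hmax
    exact max_mem_Ex hM (fun y hy => (hFm y (hmem i hy)).2) hα hαM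
      (fun y hy => hcov y (hFm y (hmem i hy)).1 (hFm y (hmem i hy)).2) hz hmax
  have hxE : ∀ i < t, x i ∈ Ex o M (peel o M F i) := fun i hi => hEx i hi _ (hx i hi).1 (hx i hi).2
  have hxU : ∀ i < t, x i ∈ peelU o M F t := fun i hi => Ex_sub_U hi (hxE i hi)
  have hxα : ∀ i < t, x i ≠ α := by
    intro i hi h
    exact (hFm _ (hxF i hi)).2 (h ▸ hα)
  have hxne : ∀ i j, i < j → j < t → x i ≠ x j := by
    intro i j hij hj h
    have h1 : x j ∈ peel o M F (i + 1) := peel_anti hij (hx j hj).1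
    rw [peel, Finset.mem_sdiff, ← h] at h1
    exact h1.2 (hxE i (by omega))
  have hinr : ∀ i < t, inter α (x i) ∈ Vx L ∧ ev α (inter α (x i)) = 0 ∧ ev (x i) (inter α (x i)) = 0 :=
    fun i hi => inter_mem hL (hQ hαQ) (hQ (hFm _ (hxF i hi)).1) (hxα i hi).symm
  have hcard : (Finset.range t).card ≤ (Wd L Q o α).card := by
    apply Finset.card_le_card_of_injOn (fun i => inter α (x i))
    · intro i hi
      have hi : i < t := by simpa using hi
      obtain ⟨h1, h2, h3⟩ := hinr i hi
      have hvo : inter α (x i) ≠ o := by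
        intro h; rw [h] at h3; exact (hFm _ (hxF i hi)).2 h3
      simp only [Wd, Finset.coe_filter, Set.mem_ofPred_eq]
      refine ⟨h1, h2, hvo, ⟨x i, (hFm _ (hxF i hi)).1, hxα i hi, h3⟩, ?_⟩
      rw [Finset.card_eq_two]
      refine ⟨α, x i, (hxα i hi).symm, ?_⟩
      ext y
      simp only [Finset.mem_filter, Finset.mem_insert, Finset.mem_singleton]
      constructor
      · rintro ⟨hyQ, hyv⟩
        by_contra hc
        push Not at hc
        by_cases hyo : ev y o = 0
        · exact hc.1 (line_eq hyv h2 hyo hα hvo)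
        · have hyF : y ∈ F := by rw [hFd, Finset.mem_filter]; exact ⟨hyQ, hyo⟩
          have hyU : y ∈ peelU o M F t := by
            by_cases hyi : y ∈ peel o M F i
            · apply Ex_sub_U hi
              apply hEx i hi y hyi
              intro z hz
              rw [psi_eq hα h2 hyv h3 hyo (hFm _ (hxF i hi)).2]
              exact (hx i hi).2 z hz
            · exact peelU_mono hi.le (not_peel hyF i hyi)
          exact hαU y hyU (x i) (hxU i hi) hc.2 _ hyv h3 h2
      · rintro (rfl | rfl)
        · exact ⟨hαQ, h2⟩
        · exact ⟨(hFm _ (hxF i hi)).1, h3⟩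
    · intro i hi j hj hij
      have hi : i < t := by simpa using hi
      have hj : j < t := by simpa using hj
      simp only at hij
      by_contra hne
      have hxx : x i ≠ x j := by
        rcases Nat.lt_or_gt_of_ne hne with h | h
        · exact hxne i j h hj
        · exact (hxne j i h hi).symm
      have h1 := hinr i hi
      have h2 := hinr j hj
      rw [← hij] at h2
      exact hαU _ (hxU i hi) _ (hxU j hj) hxx _ h1.2.2 h2.2.2 h1.2.1
  simpa using hcard

end FOL

set_option linter.unusedVariables false
namespace FOL

open Finset MvPolynomial

attribute [local instance] Classical.propDecidable

variable {L : Finset (ℝ × ℝ)}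

/-- lines through `α` meeting both `Q` (again) and the rest of `L` -/
noncomputable def Mx (L Q : Finset (ℝ × ℝ)) (α : ℝ × ℝ) : Finset (ℝ × ℝ) :=
  (Vx L).filter fun v => ev α v = 0 ∧ (∃ x ∈ Q, x ≠ α ∧ ev x v = 0) ∧ ∃ y ∈ L, y ∉ Q ∧ ev y v = 0

lemma Wd_le {Q : Finset (ℝ × ℝ)} (hQ : Q ⊆ L) (o α : ℝ × ℝ) :
    (Wd L Q o α).card ≤ (((Vx L).filter fun v => (thr L v).card = 2).filter fun v => ev α v = 0 ∧ v ≠ o).card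
      + (Mx L Q α).card := by
  refine le_trans (Finset.card_le_card ?_) (Finset.card_union_le _ _)
  intro v hv
  simp only [Wd, Finset.mem_filter] at hv
  obtain ⟨h1, h2, h3, h4, h5⟩ := hv
  rw [Finset.mem_union]
  by_cases hy : ∃ y ∈ L, y ∉ Q ∧ ev y v = 0
  · right
    simp only [Mx, Finset.mem_filter]
    exact ⟨h1, h2, h4, hy⟩
  · left
    push Not at hy
    simp only [Finset.mem_filter]
    refine ⟨⟨h1, ?_⟩, h2, h3⟩
    rw [← h5]
    congr 1
    ext y
    simp only [thr, Finset.mem_filter]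
    constructor
    · rintro ⟨hy1, hy2⟩
      exact ⟨by_contra fun h => hy y hy1 h hy2, hy2⟩
    · rintro ⟨hy1, hy2⟩
      exact ⟨hQ hy1, hy2⟩

lemma sum_N2_le (o : ℝ × ℝ) (A : Finset (ℝ × ℝ)) (hA : ∀ α ∈ A, ev α o = 0) :
    ∑ α ∈ A, (((Vx L).filter fun v => (thr L v).card = 2).filter fun v => ev α v = 0 ∧ v ≠ o).card ≤ N2 L := by
  rw [← Finset.card_biUnion]
  · apply Finset.card_le_card
    intro v hv
    rw [Finset.mem_biUnion] at hv
    obtain ⟨α, _, h⟩ := hv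
    exact (Finset.mem_filter.1 h).1
  · intro α hα β hβ hne
    rw [Function.onFun, Finset.disjoint_left]
    intro v h1 h2
    rw [Finset.mem_filter] at h1 h2
    exact hne (line_eq h1.2.1 h2.2.1 (hA α hα) (hA β hβ) h1.2.2)

theorem lines_main (hL : Gen L) {Q Λ : Finset (ℝ × ℝ)} (hQ : Q ⊆ L) (hΛ : Λ ⊆ Vx L) {o : ℝ × ℝ} (ho : o ∈ Λ)
    {s : ℕ} (hs : Λ.card ≤ s) (hcov : ∀ q ∈ Q, ∃ v ∈ Λ, ev q v = 0) (t : ℕ)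
    (hF : 2 * s * t < (Q.filter fun x => ev x o ≠ 0).card) :
    t * (Q.filter fun x => ev x o = 0).card ≤ N2 L + ∑ α ∈ Q, (Mx L Q α).card + t * (s + (2 * s * t) ^ 2) := by
  set A := Q.filter fun x => ev x o = 0 with hA
  set F := Q.filter fun x => ev x o ≠ 0 with hFd
  set M := Λ.erase o with hMd
  have hMs : M.card ≤ s := (Finset.card_le_card (Finset.erase_subset _ _)).trans hs
  have hM : ∀ v ∈ M, o.1 ≠ v.1 := by
    intro v hv h
    rw [hMd, Finset.mem_erase] at hv
    exact hv.1 (hL.gen o (hΛ ho) v (hΛ hv.2) h).symm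
  have hMo : ∀ v ∈ M, v ≠ o := fun v hv => by rw [hMd, Finset.mem_erase] at hv; exact hv.1
  have hcov' : ∀ q ∈ Q, ev q o ≠ 0 → ∃ v ∈ M, ev q v = 0 := by
    intro q hq hqo
    obtain ⟨v, hv, h⟩ := hcov q hq
    refine ⟨v, ?_, h⟩
    rw [hMd, Finset.mem_erase]
    exact ⟨by rintro rfl; exact hqo h, hv⟩
  have htm : t * (M.card * 2) ≤ 2 * s * t := by
    calc t * (M.card * 2) ≤ t * (s * 2) := by gcongr
      _ = _ := by ring
  set U := peelU o M F t with hU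
  have hUc : U.card ≤ 2 * s * t := (peelU_card hM t).trans htm
  have hUo : ∀ x ∈ U, ev x o ≠ 0 := by
    intro x hx
    rw [hU, peelU, Finset.mem_biUnion] at hx
    obtain ⟨i, _, hi⟩ := hx
    have : x ∈ F := peel_anti (Nat.zero_le i) (Ex_sub hi)
    rw [hFd, Finset.mem_filter] at this
    exact this.2
  set b1 := M.biUnion fun v => A.filter fun α => ev α v = 0 with hb1
  set b2 := (U ×ˢ U).biUnion fun xy => A.filter fun α => xy.1 ≠ xy.2 ∧ ∃ v, ev xy.1 v = 0 ∧ ev xy.2 v = 0 ∧ ev α v = 0 with hb2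
  have hAo : ∀ α ∈ A, α ∈ Q ∧ ev α o = 0 := fun α h => by rw [hA, Finset.mem_filter] at h; exact h
  have c1 : b1.card ≤ s := by
    have : b1.card ≤ M.card * 1 := by
      apply Finset.card_biUnion_le_card_mul
      intro v hv
      rw [Finset.card_le_one]
      intro a ha b hb
      rw [Finset.mem_filter] at ha hb
      exact line_eq ha.2 hb.2 (hAo a ha.1).2 (hAo b hb.1).2 (hMo v hv)
    omega
  have c2 : b2.card ≤ (2 * s * t) ^ 2 := by
    have : b2.card ≤ (U ×ˢ U).card * 1 := by
      apply Finset.card_biUnion_le_card_mul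
      intro xy hxy
      rw [Finset.mem_product] at hxy
      rw [Finset.card_le_one]
      intro a ha b hb
      rw [Finset.mem_filter] at ha hb
      obtain ⟨ha, hne, v, h1, h2, h3⟩ := ha
      obtain ⟨hb, _, v', h1', h2', h3'⟩ := hb
      have : v = v' := pt_eq h1 h2 h1' h2' hne
      rw [← this] at h3'
      refine line_eq h3 h3' (hAo a ha).2 (hAo b hb).2 ?_
      intro h
      rw [h] at h1
      exact hUo _ hxy.1 h1
    rw [Finset.card_product, mul_one] at this
    calc b2.card ≤ U.card * U.card := this
      _ ≤ (2 * s * t) * (2 * s * t) := by gcongr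
      _ = _ := by ring
  set G := A \ (b1 ∪ b2) with hG
  have cG : A.card ≤ G.card + (s + (2 * s * t) ^ 2) := by
    have h1 := Finset.le_card_sdiff (b1 ∪ b2) A
    have h2 := Finset.card_union_le b1 b2
    rw [← hG] at h1
    omega
  have hg : ∀ α ∈ G, t ≤ (Wd L Q o α).card := by
    intro α hα
    rw [hG, Finset.mem_sdiff, Finset.mem_union, not_or] at hα
    obtain ⟨h1, h2, h3⟩ := hα
    apply good_alpha hL hQ hM hcov' t (lt_of_le_of_lt htm hF) (hAo α h1).1 (hAo α h1).2
    · intro v hv h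
      apply h2
      rw [hb1, Finset.mem_biUnion]
      exact ⟨v, hv, Finset.mem_filter.2 ⟨h1, h⟩⟩
    · intro x hx y hy hne v hxv hyv hav
      apply h3
      rw [hb2, Finset.mem_biUnion]
      exact ⟨(x, y), Finset.mem_product.2 ⟨hx, hy⟩, Finset.mem_filter.2 ⟨h1, hne, v, hxv, hyv, hav⟩⟩
  have h1 : G.card * t ≤ ∑ α ∈ G, (Wd L Q o α).card := by
    have := Finset.card_nsmul_le_sum G (fun α => (Wd L Q o α).card) t hg
    simpa using this
  have h2 : ∑ α ∈ G, (Wd L Q o α).card ≤ N2 L + ∑ α ∈ Q, (Mx L Q α).card := by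
    have hGA : G ⊆ A := Finset.sdiff_subset
    calc ∑ α ∈ G, (Wd L Q o α).card ≤ ∑ α ∈ G, ((((Vx L).filter fun v => (thr L v).card = 2).filter
            fun v => ev α v = 0 ∧ v ≠ o).card + (Mx L Q α).card) :=
          Finset.sum_le_sum fun α _ => Wd_le hQ o α
      _ ≤ _ := by
        rw [Finset.sum_add_distrib]
        apply Nat.add_le_add
        · exact sum_N2_le o G (fun α h => (hAo α (hGA h)).2)
        · apply Finset.sum_le_sum_of_subset
          intro α h
          exact (hAo α (hGA h)).1
  calc t * A.card ≤ t * (G.card + (s + (2 * s * t) ^ 2)) := by gcongr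
    _ = G.card * t + t * (s + (2 * s * t) ^ 2) := by ring
    _ ≤ _ := by omega

/-- a finite set covered by `s` lines, few mixed lines: one line takes almost all -/
theorem lines_cor (hL : Gen L) {Q Λ : Finset (ℝ × ℝ)} (hQ : Q ⊆ L) (hΛ : Λ ⊆ Vx L)
    {s : ℕ} (hs : Λ.card ≤ s) (hs1 : 1 ≤ s) (hcov : ∀ q ∈ Q, ∃ v ∈ Λ, ev q v = 0) {R : ℕ}
    (hR : N2 L + ∑ α ∈ Q, (Mx L Q α).card ≤ R * Q.card)
    (hbig : s * (s * R + 1) * (s + (2 * s * (s * R + 1)) ^ 2) < Q.card) :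
    ∃ o ∈ Vx L, (Q.filter fun x => ev x o ≠ 0).card ≤ 2 * s * (s * R + 1) := by
  set t := s * R + 1 with ht
  have hΛne : Λ.Nonempty := by
    have : Q.Nonempty := Finset.card_pos.1 (by omega)
    obtain ⟨q, hq⟩ := this
    obtain ⟨v, hv, _⟩ := hcov q hq
    exact ⟨v, hv⟩
  obtain ⟨o, ho, hmax⟩ := Finset.exists_max_image Λ (fun v => (Q.filter fun x => ev x v = 0).card) hΛne
  refine ⟨o, hΛ ho, ?_⟩
  by_contra hc
  push Not at hc
  have h1 := lines_main hL hQ hΛ ho hs hcov t hc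
  have h2 : Q.card ≤ s * (Q.filter fun x => ev x o = 0).card := by
    have hsub : Q ⊆ Λ.biUnion fun v => Q.filter fun x => ev x v = 0 := by
      intro q hq
      obtain ⟨v, hv, h⟩ := hcov q hq
      rw [Finset.mem_biUnion]
      exact ⟨v, hv, Finset.mem_filter.2 ⟨hq, h⟩⟩
    calc Q.card ≤ _ := Finset.card_le_card hsub
      _ ≤ Λ.card * (Q.filter fun x => ev x o = 0).card := Finset.card_biUnion_le_card_mul _ _ _ hmax
      _ ≤ _ := by gcongr
  set a := (Q.filter fun x => ev x o = 0).card
  set X := s + (2 * s * t) ^ 2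
  have h3 : t * a ≤ R * Q.card + t * X := by omega
  have h4 : t * Q.card ≤ s * R * Q.card + s * t * X := by
    calc t * Q.card ≤ t * (s * a) := by gcongr
      _ = s * (t * a) := by ring
      _ ≤ s * (R * Q.card + t * X) := by gcongr
      _ = _ := by ring
  have h5 : t * Q.card = s * R * Q.card + Q.card := by rw [ht]; ring
  omega

/-- collinear points of `L` lie on a vertex line -/
lemma col_vx (hL : Gen L) (h2 : 2 ≤ L.card) {n : Fin 3 → ℝ} (hn : n ≠ 0) {Q : Finset (ℝ × ℝ)} (hQ : Q ⊆ L)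
    (hz : ∀ q ∈ Q, Zr (lin n) q) : ∃ v ∈ Vx L, ∀ q ∈ Q, ev q v = 0 := by
  by_cases h : ∃ x ∈ Q, ∃ y ∈ Q, x ≠ y
  · obtain ⟨x, hx, y, hy, hne⟩ := h
    obtain ⟨h1, h2, h3⟩ := inter_mem hL (hQ hx) (hQ hy) hne
    refine ⟨_, h1, fun q hq => ?_⟩
    rw [← Zr_vf] at h2 h3 ⊢
    exact lin_zero_of_col (crs_uu hne) hn (hz x hx) (hz y hy) (hz q hq) h2 h3
  · push Not at h
    have : ∃ x ∈ L, ∀ q ∈ Q, q = x := by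
      rcases Q.eq_empty_or_nonempty with h0 | ⟨x, hx⟩
      · obtain ⟨x, hx⟩ : L.Nonempty := Finset.card_pos.1 (by omega)
        exact ⟨x, hx, by simp [h0]⟩
      · exact ⟨x, hQ hx, fun q hq => h q hq x hx⟩
    obtain ⟨x, hx, hxq⟩ := this
    obtain ⟨y, hy, hne⟩ := Finset.exists_mem_ne (by omega : 1 < L.card) x
    obtain ⟨h1, h2, h3⟩ := inter_mem hL hx hy hne.symm
    exact ⟨_, h1, fun q hq => by rw [hxq q hq]; exact h2⟩

end FOL

set_option linter.unusedVariables false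
namespace FOL

open Finset MvPolynomial

attribute [local instance] Classical.propDecidable

variable {L : Finset (ℝ × ℝ)}

lemma mem_off {G : Pol} {q : ℝ × ℝ} : q ∈ off L G ↔ q ∈ L ∧ ¬ Zr G q := by simp [off]

lemma conic_quot {σ F : Pol} (hσ0 : σ ≠ 0) (hσd : σ.IsHomogeneous 2) (hF0 : F ≠ 0) (hF : F.IsHomogeneous 3)
    (h : σ ∣ F) : ∃ n, n ≠ 0 ∧ F = σ * lin n := by
  obtain ⟨c, hc⟩ := h
  have h1 := hom_quot (e := 1) hσd hσ0 hF hc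
  obtain ⟨n, hn⟩ := hom1_eq_lin h1
  refine ⟨n, ?_, by rw [hc, hn]⟩
  rintro rfl
  apply hF0
  rw [hc, hn]
  simp [lin]

lemma Zr_mul {f g : Pol} {q : ℝ × ℝ} : Zr (f * g) q ↔ Zr f q ∨ Zr g q := by
  unfold Zr; rw [map_mul, mul_eq_zero]

/-- the points `s` of the conic such that the line `qs` is not of type (q, s, t) -/
noncomputable def SB (L : Finset (ℝ × ℝ)) (σ : Pol) (q : ℝ × ℝ) : Finset (ℝ × ℝ) :=
  (on L σ).filter fun s => ¬ ∃ v s', Tri L v q s s' ∧ s' ∈ on L σ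

lemma SB_card (hL : Gen L) {σ : Pol} (hσ : Irreducible σ) (hσd : σ.IsHomogeneous 2) {q : ℝ × ℝ}
    (hq : q ∈ off L σ) : (SB L σ q).card ≤ 18 * ((BadOn L q).card + 1) := by
  obtain ⟨hqL, hqσ⟩ := mem_off.1 hq
  obtain ⟨D⟩ := dec hL hqL (le_refl (BadOn L q).card)
  set T := (BadOn L q).card
  have hn : ∀ r, ∃ n, r ∈ D.act → σ ∣ D.F r → n ≠ 0 ∧ D.F r = σ * lin n := by
    intro r
    by_cases hr : r ∈ D.act ∧ σ ∣ D.F r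
    · obtain ⟨n, hn⟩ := conic_quot hσ.ne_zero hσd (D.F0 r hr.1) (D.Fh r hr.1) hr.2
      exact ⟨n, fun _ _ => hn⟩
    · exact ⟨0, fun h1 h2 => absurd ⟨h1, h2⟩ hr⟩
  choose n hn using hn
  have hsub : SB L σ q ⊆ (D.E.biUnion fun v => (on L σ).filter (fun s => ev s v = 0)) ∪
      (D.act.biUnion fun r => (on L σ).filter (fun s => Zr (D.F r) s ∧ (σ ∣ D.F r → Zr (lin (n r)) s))) := by
    intro s hs
    simp only [SB, Finset.mem_filter] at hs
    obtain ⟨hs, hbad⟩ := hs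
    have hs' := mem_on.1 hs
    have hne : s ≠ q := by rintro rfl; exact hqσ hs'.2
    rw [Finset.mem_union, Finset.mem_biUnion, Finset.mem_biUnion]
    rcases D.loc hL hqL hs'.1 hne with ⟨v, hv, h⟩ | ⟨r, hr, i, hi, h⟩
    · exact Or.inl ⟨v, hv, Finset.mem_filter.2 ⟨hs, h⟩⟩
    · right
      refine ⟨r, hr, Finset.mem_filter.2 ⟨hs, ?_⟩⟩
      have key : ∃ s', Tri L (D.V r i) q s s' ∧ Zr (D.F r) s ∧ Zr (D.F r) s' := by
        rcases h with rfl | rfl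
        · exact ⟨_, D.tri r hr i hi, D.Fa r hr i hi, D.Fb r hr i hi⟩
        · exact ⟨_, (D.tri r hr i hi).swap, D.Fb r hr i hi, D.Fa r hr i hi⟩
      obtain ⟨s', htri, hz, hz'⟩ := key
      refine ⟨hz, fun hd => ?_⟩
      obtain ⟨hn0, hFn⟩ := hn r hr hd
      have hs'n : ¬ Zr σ s' := fun h => hbad ⟨_, s', htri, mem_on.2 ⟨htri.m3.1, h⟩⟩
      have h1 : Zr (lin (n r)) s' := by
        rw [hFn, Zr_mul] at hz'; exact hz'.resolve_left hs'n
      have h2 : Zr (lin (n r)) q := by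
        have := D.Fp r hr
        rw [hFn, Zr_mul] at this; exact this.resolve_left hqσ
      exact lin_zero_of_col (crs_uu htri.pr) (vf_ne (D.V r i)) (Zr_vf.2 htri.m1.2) (Zr_vf.2 htri.m3.2)
        (Zr_vf.2 htri.m2.2) h2 h1
  have h1 : (D.E.biUnion fun v => (on L σ).filter (fun s => ev s v = 0)).card ≤ D.E.card * 2 := by
    apply Finset.card_biUnion_le_card_mul
    intro v hv
    apply line_count hσ hσd (by norm_num) (vf_ne v)
    · intro q hq; exact (mem_on.1 (Finset.mem_filter.1 hq).1).2
    · intro q hq; rw [Zr_vf]; exact (Finset.mem_filter.1 hq).2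
  have h2 : (D.act.biUnion fun r => (on L σ).filter
      (fun s => Zr (D.F r) s ∧ (σ ∣ D.F r → Zr (lin (n r)) s))).card ≤ D.act.card * 6 := by
    apply Finset.card_biUnion_le_card_mul
    intro r hr
    by_cases hd : σ ∣ D.F r
    · have := line_count hσ hσd (by norm_num) (hn r hr hd).1 ((on L σ).filter
        (fun s => Zr (D.F r) s ∧ (σ ∣ D.F r → Zr (lin (n r)) s)))
        (fun s hs => (mem_on.1 (Finset.mem_filter.1 hs).1).2) (fun s hs => (Finset.mem_filter.1 hs).2.2 hd)
      omega
    · exact bez _ hσ hσd (D.Fh r hr) hd (fun s hs => (mem_on.1 (Finset.mem_filter.1 hs).1).2)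
        (fun s hs => (Finset.mem_filter.1 hs).2.1)
  have h3 := Finset.card_le_card hsub
  have h4 := Finset.card_union_le (D.E.biUnion fun v => (on L σ).filter (fun s => ev s v = 0))
    (D.act.biUnion fun r => (on L σ).filter (fun s => Zr (D.F r) s ∧ (σ ∣ D.F r → Zr (lin (n r)) s)))
  have h5 := D.hE
  have h6 := D.hact
  omega

lemma SB_sum {σ : Pol} :
    ∑ q ∈ off L σ, (on L σ \ SB L σ q).card ≤ (on L σ).card * (on L σ).card := by
  rw [← Finset.card_sigma, ← Finset.card_product]
  have hf : ∀ q s : ℝ × ℝ, ∃ s', s ∈ on L σ \ SB L σ q → (∃ v, Tri L v q s s') ∧ s' ∈ on L σ := by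
    intro q s
    by_cases h : s ∈ on L σ \ SB L σ q
    · have h' := h
      rw [SB, Finset.mem_sdiff, Finset.mem_filter, not_and, not_not] at h'
      obtain ⟨v, s', h1, h2⟩ := h'.2 h'.1
      exact ⟨s', fun _ => ⟨⟨v, h1⟩, h2⟩⟩
    · exact ⟨0, fun hh => absurd hh h⟩
  choose f hf using hf
  apply Finset.card_le_card_of_injOn (fun x => (x.2, f x.1 x.2))
  · rintro ⟨q, s⟩ h
    simp only [Finset.mem_coe, Finset.mem_sigma] at h
    simp only [Finset.mem_coe, Finset.mem_product]
    exact ⟨(Finset.mem_sdiff.1 h.2).1, (hf q s h.2).2⟩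
  · rintro ⟨q, s⟩ h ⟨q', s'⟩ h' he
    simp only [Finset.mem_coe, Finset.mem_sigma] at h h'
    simp only [Prod.mk.injEq] at he
    obtain ⟨rfl, he⟩ := he
    obtain ⟨⟨v, hv⟩, _⟩ := hf q s h.2
    obtain ⟨⟨v', hv'⟩, _⟩ := hf q' s h'.2
    rw [← he] at hv'
    have hvv : v = v' := pt_eq hv.m2.2 hv.m3.2 hv'.m2.2 hv'.m3.2 hv.qr
    rw [← hvv] at hv'
    rcases (hv.mem q').1 hv'.m1 with h | h | h
    · rw [h]
    · exact absurd h hv'.pq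
    · exact absurd h hv'.pr

lemma Mx_le (hL : Gen L) {σ : Pol} {α : ℝ × ℝ} (hα : α ∈ off L σ) :
    (Mx L (off L σ) α).card ≤ (SB L σ α).card := by
  have hy : ∀ v, ∃ y, v ∈ Mx L (off L σ) α → y ∈ L ∧ y ∉ off L σ ∧ ev y v = 0 := by
    intro v
    by_cases h : v ∈ Mx L (off L σ) α
    · have h' := h
      simp only [Mx, Finset.mem_filter] at h'
      obtain ⟨_, _, _, y, h1, h2, h3⟩ := h'
      exact ⟨y, fun _ => ⟨h1, h2, h3⟩⟩
    · exact ⟨0, fun hh => absurd hh h⟩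
  choose y hy using hy
  have hyσ : ∀ v ∈ Mx L (off L σ) α, y v ∈ on L σ ∧ y v ≠ α := by
    intro v hv
    obtain ⟨h1, h2, h3⟩ := hy v hv
    refine ⟨mem_on.2 ⟨h1, by_contra fun h => h2 (mem_off.2 ⟨h1, h⟩)⟩, ?_⟩
    intro h; rw [h] at h2; exact h2 hα
  apply Finset.card_le_card_of_injOn y
  · intro v hv
    have hv : v ∈ Mx L (off L σ) α := hv
    obtain ⟨h1, h2⟩ := hyσ v hv
    obtain ⟨_, _, h3⟩ := hy v hv
    simp only [Mx, Finset.mem_filter] at hv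
    obtain ⟨_, hav, ⟨x, hx, hxα, hxv⟩, _⟩ := hv
    have : y v ∈ SB L σ α := by
      rw [SB, Finset.mem_filter]
      refine ⟨h1, ?_⟩
      rintro ⟨v', s', htri, hs'⟩
      have hvv : v = v' := pt_eq hav h3 htri.m1.2 htri.m2.2 h2.symm
      rw [← hvv] at htri
      have hxo := mem_off.1 hx
      rcases (htri.mem x).1 ⟨hxo.1, hxv⟩ with h | h | h
      · exact hxα h
      · rw [h] at hxo; exact hxo.2 (mem_on.1 h1).2
      · rw [h] at hxo; exact hxo.2 (mem_on.1 hs').2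
    exact this
  · intro v hv w hw he
    have hv : v ∈ Mx L (off L σ) α := hv
    have hw : w ∈ Mx L (off L σ) α := hw
    have h1 := hyσ v hv
    have h2 := (hy v hv).2.2
    have h3 := (hy w hw).2.2
    rw [← he] at h3
    simp only [Mx, Finset.mem_filter] at hv hw
    exact pt_eq hv.2.1 h2 hw.2.1 h3 h1.2.symm

/-- most of the rest lies on few lines -/
lemma conic_cover (hL : Gen L) {σ : Pol} (hσ : Irreducible σ) (hσd : σ.IsHomogeneous 2) {p : ℝ × ℝ}
    (hp : p ∈ on L σ) {T : ℕ} (hT : (BadOn L p).card ≤ T) :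
    ∃ (I : Finset ℕ) (n : ℕ → Fin 3 → ℝ), I.card ≤ T + 1 ∧ (∀ r ∈ I, n r ≠ 0) ∧
      (on L σ).card ≤ ((off L σ).filter fun q => ∃ r ∈ I, Zr (lin (n r)) q).card + 18 * (T + 1) + 1 := by
  obtain ⟨hpL, hpσ⟩ := mem_on.1 hp
  obtain ⟨D⟩ := dec hL hpL hT
  have hn : ∀ r, ∃ n, r ∈ D.act → σ ∣ D.F r → n ≠ 0 ∧ D.F r = σ * lin n := by
    intro r
    by_cases hr : r ∈ D.act ∧ σ ∣ D.F r
    · obtain ⟨n, hn⟩ := conic_quot hσ.ne_zero hσd (D.F0 r hr.1) (D.Fh r hr.1) hr.2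
      exact ⟨n, fun _ _ => hn⟩
    · exact ⟨0, fun h1 h2 => absurd ⟨h1, h2⟩ hr⟩
  choose n hn using hn
  set I := D.act.filter fun r => σ ∣ D.F r with hI
  have hIm : ∀ r ∈ I, r ∈ D.act ∧ σ ∣ D.F r := fun r h => by rw [hI, Finset.mem_filter] at h; exact h
  refine ⟨I, n, (Finset.card_filter_le _ _).trans D.hact, fun r hr => (hn r (hIm r hr).1 (hIm r hr).2).1, ?_⟩
  set X := (off L σ).filter fun q => ∃ r ∈ I, Zr (lin (n r)) q with hX
  set Y := (on L σ).filter fun s => s ≠ p ∧ ∃ v s', Tri L v p s s' ∧ s' ∈ X with hY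
  have hYX : Y.card ≤ X.card := by
    have hf : ∀ s, ∃ s', s ∈ Y → (∃ v, Tri L v p s s') ∧ s' ∈ X := by
      intro s
      by_cases h : s ∈ Y
      · have h' := h
        rw [hY, Finset.mem_filter] at h'
        obtain ⟨_, _, v, s', h1, h2⟩ := h'
        exact ⟨s', fun _ => ⟨⟨v, h1⟩, h2⟩⟩
      · exact ⟨0, fun hh => absurd hh h⟩
    choose f hf using hf
    apply Finset.card_le_card_of_injOn f
    · intro s hs
      exact (hf s hs).2
    · intro s hs s1 hs1 he
      obtain ⟨⟨v, hv⟩, _⟩ := hf s hs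
      obtain ⟨⟨w, hw⟩, _⟩ := hf s1 hs1
      rw [← he] at hw
      have : v = w := pt_eq hv.m1.2 hv.m3.2 hw.m1.2 hw.m3.2 hv.pr
      rw [← this] at hw
      rcases (hv.mem s1).1 hw.m2 with h | h | h
      · exact absurd h.symm hw.pq
      · exact h.symm
      · exact absurd h hw.qr
  have hsub : on L σ ⊆ ((D.E.biUnion fun v => (on L σ).filter (fun s => ev s v = 0)) ∪
      ((D.act.filter fun r => ¬ σ ∣ D.F r).biUnion fun r => (on L σ).filter (fun s => Zr (D.F r) s))) ∪ (Y ∪ {p}) := by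
    intro s hs
    have hs' := mem_on.1 hs
    by_cases hne : s = p
    · simp [hne]
    rw [Finset.mem_union, Finset.mem_union, Finset.mem_biUnion, Finset.mem_biUnion]
    rcases D.loc hL hpL hs'.1 hne with ⟨v, hv, h⟩ | ⟨r, hr, i, hi, h⟩
    · exact Or.inl (Or.inl ⟨v, hv, Finset.mem_filter.2 ⟨hs, h⟩⟩)
    · have key : ∃ s', Tri L (D.V r i) p s s' ∧ Zr (D.F r) s ∧ Zr (D.F r) s' := by
        rcases h with rfl | rfl
        · exact ⟨_, D.tri r hr i hi, D.Fa r hr i hi, D.Fb r hr i hi⟩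
        · exact ⟨_, (D.tri r hr i hi).swap, D.Fb r hr i hi, D.Fa r hr i hi⟩
      obtain ⟨s', htri, hz, hz'⟩ := key
      by_cases hd : σ ∣ D.F r
      · right
        rw [Finset.mem_union]; left
        rw [hY, Finset.mem_filter]
        refine ⟨hs, hne, _, s', htri, ?_⟩
        have hs'n : ¬ Zr σ s' := by
          intro h
          have hc := line_count hσ hσd (by norm_num) (vf_ne (D.V r i)) {p, s, s'} (by
            intro x hx
            simp only [Finset.mem_insert, Finset.mem_singleton] at hx
            rcases hx with rfl | rfl | rfl
            · exact hpσ
            · exact hs'.2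
            · exact h) (by
            intro x hx
            simp only [Finset.mem_insert, Finset.mem_singleton] at hx
            rw [Zr_vf]
            exact ((htri.mem x).2 hx).2)
          rw [Finset.card_eq_three.2 ⟨p, s, s', htri.pq, htri.pr, htri.qr, rfl⟩] at hc
          omega
        rw [hX, Finset.mem_filter]
        refine ⟨mem_off.2 ⟨htri.m3.1, hs'n⟩, r, ?_, ?_⟩
        · rw [hI, Finset.mem_filter]; exact ⟨hr, hd⟩
        · rw [(hn r hr hd).2, Zr_mul] at hz'; exact hz'.resolve_left hs'n
      · left; right
        exact ⟨r, Finset.mem_filter.2 ⟨hr, hd⟩, Finset.mem_filter.2 ⟨hs, hz⟩⟩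
  have h1 : (D.E.biUnion fun v => (on L σ).filter (fun s => ev s v = 0)).card ≤ D.E.card * 2 := by
    apply Finset.card_biUnion_le_card_mul
    intro v hv
    apply line_count hσ hσd (by norm_num) (vf_ne v)
    · intro q hq; exact (mem_on.1 (Finset.mem_filter.1 hq).1).2
    · intro q hq; rw [Zr_vf]; exact (Finset.mem_filter.1 hq).2
  have h2 : ((D.act.filter fun r => ¬ σ ∣ D.F r).biUnion fun r => (on L σ).filter (fun s => Zr (D.F r) s)).card
      ≤ (D.act.filter fun r => ¬ σ ∣ D.F r).card * 6 := by
    apply Finset.card_biUnion_le_card_mul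
    intro r hr
    rw [Finset.mem_filter] at hr
    exact bez _ hσ hσd (D.Fh r hr.1) hr.2 (fun s hs => (mem_on.1 (Finset.mem_filter.1 hs).1).2)
        (fun s hs => (Finset.mem_filter.1 hs).2)
  have h2' : (D.act.filter fun r => ¬ σ ∣ D.F r).card ≤ D.act.card := Finset.card_filter_le _ _
  have h3 := (Finset.card_le_card hsub).trans (Finset.card_union_le _ _)
  have h4 := Finset.card_union_le (D.E.biUnion fun v => (on L σ).filter (fun s => ev s v = 0))
    ((D.act.filter fun r => ¬ σ ∣ D.F r).biUnion fun r => (on L σ).filter (fun s => Zr (D.F r) s))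
  have h4' := Finset.card_union_le Y {p}
  rw [Finset.card_singleton] at h4'
  have h5 := D.hE
  have h6 := D.hact
  omega

end FOL

set_option linter.unusedVariables false
namespace FOL

open Finset MvPolynomial

attribute [local instance] Classical.propDecidable

variable {L : Finset (ℝ × ℝ)}

/-- cover by vertex lines from cover by lines -/
lemma cover_vx (hL : Gen L) (h2 : 2 ≤ L.card) {Q : Finset (ℝ × ℝ)} (hQ : Q ⊆ L) {ι : Type*} (I : Finset ι) (n : ι → Fin 3 → ℝ)
    (hn : ∀ r ∈ I, n r ≠ 0) :
    ∃ Λ ⊆ Vx L, Λ.card ≤ I.card + (Q.card - (Q.filter fun q => ∃ r ∈ I, Zr (lin (n r)) q).card) ∧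
      ∀ q ∈ Q, ∃ v ∈ Λ, ev q v = 0 := by
  set X := Q.filter fun q => ∃ r ∈ I, Zr (lin (n r)) q with hX
  have h1 : ∀ r, ∃ v, r ∈ I → v ∈ Vx L ∧ ∀ q ∈ Q, Zr (lin (n r)) q → ev q v = 0 := by
    intro r
    by_cases hr : r ∈ I
    · obtain ⟨v, hv, h⟩ := col_vx hL h2 (hn r hr) (Q := Q.filter fun q => Zr (lin (n r)) q)
        ((Finset.filter_subset _ _).trans hQ) (fun q hq => (Finset.mem_filter.1 hq).2)
      exact ⟨v, fun _ => ⟨hv, fun q hq hz => h q (Finset.mem_filter.2 ⟨hq, hz⟩)⟩⟩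
    · exact ⟨0, fun h => absurd h hr⟩
  choose f hf using h1
  have h3 : ∀ q, ∃ v, q ∈ Q → v ∈ Vx L ∧ ev q v = 0 := by
    intro q
    by_cases hq : q ∈ Q
    · obtain ⟨y, hy, hne⟩ := Finset.exists_mem_ne (by omega : 1 < L.card) q
      obtain ⟨h1, h2, h3⟩ := inter_mem hL (hQ hq) hy hne.symm
      exact ⟨_, fun _ => ⟨h1, h2⟩⟩
    · exact ⟨0, fun h => absurd h hq⟩
  choose g hg using h3
  refine ⟨I.image f ∪ (Q \ X).image g, ?_, ?_, ?_⟩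
  · intro v hv
    rw [Finset.mem_union, Finset.mem_image, Finset.mem_image] at hv
    rcases hv with ⟨r, hr, rfl⟩ | ⟨q, hq, rfl⟩
    · exact (hf r hr).1
    · exact (hg q (Finset.mem_sdiff.1 hq).1).1
  · refine (Finset.card_union_le _ _).trans ?_
    apply Nat.add_le_add Finset.card_image_le
    refine Finset.card_image_le.trans ?_
    rw [Finset.card_sdiff_of_subset (Finset.filter_subset _ _)]
  · intro q hq
    by_cases hx : q ∈ X
    · have hx' := hx
      rw [hX, Finset.mem_filter] at hx'
      obtain ⟨_, r, hr, hz⟩ := hx'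
      exact ⟨f r, Finset.mem_union_left _ (Finset.mem_image_of_mem _ hr), (hf r hr).2 q hq hz⟩
    · exact ⟨g q, Finset.mem_union_right _ (Finset.mem_image_of_mem _ (Finset.mem_sdiff.2 ⟨hq, hx⟩)), (hg q hq).2⟩

theorem conic_case (k : ℕ) (hk : 1 ≤ k) (hL : Gen L) (hN : N2 L ≤ k * L.card) {σ : Pol}
    (hσ : Irreducible σ) (hσd : σ.IsHomogeneous 2) {B s R t : ℕ} (hB : B = 1180 * k) (hs : s = 148 * B + 57)
    (hR : R = 57 * B + 18) (ht : t = s * R + 1)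
    (hm : 2 * (s * t * (s + (2 * s * t) ^ 2)) + 144 * B + 38 < (on L σ).card) :
    ∃ o ∈ Vx L, ((off L σ).filter fun x => ev x o ≠ 0).card ≤ 2 * s * t := by
  have hsum := sum_BadOn k hk hL hN
  rw [← hB] at hsum
  have hoo := on_off (L := L) σ
  set m := (on L σ).card with hmd
  set x := (off L σ).card with hxd
  set n := L.card with hnd
  have hQL : off L σ ⊆ L := Finset.filter_subset _ _
  have hSL : on L σ ⊆ L := Finset.filter_subset _ _
  have hSBs : ∑ q ∈ off L σ, (SB L σ q).card ≤ 18 * (B * n + x) := by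
    calc ∑ q ∈ off L σ, (SB L σ q).card ≤ ∑ q ∈ off L σ, 18 * ((BadOn L q).card + 1) :=
          Finset.sum_le_sum fun q hq => SB_card hL hσ hσd hq
      _ = 18 * (∑ q ∈ off L σ, (BadOn L q).card + x) := by
          rw [← Finset.mul_sum, Finset.sum_add_distrib, Finset.sum_const, smul_eq_mul, mul_one]
      _ ≤ 18 * (B * n + x) := by
          gcongr
          exact (Finset.sum_le_sum_of_subset hQL).trans hsum
  have hxm : x * m ≤ m * m + 18 * (B * n + x) := by
    have h1 : ∑ q ∈ off L σ, m ≤ ∑ q ∈ off L σ, ((on L σ \ SB L σ q).card + (SB L σ q).card) := by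
      apply Finset.sum_le_sum
      intro q hq
      have := Finset.le_card_sdiff (SB L σ q) (on L σ)
      rw [← hmd] at this
      omega
    rw [Finset.sum_const, smul_eq_mul, Finset.sum_add_distrib, ← hxd] at h1
    have h2 := SB_sum (L := L) (σ := σ)
    rw [← hmd] at h2
    omega
  have hs9 : 9 ≤ s := by omega
  have ht1 : 1 ≤ t := by omega
  have hms : 36 * (B + 1) ≤ m := by
    have : 144 * B + 38 ≤ m := by omega
    omega
  have hxle : x ≤ m + 72 * B + 37 := by
    by_contra hc
    push Not at hc
    rw [← hoo] at hxm
    zify at *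
    nlinarith [mul_nonneg (sub_nonneg.2 hms) (sub_nonneg.2 hc.le)]
  have hp : ∃ p ∈ on L σ, (BadOn L p).card ≤ 4 * B := by
    by_contra hc
    push Not at hc
    have h1 : ∑ p ∈ on L σ, (4 * B + 1) ≤ ∑ p ∈ on L σ, (BadOn L p).card := Finset.sum_le_sum fun p hp => hc p hp
    have h2 : ∑ p ∈ on L σ, (BadOn L p).card ≤ _ := Finset.sum_le_sum_of_subset hSL
    rw [Finset.sum_const, smul_eq_mul, ← hmd] at h1
    have h3 : n ≤ 4 * m := by omega
    have h4 : B * n ≤ B * (4 * m) := Nat.mul_le_mul_left _ h3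
    have h5 : m * (4 * B + 1) = B * (4 * m) + m := by ring
    omega
  obtain ⟨p, hp, hpT⟩ := hp
  obtain ⟨I, nn, hI, hn0, hcov⟩ := conic_cover hL hσ hσd hp hpT
  obtain ⟨Λ, hΛ, hΛc, hΛcov⟩ := cover_vx hL (by omega) hQL I nn hn0
  set y := ((off L σ).filter fun q => ∃ r ∈ I, Zr (lin (nn r)) q).card with hy
  rw [← hmd] at hcov
  rw [← hxd] at hΛc
  have hyx : y ≤ x := Finset.card_filter_le _ _
  have hMx : N2 L + ∑ α ∈ off L σ, (Mx L (off L σ) α).card ≤ R * x := by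
    have h1 : ∑ α ∈ off L σ, (Mx L (off L σ) α).card ≤ 18 * (B * n + x) :=
      (Finset.sum_le_sum fun α hα => Mx_le hL hα).trans hSBs
    have h2 : n ≤ 3 * x := by omega
    have h3 : N2 L ≤ B * n := hN.trans (Nat.mul_le_mul_right _ (by omega))
    have h4 : B * n ≤ B * (3 * x) := Nat.mul_le_mul_left _ h2
    have h5 : R * x = 19 * (B * (3 * x)) + 18 * x := by rw [hR]; ring
    omega
  have := lines_cor hL hQL hΛ (s := s) (by omega) (by omega) hΛcov hMx (by
    rw [← ht]; omega)
  rw [← ht] at this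
  exact this

end FOL

set_option linter.unusedVariables false
namespace FOL

open Finset MvPolynomial

attribute [local instance] Classical.propDecidable

variable {L : Finset (ℝ × ℝ)}

/-- polynomially bounded functions -/
def PB (f : ℕ → ℕ) : Prop := ∃ c e : ℕ, ∀ k, 1 ≤ k → f k ≤ c * k ^ e

lemma PB.const (a : ℕ) : PB fun _ => a := ⟨a, 0, fun k _ => by simp⟩

lemma PB.id : PB fun k => k := ⟨1, 1, fun k _ => by simp⟩

lemma PB.add {f g : ℕ → ℕ} (hf : PB f) (hg : PB g) : PB fun k => f k + g k := by
  obtain ⟨c, e, h⟩ := hf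
  obtain ⟨c', e', h'⟩ := hg
  refine ⟨c + c', e + e', fun k hk => ?_⟩
  have h1 : k ^ e ≤ k ^ (e + e') := Nat.pow_le_pow_right hk (by omega)
  have h2 : k ^ e' ≤ k ^ (e + e') := Nat.pow_le_pow_right hk (by omega)
  calc f k + g k ≤ c * k ^ e + c' * k ^ e' := Nat.add_le_add (h k hk) (h' k hk)
    _ ≤ c * k ^ (e + e') + c' * k ^ (e + e') := by gcongr
    _ = _ := by ring

lemma PB.mul {f g : ℕ → ℕ} (hf : PB f) (hg : PB g) : PB fun k => f k * g k := by
  obtain ⟨c, e, h⟩ := hf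
  obtain ⟨c', e', h'⟩ := hg
  refine ⟨c * c', e + e', fun k hk => ?_⟩
  calc f k * g k ≤ (c * k ^ e) * (c' * k ^ e') := Nat.mul_le_mul (h k hk) (h' k hk)
    _ = _ := by ring

lemma PB.sq {f : ℕ → ℕ} (hf : PB f) : PB fun k => f k ^ 2 := by
  simpa only [pow_two] using hf.mul hf

def fB (k : ℕ) : ℕ := 1180 * k
def fs (k : ℕ) : ℕ := 148 * fB k + 57
def fR (k : ℕ) : ℕ := 57 * fB k + 18
def ft (k : ℕ) : ℕ := fs k * fR k + 1
def fM (k : ℕ) : ℕ := 2 * (fs k * ft k * (fs k + (2 * fs k * ft k) ^ 2)) + 144 * fB k + 39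
def fS (k : ℕ) : ℕ := 9 * (fB k + 1) + (1 + (fB k + 1) * (3 * (fM k + (54 * fB k + 54))))
def fN (k : ℕ) : ℕ := fS k * (fS k * k + 1) * (fS k + (2 * fS k * (fS k * k + 1)) ^ 2)
def fPhi (k : ℕ) : ℕ := 54 * fB k + 2 * fs k * ft k + (fN k + 2) + 2 * fS k * (fS k * k + 1)

lemma PB_fB : PB fB := (PB.const _).mul PB.id
lemma PB_fs : PB fs := ((PB.const _).mul PB_fB).add (PB.const _)
lemma PB_fR : PB fR := ((PB.const _).mul PB_fB).add (PB.const _)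
lemma PB_ft : PB ft := (PB_fs.mul PB_fR).add (PB.const _)
lemma PB_fM : PB fM :=
  (((PB.const _).mul ((PB_fs.mul PB_ft).mul (PB_fs.add (((PB.const _).mul PB_fs).mul PB_ft).sq))).add
    ((PB.const _).mul PB_fB)).add (PB.const _)
lemma PB_fS : PB fS :=
  ((PB.const _).mul (PB_fB.add (PB.const _))).add ((PB.const _).add ((PB_fB.add (PB.const _)).mul
    ((PB.const _).mul (PB_fM.add (((PB.const _).mul PB_fB).add (PB.const _))))))
lemma PB_fT : PB fun k => fS k * k + 1 := (PB_fS.mul PB.id).add (PB.const _)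
lemma PB_fN : PB fN :=
  (PB_fS.mul PB_fT).mul (PB_fS.add (((PB.const _).mul PB_fS).mul PB_fT).sq)
lemma PB_fPhi : PB fPhi :=
  ((((PB.const _).mul PB_fB).add (((PB.const _).mul PB_fs).mul PB_ft)).add (PB_fN.add (PB.const _))).add
    (((PB.const _).mul PB_fS).mul PB_fT)

theorem affine_main (k : ℕ) (hk : 1 ≤ k) (hL : Gen L) (hN : N2 L ≤ k * L.card) :
    L.card ≤ fPhi k ∨
    (∃ G : Pol, Irreducible G ∧ G.IsHomogeneous 3 ∧ (off L G).card ≤ fPhi k) ∨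
    (∃ σ : Pol, Irreducible σ ∧ σ.IsHomogeneous 2 ∧ ∃ o, ((off L σ).filter fun x => ev x o ≠ 0).card ≤ fPhi k) ∨
    (∃ o, (L.filter fun x => ev x o ≠ 0).card ≤ fPhi k) := by
  by_cases h0 : L.card ≤ fPhi k
  · exact Or.inl h0
  right
  have hPhi : fPhi k = 54 * fB k + 2 * fs k * ft k + (fN k + 2) + 2 * fS k * (fS k * k + 1) := rfl
  push Not at h0
  by_cases h3 : ∃ G : Pol, Irreducible G ∧ G.IsHomogeneous 3 ∧ 54 * fB k + 54 ≤ (on L G).card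
  · obtain ⟨G, h1, h2, h3⟩ := h3
    left
    refine ⟨G, h1, h2, (cubic_case k hk hL hN h1 h2 h3).trans ?_⟩
    rw [hPhi]
    have : 1180 * k = fB k := rfl
    omega
  right
  by_cases h2 : ∃ σ : Pol, Irreducible σ ∧ σ.IsHomogeneous 2 ∧ fM k ≤ (on L σ).card
  · obtain ⟨σ, h1, h2, h3⟩ := h2
    left
    obtain ⟨o, _, ho⟩ := conic_case k hk hL hN h1 h2 (B := fB k) (s := fs k) (R := fR k) (t := ft k) rfl rfl rfl rfl
      (lt_of_lt_of_le (by unfold fM; omega) h3)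
    refine ⟨σ, h1, h2, o, ho.trans ?_⟩
    rw [hPhi]; omega
  right
  push Not at h2 h3
  have hsum := sum_BadOn k hk hL hN
  have hp : ∃ p ∈ L, (BadOn L p).card ≤ fB k := by
    by_contra hc
    push Not at hc
    have h1 : ∑ p ∈ L, (fB k + 1) ≤ ∑ p ∈ L, (BadOn L p).card := Finset.sum_le_sum fun p hp => hc p hp
    rw [Finset.sum_const, smul_eq_mul] at h1
    have h4 : L.card * (fB k + 1) = 1180 * k * L.card + L.card := by rw [fB]; ring
    omega
  obtain ⟨p, hpL, hpT⟩ := hp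
  obtain ⟨D⟩ := dec hL hpL hpT
  have hl : ∀ r, ∃ l : List Pol, r ∈ D.act → l.length ≤ 3 ∧ (∀ f ∈ l, Irreducible f ∧ ∃ d, 1 ≤ d ∧ d ≤ 3 ∧ f.IsHomogeneous d) ∧
      ∀ q, Zr (D.F r) q → ∃ f ∈ l, Zr f q := by
    intro r
    by_cases hr : r ∈ D.act
    · obtain ⟨l, h1, h2, h3⟩ := factor_cover 3 (D.F r) (D.F0 r hr) (D.Fh r hr)
      refine ⟨l, fun _ => ⟨h1, fun f hf => ⟨(h2 f hf).1, ?_⟩, fun q hq => h3 _ hq⟩⟩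
      obtain ⟨_, _, d, h⟩ := h2 f hf
      exact ⟨d, by tauto⟩
    · exact ⟨[], fun h => absurd h hr⟩
  choose l hl using hl
  have hnf : ∀ f : Pol, ∃ n, f.IsHomogeneous 1 → f = lin n := by
    intro f
    by_cases h : f.IsHomogeneous 1
    · obtain ⟨n, hn⟩ := hom1_eq_lin h
      exact ⟨n, fun _ => hn⟩
    · exact ⟨0, fun hh => absurd hh h⟩
  choose nf hnf using hnf
  set I := D.E.image vf ∪ D.act.biUnion fun r => ((l r).toFinset.filter fun f => f.IsHomogeneous 1).image nf with hI
  have hI0 : ∀ n ∈ I, n ≠ 0 := by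
    intro n hn
    rw [hI, Finset.mem_union, Finset.mem_image, Finset.mem_biUnion] at hn
    rcases hn with ⟨v, _, rfl⟩ | ⟨r, hr, hn⟩
    · exact vf_ne v
    · rw [Finset.mem_image] at hn
      obtain ⟨f, hf, rfl⟩ := hn
      rw [Finset.mem_filter, List.mem_toFinset] at hf
      intro h0
      have h1 := hnf f hf.2
      rw [h0] at h1
      apply ((hl r hr).2.1 f hf.1).1.ne_zero
      rw [h1]; simp [lin]
  have hlc : ∀ r ∈ D.act, (l r).toFinset.card ≤ 3 := fun r hr => (List.toFinset_card_le _).trans (hl r hr).1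
  have hIc : I.card ≤ 9 * (fB k + 1) := by
    have h1 : (D.E.image vf).card ≤ D.E.card := Finset.card_image_le
    have h2 : (D.act.biUnion fun r => ((l r).toFinset.filter fun f => f.IsHomogeneous 1).image nf).card ≤ D.act.card * 3 := by
      apply Finset.card_biUnion_le_card_mul
      intro r hr
      exact Finset.card_image_le.trans ((Finset.card_filter_le _ _).trans (hlc r hr))
    have h3 := Finset.card_union_le (D.E.image vf)
      (D.act.biUnion fun r => ((l r).toFinset.filter fun f => f.IsHomogeneous 1).image nf)
    rw [← hI] at h3
    have := D.hE
    have := D.hact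
    omega
  obtain ⟨Λ, hΛ, hΛc, hΛcov⟩ := cover_vx hL (by omega) (Finset.Subset.refl L) I (fun n => n) hI0
  have hrest : L.card - (L.filter fun q => ∃ r ∈ I, Zr (lin r) q).card ≤
      1 + (fB k + 1) * (3 * (fM k + (54 * fB k + 54))) := by
    rw [← Finset.card_sdiff_of_subset (Finset.filter_subset _ _)]
    have hsub : L \ (L.filter fun q => ∃ r ∈ I, Zr (lin r) q) ⊆ {p} ∪ D.act.biUnion fun r =>
        ((l r).toFinset.filter fun f => ¬ f.IsHomogeneous 1).biUnion fun f => on L f := by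
      intro q hq
      rw [Finset.mem_sdiff, Finset.mem_filter, not_and] at hq
      obtain ⟨hqL, hq⟩ := hq
      have hq := hq hqL
      rw [Finset.mem_union, Finset.mem_singleton]
      by_cases hqp : q = p
      · exact Or.inl hqp
      right
      rcases D.loc' hL hpL hqL hqp with ⟨v, hv, h⟩ | ⟨r, hr, h⟩
      · exfalso; apply hq
        refine ⟨vf v, ?_, Zr_vf.2 h⟩
        rw [hI]; exact Finset.mem_union_left _ (Finset.mem_image_of_mem _ hv)
      · obtain ⟨f, hf, hfq⟩ := (hl r hr).2.2 q h
        rw [Finset.mem_biUnion]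
        refine ⟨r, hr, ?_⟩
        rw [Finset.mem_biUnion]
        refine ⟨f, ?_, mem_on.2 ⟨hqL, hfq⟩⟩
        rw [Finset.mem_filter, List.mem_toFinset]
        refine ⟨hf, fun h1 => hq ⟨nf f, ?_, ?_⟩⟩
        · rw [hI]; apply Finset.mem_union_right
          rw [Finset.mem_biUnion]
          refine ⟨r, hr, Finset.mem_image_of_mem _ ?_⟩
          rw [Finset.mem_filter, List.mem_toFinset]; exact ⟨hf, h1⟩
        · rw [← hnf f h1]; exact hfq
    refine (Finset.card_le_card hsub).trans ((Finset.card_union_le _ _).trans ?_)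
    rw [Finset.card_singleton]
    apply Nat.add_le_add_left
    refine (Finset.card_biUnion_le_card_mul _ _ (3 * (fM k + (54 * fB k + 54))) ?_).trans
      (Nat.mul_le_mul_right _ D.hact)
    intro r hr
    refine (Finset.card_biUnion_le_card_mul _ _ (fM k + (54 * fB k + 54)) ?_).trans
      (Nat.mul_le_mul_right _ ((Finset.card_filter_le _ _).trans (hlc r hr)))
    intro f hf
    rw [Finset.mem_filter, List.mem_toFinset] at hf
    obtain ⟨hirr, d, hd1, hd3, hd⟩ := (hl r hr).2.1 f hf.1
    have : d = 2 ∨ d = 3 := by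
      have : d ≠ 1 := by rintro rfl; exact hf.2 hd
      omega
    rcases this with rfl | rfl
    · have := h2 f hirr hd; omega
    · have := h3 f hirr hd; omega
  have hMx : N2 L + ∑ α ∈ L, (Mx L L α).card ≤ k * L.card := by
    have : ∑ α ∈ L, (Mx L L α).card = 0 := by
      apply Finset.sum_eq_zero
      intro α hα
      rw [Finset.card_eq_zero, Mx, Finset.filter_eq_empty_iff]
      rintro v _ ⟨_, _, y, h1, h2, _⟩
      exact h2 h1
    omega
  obtain ⟨o, _, ho⟩ := lines_cor hL (Finset.Subset.refl L) hΛ (s := fS k) (by unfold fS; omega) (by unfold fS; omega)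
    hΛcov hMx (by
      have : fN k = fS k * (fS k * k + 1) * (fS k + (2 * fS k * (fS k * k + 1)) ^ 2) := rfl
      omega)
  exact ⟨o, ho.trans (by rw [hPhi]; omega)⟩

end FOL

set_option linter.unusedVariables false
namespace FOL

open Finset MvPolynomial

attribute [local instance] Classical.propDecidable

lemma moment_avoid (S : Set (Fin 3 → ℝ)) (hS : S.Finite) (hS0 : ∀ u ∈ S, u ≠ 0) (T : Set ℝ) (hT : T.Finite) :
    ∃ t, t ∉ T ∧ ∀ u ∈ S, u 0 + u 1 * t + u 2 * t ^ 2 ≠ 0 := by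
  have hb : ∀ u ∈ S, {t : ℝ | u 0 + u 1 * t + u 2 * t ^ 2 = 0}.Finite := by
    intro u hu
    set p : Polynomial ℝ := Polynomial.C (u 2) * Polynomial.X ^ 2 + Polynomial.C (u 1) * Polynomial.X + Polynomial.C (u 0) with hp
    have hp0 : p ≠ 0 := by
      intro h
      apply hS0 u hu
      have h2 : p.coeff 2 = u 2 := by simp [hp, Polynomial.coeff_X, Polynomial.coeff_C]
      have h1 : p.coeff 1 = u 1 := by simp [hp, Polynomial.coeff_X, Polynomial.coeff_C]
      have h0 : p.coeff 0 = u 0 := by simp [hp]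
      rw [h] at h0 h1 h2
      ext i
      fin_cases i
      · simpa using h0.symm
      · simpa using h1.symm
      · simpa using h2.symm
    refine (Polynomial.finite_setOfPred_isRoot hp0).subset ?_
    intro t ht
    simp only [Set.mem_ofPred_eq, Polynomial.IsRoot] at *
    simp [hp]; linarith
  have hfin : (T ∪ ⋃ u ∈ S, {t : ℝ | u 0 + u 1 * t + u 2 * t ^ 2 = 0}).Finite :=
    hT.union (hS.biUnion hb)
  obtain ⟨t, ht⟩ := hfin.exists_notMem
  rw [Set.mem_union, not_or] at ht
  refine ⟨t, ht.1, fun u hu h => ht.2 ?_⟩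
  rw [Set.mem_iUnion₂]
  exact ⟨u, hu, h⟩

lemma span_rank {x y : RP2} (h : x ≠ y) : LinearIndependent ℝ ![x.rep, y.rep] := by
  have := (Projectivization.independent_pair_iff_ne x y).2 h
  rw [Projectivization.independent_iff] at this
  have e : ![x.rep, y.rep] = Projectivization.rep ∘ ![x, y] := by
    funext i
    fin_cases i <;> rfl
  rw [e]; exact this

lemma span_finrank {x y : RP2} (h : x ≠ y) : Module.finrank ℝ (Submodule.span ℝ {x.rep, y.rep}) = 2 := by
  have := finrank_span_eq_card (span_rank h)
  have e : Set.range ![x.rep, y.rep] = {x.rep, y.rep} := by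
    rw [Matrix.range_cons, Matrix.range_cons, Matrix.range_empty, Set.union_empty]; rfl
  rw [e] at this
  rw [this]; simp

lemma inf_line {W1 W2 : Submodule ℝ (Fin 3 → ℝ)} (h1 : Module.finrank ℝ W1 = 2) (h2 : Module.finrank ℝ W2 = 2)
    (hne : W1 ≠ W2) : ∃ u0 : Fin 3 → ℝ, ∀ u ∈ W1, u ∈ W2 → ∃ c : ℝ, u = c • u0 := by
  have h : Module.finrank ℝ (W1 ⊓ W2 : Submodule ℝ (Fin 3 → ℝ)) ≤ 1 := by
    by_contra hc
    push Not at hc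
    have e1 : W1 ⊓ W2 = W1 := Submodule.eq_of_le_of_finrank_le inf_le_left (by omega)
    have e2 : W1 ⊓ W2 = W2 := Submodule.eq_of_le_of_finrank_le inf_le_right (by omega)
    exact hne (e1.symm.trans e2)
  rw [finrank_le_one_iff] at h
  obtain ⟨v, hv⟩ := h
  refine ⟨v, fun u hu1 hu2 => ?_⟩
  obtain ⟨c, hc⟩ := hv ⟨u, hu1, hu2⟩
  exact ⟨c, by have := congrArg Subtype.val hc; simpa using this.symm⟩

lemma exists_chart (P : Finset RP2) : ∃ g : (Fin 3 → ℝ) ≃ₗ[ℝ] (Fin 3 → ℝ),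
    (∀ x ∈ P, g x.rep 0 ≠ 0) ∧
    (∀ x ∈ P, ∀ y ∈ P, x ≠ y → g x.rep 1 * g y.rep 0 - g y.rep 1 * g x.rep 0 ≠ 0) ∧
    (∀ x ∈ P, ∀ y ∈ P, ∀ z ∈ P, ∀ w ∈ P, x ≠ y → z ≠ w →
      Submodule.span ℝ {x.rep, y.rep} ≠ Submodule.span ℝ {z.rep, w.rep} →
      ∀ u ∈ Submodule.span ℝ {x.rep, y.rep}, u ∈ Submodule.span ℝ {z.rep, w.rep} → g u 0 = 0 → u = 0) := by
  have hu : ∀ a : (RP2 × RP2) × (RP2 × RP2), ∃ u0 : Fin 3 → ℝ, a.1.1 ≠ a.1.2 → a.2.1 ≠ a.2.2 →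
      Submodule.span ℝ {a.1.1.rep, a.1.2.rep} ≠ Submodule.span ℝ {a.2.1.rep, a.2.2.rep} →
      ∀ u ∈ Submodule.span ℝ {a.1.1.rep, a.1.2.rep}, u ∈ Submodule.span ℝ {a.2.1.rep, a.2.2.rep} → ∃ c : ℝ, u = c • u0 := by
    rintro ⟨⟨x, y⟩, ⟨z, w⟩⟩
    by_cases h : x ≠ y ∧ z ≠ w ∧ Submodule.span ℝ {x.rep, y.rep} ≠ Submodule.span ℝ {z.rep, w.rep}
    · obtain ⟨u0, hu0⟩ := inf_line (span_finrank h.1) (span_finrank h.2.1) h.2.2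
      exact ⟨u0, fun _ _ _ => hu0⟩
    · exact ⟨0, fun h1 h2 h3 => absurd ⟨h1, h2, h3⟩ h⟩
  choose U hU using hu
  set S1 : Finset (Fin 3 → ℝ) := ((P.image fun x => x.rep) ∪ ((P ×ˢ P) ×ˢ (P ×ˢ P)).image U).filter fun u => u ≠ 0 with hS1
  obtain ⟨t1, _, h1⟩ := moment_avoid S1 S1.finite_toSet (fun u hu => by
    rw [Finset.mem_coe, hS1, Finset.mem_filter] at hu; exact hu.2) ∅ Set.finite_empty
  set A : (Fin 3 → ℝ) → ℝ := fun u => u 0 + u 1 * t1 + u 2 * t1 ^ 2 with hA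
  have hA1 : ∀ x ∈ P, A x.rep ≠ 0 := by
    intro x hx
    apply h1
    rw [Finset.mem_coe, hS1, Finset.mem_filter]
    exact ⟨Finset.mem_union_left _ (Finset.mem_image_of_mem _ hx), x.rep_nonzero⟩
  set S2 : Finset (Fin 3 → ℝ) := ((P ×ˢ P).image fun a => A a.2.rep • a.1.rep - A a.1.rep • a.2.rep).filter fun u => u ≠ 0 with hS2
  obtain ⟨t2, ht2, h2⟩ := moment_avoid S2 S2.finite_toSet (fun u hu => by
    rw [Finset.mem_coe, hS2, Finset.mem_filter] at hu; exact hu.2) {t1} (Set.finite_singleton _)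
  obtain ⟨t3, ht3, _⟩ := moment_avoid ∅ Set.finite_empty (fun u hu => absurd hu (Set.notMem_empty u)) {t1, t2} (Set.toFinite _)
  simp only [Set.mem_insert_iff, Set.mem_singleton_iff, not_or] at ht2 ht3
  set t : Fin 3 → ℝ := ![t1, t2, t3] with ht
  have hdet : (Matrix.vandermonde t).det ≠ 0 := by
    rw [Matrix.det_vandermonde_ne_zero_iff]
    intro i j hij
    fin_cases i <;> fin_cases j <;> simp [ht] at hij ⊢ <;> first
      | exact absurd hij ht2 | exact absurd hij.symm ht2 | exact absurd hij ht3.1 | exact absurd hij.symm ht3.1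
      | exact absurd hij ht3.2 | exact absurd hij.symm ht3.2
  set g := (Matrix.vandermonde t).toLinearEquiv' (Matrix.invertibleOfIsUnitDet _ (isUnit_iff_ne_zero.2 hdet)) with hg
  have hg' : ∀ u i, g u i = u 0 + u 1 * t i + u 2 * t i ^ 2 := by
    intro u i
    have : g u = (Matrix.vandermonde t).mulVec u := rfl
    rw [this, Matrix.mulVec, dotProduct, Fin.sum_univ_three]
    simp [Matrix.vandermonde_apply]
    ring
  have hg0 : ∀ u, g u 0 = A u := fun u => by rw [hg']; simp [hA, ht]
  have hg1 : ∀ u, g u 1 = u 0 + u 1 * t2 + u 2 * t2 ^ 2 := fun u => by rw [hg']; simp [ht]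
  refine ⟨g, fun x hx => ?_, fun x hx y hy hne => ?_, ?_⟩
  · rw [hg0]; exact hA1 x hx
  · have h0 : A y.rep • x.rep - A x.rep • y.rep ≠ 0 := by
      intro h
      have := LinearIndependent.pair_iff.1 (span_rank hne) (A y.rep) (-A x.rep) (by rw [neg_smul, ← sub_eq_add_neg]; exact h)
      exact hA1 y hy this.1
    have := h2 (A y.rep • x.rep - A x.rep • y.rep) (by
      rw [Finset.mem_coe, hS2, Finset.mem_filter]
      exact ⟨Finset.mem_image.2 ⟨(x, y), Finset.mem_product.2 ⟨hx, hy⟩, rfl⟩, h0⟩)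
    rw [← hg1, map_sub, map_smul, map_smul] at this
    simp only [Pi.sub_apply, Pi.smul_apply, smul_eq_mul] at this
    rw [hg0, hg0]
    intro h; apply this; linarith
  · intro x hx y hy z hz w hw hxy hzw hne u hu1 hu2 h0
    obtain ⟨c, hc⟩ := hU ((x, y), (z, w)) hxy hzw hne u hu1 hu2
    by_contra hun
    have hc0 : c ≠ 0 := by rintro rfl; exact hun (by rw [hc, zero_smul])
    have hU0 : U ((x, y), (z, w)) ≠ 0 := by intro h; exact hun (by rw [hc, h, smul_zero])
    have := h1 (U ((x, y), (z, w))) (by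
      rw [Finset.mem_coe, hS1, Finset.mem_filter]
      refine ⟨Finset.mem_union_right _ (Finset.mem_image_of_mem _ ?_), hU0⟩
      simp [hx, hy, hz, hw])
    rw [hc, map_smul] at h0
    simp only [Pi.smul_apply, smul_eq_mul] at h0
    rw [hg0] at h0
    exact this ((mul_eq_zero.1 h0).resolve_left hc0)

end FOL

set_option linter.unusedVariables false
namespace FOL

open Finset MvPolynomial

attribute [local instance] Classical.propDecidable

/-- affine chart -/
noncomputable def ph (g : (Fin 3 → ℝ) ≃ₗ[ℝ] (Fin 3 → ℝ)) (x : RP2) : ℝ × ℝ :=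
  (g x.rep 1 / g x.rep 0, g x.rep 2 / g x.rep 0)

lemma g_rep {g : (Fin 3 → ℝ) ≃ₗ[ℝ] (Fin 3 → ℝ)} {x : RP2} (h : g x.rep 0 ≠ 0) :
    g x.rep = (g x.rep 0) • uu (ph g x) := by
  funext i
  fin_cases i
  · simp [uu]
  · simp [uu, ph]; field_simp
  · simp [uu, ph]; field_simp

/-- pull back of polynomials -/
noncomputable def pull (g : (Fin 3 → ℝ) ≃ₗ[ℝ] (Fin 3 → ℝ)) : Pol →ₐ[ℝ] Pol :=
  aeval fun i => lin fun j => g (Pi.single j 1) i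

lemma eval_pull (g : (Fin 3 → ℝ) ≃ₗ[ℝ] (Fin 3 → ℝ)) (F : Pol) (x : Fin 3 → ℝ) :
    eval x (pull g F) = eval (g x) F := by
  have h : (fun i => eval x (lin fun j => g (Pi.single j 1) i)) = g x := by
    funext i
    rw [eval_lin]
    have := LinearMap.pi_apply_eq_sum_univ (g : (Fin 3 → ℝ) →ₗ[ℝ] (Fin 3 → ℝ)) x
    have h2 := congrFun this i
    rw [Fin.sum_univ_three] at h2
    simp only [LinearEquiv.coe_coe, Pi.add_apply, Pi.smul_apply, smul_eq_mul] at h2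
    rw [h2]
    have e : ∀ j : Fin 3, (fun k => if j = k then (1:ℝ) else 0) = Pi.single j 1 := by
      intro j; funext k; simp [Pi.single_apply, eq_comm]
    simp only [e]
    ring
  have ae : ∀ (y : Fin 3 → ℝ) (p : Pol), (aeval y : Pol →ₐ[ℝ] ℝ) p = eval y p := fun y p => by
    rw [← coe_aeval_eq_eval]; rfl
  have h3 : (aeval x : Pol →ₐ[ℝ] ℝ).comp (pull g) = aeval (g x) := by
    apply MvPolynomial.algHom_ext
    intro i
    have := congrFun h i
    simp only [AlgHom.comp_apply, pull, aeval_X]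
    rw [← this, ae]
  have h4 := AlgHom.congr_fun h3 F
  rw [AlgHom.comp_apply, ae, ae] at h4
  exact h4

lemma eval_scale {F : Pol} {d : ℕ} (h : F.IsHomogeneous d) (c : ℝ) (y : Fin 3 → ℝ) :
    eval (c • y) F = c ^ d * eval y F := by
  rw [eval_eq', eval_eq', Finset.mul_sum]
  apply Finset.sum_congr rfl
  intro e he
  have hd : e.degree = d := by
    by_contra hc
    exact (mem_support_iff.1 he) (h.coeff_eq_zero hc)
  rw [Finsupp.degree_eq_sum] at hd
  have : ∏ i, (c • y) i ^ e i = c ^ d * ∏ i, y i ^ e i := by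
    simp only [Pi.smul_apply, smul_eq_mul, mul_pow]
    rw [Finset.prod_mul_distrib, Finset.prod_pow_eq_pow_sum, hd]
  rw [this]; ring

lemma pull_hom (g : (Fin 3 → ℝ) ≃ₗ[ℝ] (Fin 3 → ℝ)) {F : Pol} {d : ℕ} (h : F.IsHomogeneous d) :
    (pull g F).IsHomogeneous d := by
  have := h.aeval (fun i => lin fun j => g (Pi.single j 1) i) (n := 1) (fun i => lin_hom _)
  rw [one_mul] at this
  exact this

noncomputable def pullE (g : (Fin 3 → ℝ) ≃ₗ[ℝ] (Fin 3 → ℝ)) : Pol ≃ₐ[ℝ] Pol :=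
  AlgEquiv.ofAlgHom (pull g) (pull g.symm)
    (by
      apply AlgHom.ext; intro p
      apply MvPolynomial.funext; intro x
      simp [eval_pull])
    (by
      apply AlgHom.ext; intro p
      apply MvPolynomial.funext; intro x
      simp [eval_pull])

lemma pull_irr (g : (Fin 3 → ℝ) ≃ₗ[ℝ] (Fin 3 → ℝ)) {F : Pol} (h : Irreducible F) : Irreducible (pull g F) :=
  (MulEquiv.irreducible_iff (pullE g)).2 h

lemma pull_zero {g : (Fin 3 → ℝ) ≃ₗ[ℝ] (Fin 3 → ℝ)} {F : Pol} {d : ℕ} (h : F.IsHomogeneous d) {x : RP2}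
    (hx : g x.rep 0 ≠ 0) : eval x.rep (pull g F) = 0 ↔ Zr F (ph g x) := by
  rw [eval_pull, g_rep hx, Zr, eval_scale h, mul_eq_zero]
  constructor
  · rintro (h | h)
    · exact absurd h (pow_ne_zero _ hx)
    · exact h
  · exact Or.inr

/-- the functional of a vertex -/
noncomputable def lf (g : (Fin 3 → ℝ) ≃ₗ[ℝ] (Fin 3 → ℝ)) (v : ℝ × ℝ) : (Fin 3 → ℝ) →ₗ[ℝ] ℝ :=
  (v.2 • LinearMap.proj 0 - v.1 • LinearMap.proj 1 - LinearMap.proj 2 : (Fin 3 → ℝ) →ₗ[ℝ] ℝ) ∘ₗ g.toLinearMap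

lemma lf_apply (g : (Fin 3 → ℝ) ≃ₗ[ℝ] (Fin 3 → ℝ)) (v : ℝ × ℝ) (u : Fin 3 → ℝ) :
    lf g v u = v.2 * g u 0 - v.1 * g u 1 - g u 2 := by
  simp [lf]

lemma lf_ne (g : (Fin 3 → ℝ) ≃ₗ[ℝ] (Fin 3 → ℝ)) (v : ℝ × ℝ) : lf g v ≠ 0 := by
  intro h
  have := LinearMap.congr_fun h (g.symm ![0, 0, 1])
  rw [lf_apply] at this
  simp at this

/-- the projective line of a vertex -/
def pl (g : (Fin 3 → ℝ) ≃ₗ[ℝ] (Fin 3 → ℝ)) (v : ℝ × ℝ) : Set RP2 :=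
  {x : RP2 | x.submodule ≤ LinearMap.ker (lf g v)}

lemma pl_line (g : (Fin 3 → ℝ) ≃ₗ[ℝ] (Fin 3 → ℝ)) (v : ℝ × ℝ) : IsProjLine (pl g v) := by
  refine ⟨LinearMap.ker (lf g v), ?_, rfl⟩
  have := Module.Dual.finrank_ker_add_one_of_ne_zero (lf_ne g v)
  simp at this
  omega

lemma mem_pl {g : (Fin 3 → ℝ) ≃ₗ[ℝ] (Fin 3 → ℝ)} {v : ℝ × ℝ} {x : RP2} (hx : g x.rep 0 ≠ 0) :
    x ∈ pl g v ↔ ev (ph g x) v = 0 := by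
  have : x ∈ pl g v ↔ lf g v x.rep = 0 := by
    simp only [pl, Set.mem_ofPred_eq]
    rw [Projectivization.submodule_eq, Submodule.span_singleton_le_iff_mem, LinearMap.mem_ker]
  rw [this, lf_apply, ev, ph]
  simp only
  have e : v.2 - g x.rep 1 / g x.rep 0 * v.1 - g x.rep 2 / g x.rep 0 =
    (v.2 * g x.rep 0 - v.1 * g x.rep 1 - g x.rep 2) / g x.rep 0 := by field_simp
  rw [e, div_eq_zero_iff]
  tauto

lemma ord_finite {P : Set RP2} (hP : P.Finite) : {L : Set RP2 | IsProjLine L ∧ (P ∩ L).ncard = 2}.Finite := by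
  apply Set.Finite.of_finite_image (f := fun L => P ∩ L)
  · apply hP.finite_subsets.subset
    rintro _ ⟨L, _, rfl⟩
    exact Set.inter_subset_left
  · rintro L1 ⟨⟨W1, hW1, rfl⟩, h1⟩ L2 ⟨⟨W2, hW2, rfl⟩, h2⟩ he
    simp only at he
    obtain ⟨x, y, hxy, h⟩ := Set.ncard_eq_two.1 h1
    have key : ∀ W : Submodule ℝ (Fin 3 → ℝ), Module.finrank ℝ W = 2 → P ∩ {x : RP2 | x.submodule ≤ W} = {x, y} →
        Submodule.span ℝ {x.rep, y.rep} = W := by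
      intro W hW hh
      have hx : x ∈ P ∩ {x : RP2 | x.submodule ≤ W} := by rw [hh]; simp
      have hy : y ∈ P ∩ {x : RP2 | x.submodule ≤ W} := by rw [hh]; simp
      have hx2 := hx.2
      have hy2 := hy.2
      simp only [Set.mem_ofPred_eq] at hx2 hy2
      rw [Projectivization.submodule_eq, Submodule.span_singleton_le_iff_mem] at hx2 hy2
      apply Submodule.eq_of_le_of_finrank_le
      · rw [Submodule.span_le]
        intro z hz
        rcases hz with rfl | rfl
        · exact hx2
        · exact hy2
      · rw [span_finrank hxy, hW]
    have e1 := key W1 hW1 h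
    have e2 := key W2 hW2 (he ▸ h)
    rw [← e1, ← e2]

end FOL

set_option linter.unusedVariables false
namespace FOL

open Finset MvPolynomial

attribute [local instance] Classical.propDecidable

lemma dir_vec {g : (Fin 3 → ℝ) ≃ₗ[ℝ] (Fin 3 → ℝ)} {x y : RP2} (hx : g x.rep 0 ≠ 0) (hy : g y.rep 0 ≠ 0)
    (h : (ph g x).1 ≠ (ph g y).1) :
    ∃ u ∈ Submodule.span ℝ {x.rep, y.rep}, g u = ![0, 1, -(inter (ph g x) (ph g y)).1] := by
  have hd : (ph g x).1 - (ph g y).1 ≠ 0 := sub_ne_zero.2 h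
  refine ⟨(1 / ((ph g x).1 - (ph g y).1)) • ((1 / g x.rep 0) • x.rep - (1 / g y.rep 0) • y.rep), ?_, ?_⟩
  · apply Submodule.smul_mem
    apply Submodule.sub_mem
    · exact Submodule.smul_mem _ _ (Submodule.subset_span (by simp))
    · exact Submodule.smul_mem _ _ (Submodule.subset_span (by simp))
  · have ex : g ((1 / g x.rep 0) • x.rep) = uu (ph g x) := by
      rw [map_smul]; nth_rewrite 2 [g_rep hx]
      rw [smul_smul, one_div, inv_mul_cancel₀ hx, one_smul]
    have ey : g ((1 / g y.rep 0) • y.rep) = uu (ph g y) := by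
      rw [map_smul]; nth_rewrite 2 [g_rep hy]
      rw [smul_smul, one_div, inv_mul_cancel₀ hy, one_smul]
    rw [map_smul, map_sub, ex, ey]
    funext i
    fin_cases i
    · simp [uu]
    · simp [uu]; field_simp
    · simp [uu, inter]; field_simp; ring

lemma numOrd_bound {P : Set RP2} (hP : P.Finite) {n : ℕ} (hn : P.ncard = n) :
    ∃ (g : (Fin 3 → ℝ) ≃ₗ[ℝ] (Fin 3 → ℝ)) (L : Finset (ℝ × ℝ)), (∀ x ∈ P, g x.rep 0 ≠ 0) ∧
      (∀ x ∈ P, ph g x ∈ L) ∧ Set.InjOn (ph g) P ∧ L.card = n ∧ Gen L ∧ N2 L ≤ numOrdinaryLines P := by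
  obtain ⟨g, h1, h2, h3⟩ := exists_chart hP.toFinset
  simp only [Set.Finite.mem_toFinset] at h1 h2 h3
  have hne : ∀ x ∈ P, ∀ y ∈ P, x ≠ y → (ph g x).1 ≠ (ph g y).1 := by
    intro x hx y hy hxy he
    apply h2 x hx y hy hxy
    simp only [ph] at he
    rw [div_eq_div_iff (h1 x hx) (h1 y hy)] at he
    linarith
  have hinj : Set.InjOn (ph g) P := by
    intro x hx y hy he
    by_contra hc
    exact hne x hx y hy hc (congrArg Prod.fst he)
  have hmem : ∀ p, p ∈ hP.toFinset.image (ph g) ↔ ∃ x ∈ P, ph g x = p := by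
    intro p; simp
  have hG : Gen (hP.toFinset.image (ph g)) := by
    constructor
    · intro p hp q hq he
      obtain ⟨x, hx, rfl⟩ := (hmem p).1 hp
      obtain ⟨y, hy, rfl⟩ := (hmem q).1 hq
      by_cases hxy : x = y
      · rw [hxy]
      · exact absurd he (hne x hx y hy hxy)
    · intro v hv w hw hvw
      simp only [Vx, Finset.mem_image, Finset.mem_offDiag] at hv hw
      obtain ⟨⟨p, q⟩, ⟨hp, hq, hpq⟩, rfl⟩ := hv
      obtain ⟨⟨r, s⟩, ⟨hr, hs, hrs⟩, rfl⟩ := hw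
      obtain ⟨x, hx, rfl⟩ := hp
      obtain ⟨y, hy, rfl⟩ := hq
      obtain ⟨z, hz, rfl⟩ := hr
      obtain ⟨t, ht, rfl⟩ := hs
      simp only [Set.Finite.mem_toFinset] at hx hy hz ht
      have hxy : x ≠ y := fun h => hpq (by rw [h])
      have hzt : z ≠ t := fun h => hrs (by rw [h])
      obtain ⟨u, hu, gu⟩ := dir_vec (h1 x hx) (h1 y hy) (hne x hx y hy hxy)
      obtain ⟨u', hu', gu'⟩ := dir_vec (h1 z hz) (h1 t ht) (hne z hz t ht hzt)
      have huu : u = u' := by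
        apply g.injective
        rw [gu, gu', hvw]
      have hspan : Submodule.span ℝ {x.rep, y.rep} = Submodule.span ℝ {z.rep, t.rep} := by
        by_contra hc
        have h0 := h3 x hx y hy z hz t ht hxy hzt hc u hu (huu ▸ hu') (by rw [gu]; simp)
        rw [h0, map_zero] at gu
        have := congrFun gu 1
        simp at this
      set v := inter (ph g x) (ph g y) with hv
      have evx : ev (ph g x) v = 0 := ev_inter_left _ _
      have evy : ev (ph g y) v = 0 := ev_inter_right (hne x hx y hy hxy)
      have key : ∀ a : RP2, a ∈ pl g v ↔ a.rep ∈ LinearMap.ker (lf g v) := by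
        intro a
        simp only [pl, Set.mem_ofPred_eq]
        rw [Projectivization.submodule_eq, Submodule.span_singleton_le_iff_mem]
      have hle : Submodule.span ℝ {z.rep, t.rep} ≤ LinearMap.ker (lf g v) := by
        rw [← hspan, Submodule.span_le]
        intro b hb
        rcases hb with rfl | rfl
        · exact (key x).1 ((mem_pl (h1 x hx)).2 evx)
        · exact (key y).1 ((mem_pl (h1 y hy)).2 evy)
      have evz : ev (ph g z) v = 0 :=
        (mem_pl (h1 z hz)).1 ((key z).2 (hle (Submodule.subset_span (by simp))))
      have evt : ev (ph g t) v = 0 :=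
        (mem_pl (h1 t ht)).1 ((key t).2 (hle (Submodule.subset_span (by simp))))
      exact pt_eq evz evt (ev_inter_left _ _) (ev_inter_right (hne z hz t ht hzt)) hrs
  refine ⟨g, hP.toFinset.image (ph g), h1, fun x hx => (hmem _).2 ⟨x, hx, rfl⟩, hinj, ?_, hG, ?_⟩
  · rw [Finset.card_image_of_injOn (by simpa using hinj), ← hn, Set.ncard_eq_toFinset_card P hP]
  · set L := hP.toFinset.image (ph g) with hLdef
    have himg : ∀ v, Set.image (ph g) (P ∩ pl g v) = (thr L v : Set (ℝ × ℝ)) := by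
      intro v
      ext p
      simp only [Set.mem_image, Set.mem_inter_iff, Finset.mem_coe, mem_thr]
      constructor
      · rintro ⟨x, ⟨hx, hx2⟩, rfl⟩
        exact ⟨(hmem _).2 ⟨x, hx, rfl⟩, (mem_pl (h1 x hx)).1 hx2⟩
      · rintro ⟨hp, he⟩
        obtain ⟨x, hx, rfl⟩ := (hmem p).1 hp
        exact ⟨x, ⟨hx, (mem_pl (h1 x hx)).2 he⟩, rfl⟩
    have hcard : ∀ v, (P ∩ pl g v).ncard = (thr L v).card := by
      intro v
      rw [← Set.ncard_coe_finset, ← himg v,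
        Set.InjOn.ncard_image (hinj.mono Set.inter_subset_left)]
    rw [N2, ← Set.ncard_coe_finset, numOrdinaryLines]
    apply Set.ncard_le_ncard_of_injOn (pl g) (ht := ord_finite hP)
    · intro v hv
      simp only [Finset.coe_filter, Set.mem_ofPred_eq] at hv
      exact ⟨pl_line g v, by rw [hcard, hv.2]⟩
    · intro v hv w hw he
      simp only [Finset.coe_filter, Set.mem_ofPred_eq] at hv hw
      have hth : thr L v = thr L w := by
        apply Finset.coe_injective
        rw [← himg, ← himg, he]
      obtain ⟨p, q, hpq, hT⟩ := Finset.card_eq_two.1 hv.2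
      have hp : p ∈ thr L v := by rw [hT]; simp
      have hq : q ∈ thr L v := by rw [hT]; simp
      have hp' := hth ▸ hp
      have hq' := hth ▸ hq
      exact pt_eq (mem_thr.1 hp).2 (mem_thr.1 hq).2 (mem_thr.1 hp').2 (mem_thr.1 hq').2 hpq

lemma diff_bound {P Z : Set RP2} {g : (Fin 3 → ℝ) ≃ₗ[ℝ] (Fin 3 → ℝ)} (hinj : Set.InjOn (ph g) P)
    (S : Finset (ℝ × ℝ)) (h : ∀ x ∈ P, x ∉ Z → ph g x ∈ S) : (P \ Z).ncard ≤ S.card := by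
  rw [← Set.ncard_coe_finset]
  apply Set.ncard_le_ncard_of_injOn (ph g)
  · intro x hx; exact h x hx.1 hx.2
  · exact hinj.mono Set.sdiff_subset

lemma const_bound {c0 e : ℕ} {K : ℝ} (hK : 1 ≤ K) {m : ℕ} (hm : m ≤ c0 * ⌈K⌉₊ ^ e) :
    (m : ℝ) ≤ ((c0 * 2 ^ e + e + 1 : ℕ) : ℝ) * K ^ ((c0 * 2 ^ e + e + 1 : ℕ) : ℝ) := by
  have h0 : (m : ℝ) ≤ c0 * (⌈K⌉₊ : ℝ) ^ e := by exact_mod_cast hm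
  have h1 : (⌈K⌉₊ : ℝ) ≤ 2 * K := by
    have := Nat.ceil_lt_add_one (by linarith : 0 ≤ K); linarith
  rw [Real.rpow_natCast]
  calc (m : ℝ) ≤ c0 * (⌈K⌉₊ : ℝ) ^ e := h0
    _ ≤ c0 * (2 * K) ^ e := by gcongr
    _ = ((c0 * 2 ^ e : ℕ) : ℝ) * K ^ e := by push_cast; ring
    _ ≤ ((c0 * 2 ^ e + e + 1 : ℕ) : ℝ) * K ^ (c0 * 2 ^ e + e + 1) := by
      apply mul_le_mul
      · exact_mod_cast (by omega)
      · exact pow_le_pow_right₀ hK (by omega)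
      · positivity
      · positivity

end FOL

open FOL in
/-- The structure theorem with `K` as large as a small power of `log log n`:
all but `O(K^{O(1)})` points of `P` lie on an irreducible cubic, the union of an
irreducible conic and a line, or a line. -/
theorem structure_theorem_slowly_growing_K :
    ∃ c C : ℝ, 0 < c ∧ 0 < C ∧
      ∀ n : ℕ, 100 ≤ n → ∀ K : ℝ, 1 ≤ K →
        K ≤ c * Real.log (Real.log n) ^ c →
        ∀ P : Set RP2, P.Finite → P.ncard = n →
          (numOrdinaryLines P : ℝ) ≤ K * n →
          ∃ Z : Set RP2,
            (IsIrreducibleCubic Z ∨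
             (∃ σ L : Set RP2, IsIrreducibleConic σ ∧ IsProjLine L ∧ Z = σ ∪ L) ∨
             IsProjLine Z) ∧
            ((P \ Z).ncard : ℝ) ≤ C * K ^ C := by
  classical
  obtain ⟨c0, e, hf⟩ := PB_fPhi
  refine ⟨1, ((c0 * 2 ^ e + e + 1 : ℕ) : ℝ), one_pos, by positivity, ?_⟩
  intro n _ K hK _ P hP hn hord
  obtain ⟨g, L, h0, hmem, hinj, hcard, hG, hN⟩ := numOrd_bound hP hn
  have hk : 1 ≤ ⌈K⌉₊ := Nat.one_le_ceil_iff.2 (by linarith)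
  have hN2 : N2 L ≤ ⌈K⌉₊ * L.card := by
    have h1 : (numOrdinaryLines P : ℝ) ≤ (⌈K⌉₊ : ℝ) * n :=
      hord.trans (mul_le_mul_of_nonneg_right (Nat.le_ceil K) (by positivity))
    have h2 : numOrdinaryLines P ≤ ⌈K⌉₊ * n := by exact_mod_cast h1
    rw [hcard]; omega
  have hfk := hf _ hk
  rcases affine_main _ hk hG hN2 with h | ⟨G, hGi, hG3, h⟩ | ⟨σ, hσi, hσ2, o, h⟩ | ⟨o, h⟩
  · refine ⟨pl g 0, Or.inr (Or.inr (pl_line g 0)), const_bound hK (le_trans ?_ (h.trans hfk))⟩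
    exact diff_bound hinj L fun x hx _ => hmem x hx
  · refine ⟨{x : RP2 | MvPolynomial.eval x.rep (pull g G) = 0},
      Or.inl ⟨pull g G, pull_irr g hGi, pull_hom g hG3, rfl⟩, const_bound hK (le_trans ?_ (h.trans hfk))⟩
    refine diff_bound hinj _ fun x hx hxZ => ?_
    rw [mem_off]
    exact ⟨hmem x hx, fun hz => hxZ ((pull_zero hG3 (h0 x hx)).2 hz)⟩
  · refine ⟨{x : RP2 | MvPolynomial.eval x.rep (pull g σ) = 0} ∪ pl g o,
      Or.inr (Or.inl ⟨_, _, ⟨pull g σ, pull_irr g hσi, pull_hom g hσ2, rfl⟩, pl_line g o, rfl⟩),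
      const_bound hK (le_trans ?_ (h.trans hfk))⟩
    refine diff_bound hinj _ fun x hx hxZ => ?_
    rw [Finset.mem_filter, mem_off]
    refine ⟨⟨hmem x hx, fun hz => hxZ (Or.inl ((pull_zero hσ2 (h0 x hx)).2 hz))⟩, fun hz => ?_⟩
    exact hxZ (Or.inr ((mem_pl (h0 x hx)).2 hz))
  · refine ⟨pl g o, Or.inr (Or.inr (pl_line g o)), const_bound hK (le_trans ?_ (h.trans hfk))⟩
    refine diff_bound hinj _ fun x hx hxZ => ?_
    rw [Finset.mem_filter]
    exact ⟨hmem x hx, fun hz => hxZ ((mem_pl (h0 x hx)).2 hz)⟩
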